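/- arXiv:0812.4244 — 2 statements merged into one kernel-verified Lean document; each statement's English description precedes it below -/
import Mathlib

section
/- Let Ω ⊂ ℝ² be open. If u : Ω → ℝ is continuously differentiable and a weak solution of div(f'(‖∇u‖)∇u/‖∇u‖) = 0 in Ω, then u cannot have isolated critical points: there exist no z₀ ∈ Ω and r > 0 with ∇u(z₀) = 0 and ∇u(z) ≠ 0 for all z with 0 < ‖z − z₀‖ < r. -/
open Set MeasureTheory Metric Filter
open scoped RealInnerProductSpace Topology Classical

noncomputable section

abbrev E2 := EuclideanSpace ℝ (Fin 2)

/-- A function is Lipschitz on a set (with some constant). -/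
def LipOn (w : E2 → ℝ) (s : Set E2) : Prop := ∃ L : NNReal, LipschitzOnWith L w s

/-- The functional `J(w) = ∫_Ω f(‖∇w‖)`, with `∇w` the a.e.-defined (Rademacher) gradient,
extended by the junk value `0` where `w` is not differentiable. -/
def J (f : ℝ → ℝ) (Ω : Set E2) (w : E2 → ℝ) : ℝ := ∫ x in Ω, f ‖gradient w x‖

/-- The (one-sided at `0`) derivative of `f` on `[0,∞)`. -/
def dtop (f : ℝ → ℝ) : ℝ → ℝ := derivWithin f (Set.Ici 0)

/-- Standing assumptions on the Lagrangian `f` : strictly convex on `[0,∞)`, `C¹` on `[0,∞)`,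
`C²` on `(0,∞)` with `f''` locally Hölder continuous of some exponent `λ ∈ (0,1)`,
and `f'(0) > 0`. -/
def StdF (f : ℝ → ℝ) : Prop :=
  StrictConvexOn ℝ (Set.Ici 0) f ∧ ContDiffOn ℝ 1 f (Set.Ici 0) ∧
  ContDiffOn ℝ 2 f (Set.Ioi 0) ∧
  (∃ lam : NNReal, 0 < lam ∧ lam < 1 ∧ ∀ K : Set ℝ, IsCompact K → K ⊆ Set.Ioi 0 →
    ∃ C : NNReal, HolderOnWith C lam (deriv (dtop f)) K) ∧
  0 < dtop f 0

/-- `u` solves the variational problem (P): `u` is Lipschitz on the closure of `Ω`,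
`u = ψ` on `∂Ω`, and `u` minimizes `J` among such functions. -/
def SolvesP (f : ℝ → ℝ) (Ω : Set E2) (ψ : E2 → ℝ) (u : E2 → ℝ) : Prop :=
  LipOn u (closure Ω) ∧ EqOn u ψ (frontier Ω) ∧
  ∀ w : E2 → ℝ, LipOn w (closure Ω) → EqOn w ψ (frontier Ω) → J f Ω u ≤ J f Ω w

/-- `u` has an isolated critical point in `Ω`. -/
def HasIsolatedCritPt (Ω : Set E2) (u : E2 → ℝ) : Prop :=
  ∃ z₀ ∈ Ω, ∃ r > (0:ℝ), gradient u z₀ = 0 ∧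
    ∀ z ∈ Ω, z ≠ z₀ → dist z z₀ < r → gradient u z ≠ 0

/-- `u` is a weak solution of `div(f'(‖∇u‖)∇u/‖∇u‖) = 0` in `Ω`: the integral identity holds
against every smooth test function compactly supported in `Ω`, the integrand being `0` at
critical points of `u`. -/
def WeakSol (f' : ℝ → ℝ) (Ω : Set E2) (u : E2 → ℝ) : Prop :=
  ∀ φ : E2 → ℝ, ContDiff ℝ (⊤ : ℕ∞) φ → HasCompactSupport φ → tsupport φ ⊆ Ω →
    (∫ z in Ω, (if gradient u z = 0 then 0 else
      f' ‖gradient u z‖ * ⟪(‖gradient u z‖)⁻¹ • gradient u z, gradient φ z⟫)) = 0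

namespace CriticalPoint

section Brackets

theorem lineDeriv_eq_zero_of_notMem_tsupport {E : Type*} [NormedAddCommGroup E] [NormedSpace ℝ E]
    {k : E → ℝ} {x : E} (hx : x ∉ tsupport k) (v : E) : lineDeriv ℝ k x v = 0 := by
  have h : k =ᶠ[𝓝 x] fun _ => (0 : ℝ) := notMem_tsupport_iff_eventuallyEq.1 hx
  rw [h.lineDeriv_eq]
  simp [lineDeriv]

variable {E : Type*} [NormedAddCommGroup E] [NormedSpace ℝ E] [FiniteDimensional ℝ E]
  [MeasurableSpace E] [BorelSpace E] {μ : Measure E} [μ.IsAddHaarMeasure]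

theorem integrable_lineDeriv_of_hasCompactSupport {D : NNReal} {k : E → ℝ}
    (hk : LipschitzWith D k) (hkc : HasCompactSupport k) (v : E) :
    Integrable (fun x => lineDeriv ℝ k x v) μ := by
  refine (integrableOn_iff_integrable_of_support_subset (s := tsupport k) ?_).1 ?_
  · intro x hx
    by_contra h
    exact hx (lineDeriv_eq_zero_of_notMem_tsupport h v)
  · exact (hk.locallyIntegrable_lineDeriv v).integrableOn_isCompact hkc

theorem integrable_lineDeriv_mul_lineDeriv {C D : NNReal} {g k : E → ℝ} (hg : LipschitzWith C g)
    (hk : LipschitzWith D k) (hkc : HasCompactSupport k) (v w : E) :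
    Integrable (fun x => lineDeriv ℝ g x v * lineDeriv ℝ k x w) μ := by
  refine Integrable.bdd_mul (c := C * ‖v‖) (integrable_lineDeriv_of_hasCompactSupport hk hkc w)
    (measurable_lineDeriv hg.continuous).aestronglyMeasurable ?_
  exact Eventually.of_forall fun x => norm_lineDeriv_le_of_lipschitz ℝ hg

/-- The distributional identity behind the vanishing of the integral of a Jacobian: mixed products
of partial derivatives of Lipschitz functions, one of them compactly supported, may be swapped
under the integral sign. -/
theorem integral_lineDeriv_mul_lineDeriv_comm {C D : NNReal} {g k : E → ℝ}
    (hg : LipschitzWith C g) (hk : LipschitzWith D k) (hkc : HasCompactSupport k) (v w : E) :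
    ∫ x, lineDeriv ℝ g x v * lineDeriv ℝ k x w ∂μ =
      ∫ x, lineDeriv ℝ g x w * lineDeriv ℝ k x v ∂μ := by
  obtain ⟨R, hR⟩ : ∃ R : ℝ, tsupport k ⊆ closedBall 0 R := hkc.isBounded.subset_closedBall 0
  set S : Set E := closedBall 0 (R + ‖w‖) with hS
  have hkS : ∀ x ∉ S, lineDeriv ℝ k x w = 0 := fun x hx =>
    lineDeriv_eq_zero_of_notMem_tsupport (fun h => hx (closedBall_subset_closedBall
      (by linarith [norm_nonneg w]) (hR h))) w
  have hk0 : ∀ x ∉ closedBall (0 : E) R, k x = 0 := fun x hx =>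
    image_eq_zero_of_notMem_tsupport fun h => hx (hR h)
  set gS : E → ℝ := S.indicator fun x => lineDeriv ℝ g x v with hgS
  have hgSi : Integrable gS μ := by
    rw [hgS, integrable_indicator_iff measurableSet_closedBall]
    exact (hg.locallyIntegrable_lineDeriv v).integrableOn_isCompact (isCompact_closedBall _ _)
  have h1 := hk.integral_inv_smul_sub_mul_tendsto_integral_lineDeriv_mul hgSi w
  have h2 := hg.integral_inv_smul_sub_mul_tendsto_integral_lineDeriv_mul
    (integrable_lineDeriv_of_hasCompactSupport (μ := μ) hk hkc v) (-w)
  have e1 : ∫ x, lineDeriv ℝ k x w * gS x ∂μ = ∫ x, lineDeriv ℝ g x v * lineDeriv ℝ k x w ∂μ := by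
    refine integral_congr_ae (Eventually.of_forall fun x => ?_)
    by_cases hx : x ∈ S
    · simp [hgS, hx, mul_comm]
    · simp [hkS x hx]
  have e2 : ∫ x, lineDeriv ℝ g x (-w) * lineDeriv ℝ k x v ∂μ =
      -∫ x, lineDeriv ℝ g x w * lineDeriv ℝ k x v ∂μ := by
    rw [← integral_neg]
    refine integral_congr_ae (Eventually.of_forall fun x => ?_)
    simp [lineDeriv_neg]
  rw [e1] at h1
  rw [e2] at h2
  have h2neg := h2.neg
  rw [neg_neg] at h2neg
  refine tendsto_nhds_unique (h1.congr' ?_) h2neg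
  have hlt : ∀ᶠ t : ℝ in 𝓝[>] 0, t < 1 := by
    have : Iio (1 : ℝ) ∈ 𝓝 (0 : ℝ) := Iio_mem_nhds one_pos
    exact mem_nhdsWithin_of_mem_nhds this
  filter_upwards [hlt, self_mem_nhdsWithin] with t ht1 (ht0 : 0 < t)
  set q : E → ℝ := fun x => t⁻¹ • (k (x + t • w) - k x) with hq
  have hkt : LipschitzWith D fun x => k (x + t • w) := by
    refine LipschitzWith.of_dist_le_mul fun x y => ?_
    simpa using hk.dist_le_mul (x + t • w) (y + t • w)
  have hqL : LipschitzWith (‖t⁻¹‖₊ * (D + D)) q := by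
    refine LipschitzWith.of_dist_le_mul fun x y => ?_
    simp only [hq, dist_smul₀]
    push_cast
    rw [mul_assoc]
    gcongr
    exact_mod_cast (hkt.sub hk).dist_le_mul x y
  have hq0 : ∀ x ∉ S, q x = 0 := by
    intro x hx
    have hx' : R + ‖w‖ < ‖x‖ := by simpa [hS] using hx
    have hw : ‖t • w‖ ≤ ‖w‖ := by
      rw [norm_smul, Real.norm_of_nonneg ht0.le]
      nlinarith [norm_nonneg w]
    have a1 : k x = 0 := hk0 x (by simp; linarith [norm_nonneg w])
    have a2 : k (x + t • w) = 0 := hk0 _ (by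
      have := norm_sub_norm_le x (-(t • w))
      simp only [norm_neg, sub_neg_eq_add] at this
      simp; linarith)
    simp [hq, a1, a2]
  have hqc : HasCompactSupport q := HasCompactSupport.intro (isCompact_closedBall _ _) hq0
  have s1 : ∫ x, q x * gS x ∂μ = ∫ x, lineDeriv ℝ g x v * q x ∂μ := by
    refine integral_congr_ae (Eventually.of_forall fun x => ?_)
    by_cases hx : x ∈ S
    · simp [hgS, hx, mul_comm]
    · simp [hq0 x hx]
  have s2 := LipschitzWith.integral_lineDeriv_mul_eq (μ := μ) hg hqL hqc v
  have hdk := hk.ae_differentiableAt (μ := μ)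
  have hdk' : ∀ᵐ x ∂μ, DifferentiableAt ℝ k (x + t • w) :=
    (measurePreserving_add_right μ (t • w)).quasiMeasurePreserving.ae hdk
  have s3 : ∫ x, lineDeriv ℝ q x (-v) * g x ∂μ =
      -∫ x, t⁻¹ • (lineDeriv ℝ k (x + t • w) v - lineDeriv ℝ k x v) * g x ∂μ := by
    rw [← integral_neg]
    refine integral_congr_ae ?_
    filter_upwards [hdk, hdk'] with x hx hx'
    have a1 : HasFDerivAt (fun y => k (y + t • w)) (fderiv ℝ k (x + t • w)) x :=
      (hasFDerivAt_comp_add_right (t • w)).2 hx'.hasFDerivAt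
    have a2 := ((a1.sub hx.hasFDerivAt).const_smul t⁻¹).hasLineDerivAt (-v)
    have a3 : lineDeriv ℝ q x (-v) = _ := a2.lineDeriv
    rw [a3, hx.lineDeriv_eq_fderiv, hx'.lineDeriv_eq_fderiv]
    simp
    ring
  have hki := integrable_lineDeriv_of_hasCompactSupport (μ := μ) hk hkc v
  have hkgi : Integrable (fun x => lineDeriv ℝ k x v * g x) μ := by
    refine (integrableOn_iff_integrable_of_support_subset (s := tsupport k) ?_).1 ?_
    · intro x hx
      by_contra h
      exact hx (by simp [lineDeriv_eq_zero_of_notMem_tsupport h v])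
    · exact hki.integrableOn.mul_continuousOn hg.continuous.continuousOn hkc
  have hkgi' : Integrable (fun x => lineDeriv ℝ k x v * g (x + t • (-w))) μ := by
    refine (integrableOn_iff_integrable_of_support_subset (s := tsupport k) ?_).1 ?_
    · intro x hx
      by_contra h
      exact hx (by simp [lineDeriv_eq_zero_of_notMem_tsupport h v])
    · exact hki.integrableOn.mul_continuousOn
        (hg.continuous.comp (continuous_id.add continuous_const)).continuousOn hkc
  have hkgi'' : Integrable (fun x => lineDeriv ℝ k (x + t • w) v * g x) μ := by
    have := hkgi'.comp_add_right (t • w)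
    simpa using this
  have s4 : ∫ x, lineDeriv ℝ k (x + t • w) v * g x ∂μ =
      ∫ x, lineDeriv ℝ k x v * g (x + t • (-w)) ∂μ := by
    rw [← integral_add_right_eq_self (μ := μ)
      (fun x => lineDeriv ℝ k x v * g (x + t • (-w))) (t • w)]
    simp
  change ∫ x, q x * gS x ∂μ = -∫ x, t⁻¹ • (g (x + t • (-w)) - g x) * lineDeriv ℝ k x v ∂μ
  rw [s1, s2, s3]
  congr 1
  have l1 : ∀ x, t⁻¹ • (lineDeriv ℝ k (x + t • w) v - lineDeriv ℝ k x v) * g x =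
      t⁻¹ * (lineDeriv ℝ k (x + t • w) v * g x - lineDeriv ℝ k x v * g x) := by
    intro x; simp; ring
  have l2 : ∀ x, t⁻¹ • (g (x + t • (-w)) - g x) * lineDeriv ℝ k x v =
      t⁻¹ * (lineDeriv ℝ k x v * g (x + t • (-w)) - lineDeriv ℝ k x v * g x) := by
    intro x; simp; ring
  simp_rw [l1, l2, integral_const_mul]
  rw [integral_sub hkgi'' hkgi, integral_sub hkgi' hkgi, s4]

end Brackets

/-- The Jacobian determinant of a real-linear endomorphism of the plane. -/
def jac (A : ℂ →L[ℝ] ℂ) : ℝ := (A 1).re * (A Complex.I).im - (A 1).im * (A Complex.I).re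

theorem det_eq_jac (A : ℂ →L[ℝ] ℂ) : A.det = jac A := by
  rw [ContinuousLinearMap.det, ← LinearMap.det_toMatrix Complex.basisOneI, Matrix.det_fin_two]
  simp [LinearMap.toMatrix_apply, jac]
  ring

theorem continuous_jac : Continuous jac := by
  unfold jac
  fun_prop

theorem jac_smul (c : ℝ) (A : ℂ →L[ℝ] ℂ) : jac (c • A) = c ^ 2 * jac A := by
  simp [jac]; ring

theorem abs_jac_le (A : ℂ →L[ℝ] ℂ) : |jac A| ≤ 2 * ‖A‖ ^ 2 := by
  have h1 : ‖A 1‖ ≤ ‖A‖ := by simpa using A.le_opNorm 1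
  have h2 : ‖A Complex.I‖ ≤ ‖A‖ := by simpa using A.le_opNorm Complex.I
  have a1 := (Complex.abs_re_le_norm (A 1)).trans h1
  have a2 := (Complex.abs_im_le_norm (A 1)).trans h1
  have a3 := (Complex.abs_re_le_norm (A Complex.I)).trans h2
  have a4 := (Complex.abs_im_le_norm (A Complex.I)).trans h2
  have := abs_sub ((A 1).re * (A Complex.I).im) ((A 1).im * (A Complex.I).re)
  rw [abs_mul, abs_mul] at this
  have b1 := mul_le_mul a1 a4 (abs_nonneg _) (norm_nonneg _)
  have b2 := mul_le_mul a2 a3 (abs_nonneg _) (norm_nonneg _)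
  unfold jac
  nlinarith

/-- A smooth bump on the line, positive exactly on `(-1, 1)`. -/
def lineBump : ContDiffBump (0 : ℝ) := ⟨1 / 2, 1, by norm_num, by norm_num⟩

theorem exists_lipschitzWith_lineBump : ∃ C, LipschitzWith C (lineBump : ℝ → ℝ) :=
  ContDiff.lipschitzWith_of_hasCompactSupport lineBump.hasCompactSupport
    (lineBump.contDiff (n := 1)) one_ne_zero

theorem lineBump_pos {s : ℝ} (hs : |s| < 1) : 0 < lineBump s :=
  lineBump.pos_of_mem_ball (by simpa [lineBump] using hs)

theorem lineBump_eq_zero {s : ℝ} (hs : 1 ≤ |s|) : lineBump s = 0 :=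
  lineBump.zero_of_le_dist (by simpa [lineBump] using hs)

/-- A primitive of the line bump. -/
def bumpPrimitive (s : ℝ) : ℝ := ∫ t in (0 : ℝ)..s, lineBump t

theorem hasDerivAt_bumpPrimitive (s : ℝ) : HasDerivAt bumpPrimitive (lineBump s) s :=
  intervalIntegral.integral_hasDerivAt_right (lineBump.continuous.intervalIntegrable _ _)
    (lineBump.continuous.stronglyMeasurableAtFilter _ _) lineBump.continuous.continuousAt

theorem lipschitzWith_bumpPrimitive : LipschitzWith 1 bumpPrimitive := by
  refine lipschitzWith_of_nnnorm_deriv_le (fun s => (hasDerivAt_bumpPrimitive s).differentiableAt)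
    fun s => ?_
  rw [(hasDerivAt_bumpPrimitive s).deriv, ← NNReal.coe_le_coe, coe_nnnorm,
    Real.norm_of_nonneg lineBump.nonneg]
  exact lineBump.le_one

theorem exists_abs_bumpPrimitive_le : ∃ M, ∀ s, |bumpPrimitive s| ≤ M := by
  refine ⟨∫ t, lineBump t, fun s => ?_⟩
  have hi : Integrable (lineBump : ℝ → ℝ) :=
    lineBump.continuous.integrable_of_hasCompactSupport lineBump.hasCompactSupport
  refine (intervalIntegral.norm_integral_le_integral_norm_uIoc (f := lineBump) (a := 0)
    (b := s)).trans ?_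
  simp_rw [fun t => Real.norm_of_nonneg (lineBump.nonneg' t)]
  exact setIntegral_le_integral hi (Eventually.of_forall fun t => lineBump.nonneg' t)

/-- A continuous weight on the plane, positive exactly on the open square `(-1, 1)²`. -/
def weight (w : ℂ) : ℝ := lineBump w.re * lineBump w.im

theorem continuous_weight : Continuous weight := by
  unfold weight
  exact (lineBump.continuous.comp Complex.continuous_re).mul
    (lineBump.continuous.comp Complex.continuous_im)

theorem weight_nonneg (w : ℂ) : 0 ≤ weight w := mul_nonneg lineBump.nonneg lineBump.nonneg

theorem weight_le_one (w : ℂ) : weight w ≤ 1 :=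
  mul_le_one₀ lineBump.le_one lineBump.nonneg lineBump.le_one

theorem weight_pos {w : ℂ} (h1 : |w.re| < 1) (h2 : |w.im| < 1) : 0 < weight w :=
  mul_pos (lineBump_pos h1) (lineBump_pos h2)

theorem weight_eq_zero {w : ℂ} (hw : 2 ≤ ‖w‖) : weight w = 0 := by
  have := Complex.norm_le_abs_re_add_abs_im w
  unfold weight
  by_cases h : 1 ≤ |w.re|
  · simp [lineBump_eq_zero h]
  · simp [lineBump_eq_zero (s := w.im) (by linarith)]

/-- The first component of a potential of the weight. -/
def weightPotential (w : ℂ) : ℝ := bumpPrimitive w.re * lineBump w.im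

theorem exists_lipschitzWith_weightPotential : ∃ C, LipschitzWith C weightPotential := by
  obtain ⟨C, hC⟩ := exists_lipschitzWith_lineBump
  obtain ⟨M, hM⟩ := exists_abs_bumpPrimitive_le
  have hM0 : 0 ≤ M := (abs_nonneg _).trans (hM 0)
  refine ⟨1 + ⟨M, hM0⟩ * C, LipschitzWith.of_dist_le_mul fun w w' => ?_⟩
  have h1 : |bumpPrimitive w.re - bumpPrimitive w'.re| ≤ ‖w - w'‖ := by
    have := lipschitzWith_bumpPrimitive.dist_le_mul w.re w'.re
    rw [Real.dist_eq, Real.dist_eq] at this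
    refine this.trans ?_
    simpa using Complex.abs_re_le_norm (w - w')
  have h2 : |lineBump w.im - lineBump w'.im| ≤ C * ‖w - w'‖ := by
    have := hC.dist_le_mul w.im w'.im
    rw [Real.dist_eq, Real.dist_eq] at this
    refine this.trans ?_
    gcongr
    simpa using Complex.abs_im_le_norm (w - w')
  have e : weightPotential w - weightPotential w' =
      (bumpPrimitive w.re - bumpPrimitive w'.re) * lineBump w.im +
        bumpPrimitive w'.re * (lineBump w.im - lineBump w'.im) := by
    unfold weightPotential; ring
  rw [Real.dist_eq, dist_eq_norm, e]
  refine (abs_add_le _ _).trans ?_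
  rw [abs_mul, abs_mul, abs_of_nonneg (lineBump.nonneg' w.im)]
  have b1 := mul_le_mul h1 (lineBump.le_one (x := w.im)) lineBump.nonneg (norm_nonneg _)
  have b2 := mul_le_mul (hM w'.re) h2 (abs_nonneg _) hM0
  push_cast
  change _ ≤ (1 + M * C) * _
  linarith

theorem lineDeriv_weightPotential_comp {Φ : ℂ → ℂ} {z : ℂ} (h : DifferentiableAt ℝ Φ z) (v : ℂ) :
    lineDeriv ℝ (fun z => weightPotential (Φ z)) z v =
      weight (Φ z) * (fderiv ℝ Φ z v).re +
        bumpPrimitive (Φ z).re * deriv lineBump (Φ z).im * (fderiv ℝ Φ z v).im := by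
  have h0 := h.hasFDerivAt.hasLineDerivAt v
  have hΦ : HasDerivAt (fun t : ℝ => Φ (z + t • v)) (fderiv ℝ Φ z v) 0 := h0
  have e : Φ (z + (0 : ℝ) • v) = Φ z := by simp
  have hre : HasDerivAt (fun t : ℝ => (Φ (z + t • v)).re) (fderiv ℝ Φ z v).re 0 :=
    (Complex.reCLM.hasFDerivAt.comp_hasDerivAt (0 : ℝ) hΦ)
  have him : HasDerivAt (fun t : ℝ => (Φ (z + t • v)).im) (fderiv ℝ Φ z v).im 0 :=
    (Complex.imCLM.hasFDerivAt.comp_hasDerivAt (0 : ℝ) hΦ)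
  have hb : HasDerivAt lineBump (deriv lineBump (Φ z).im) (Φ z).im :=
    ((lineBump.contDiff (n := 1)).differentiable one_ne_zero _).hasDerivAt
  have h1 := HasDerivAt.comp (0 : ℝ) (h₂ := bumpPrimitive) (h := fun t : ℝ => (Φ (z + t • v)).re)
    (by simpa only [e] using hasDerivAt_bumpPrimitive (Φ z).re) hre
  have h2 := HasDerivAt.comp (0 : ℝ) (h₂ := lineBump) (h := fun t : ℝ => (Φ (z + t • v)).im)
    (by simpa only [e] using hb) him
  have h3 := (h1.mul h2).deriv
  simp only [Function.comp_def, zero_smul, add_zero] at h3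
  unfold lineDeriv weightPotential
  refine Eq.trans h3 ?_
  unfold weight
  ring

theorem bracket_weightPotential {Φ : ℂ → ℂ} {z : ℂ} (h : DifferentiableAt ℝ Φ z) :
    lineDeriv ℝ (fun z => weightPotential (Φ z)) z 1 *
        lineDeriv ℝ (fun z => (Φ z).im) z Complex.I -
      lineDeriv ℝ (fun z => weightPotential (Φ z)) z Complex.I *
        lineDeriv ℝ (fun z => (Φ z).im) z 1 = weight (Φ z) * jac (fderiv ℝ Φ z) := by
  have him : ∀ v, lineDeriv ℝ (fun z => (Φ z).im) z v = (fderiv ℝ Φ z v).im := fun v =>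
    ((Complex.imCLM.hasFDerivAt.comp z h.hasFDerivAt).hasLineDerivAt v).lineDeriv
  rw [lineDeriv_weightPotential_comp h, lineDeriv_weightPotential_comp h, him, him, jac]
  ring

theorem integrable_weight_jac {K : NNReal} {Φ : ℂ → ℂ} (hΦ : LipschitzWith K Φ) {s : Set ℂ}
    (hs : volume s < ⊤) :
    IntegrableOn (fun z => weight (Φ z) * jac (fderiv ℝ Φ z)) s := by
  refine IntegrableOn.of_bound hs ?_ (2 * K ^ 2) (Eventually.of_forall fun z => ?_)
  · exact ((continuous_weight.comp hΦ.continuous).measurable.mul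
      (continuous_jac.measurable.comp (measurable_fderiv ℝ Φ))).aestronglyMeasurable
  · rw [norm_mul, Real.norm_of_nonneg (weight_nonneg _), Real.norm_eq_abs]
    have h1 := abs_jac_le (fderiv ℝ Φ z)
    have h2 : ‖fderiv ℝ Φ z‖ ≤ K := norm_fderiv_le_of_lipschitz ℝ hΦ
    have h3 : ‖fderiv ℝ Φ z‖ ^ 2 ≤ K ^ 2 := by gcongr
    have := mul_le_mul (weight_le_one (Φ z)) (h1.trans (by linarith : _ ≤ 2 * (K : ℝ) ^ 2))
      (abs_nonneg _) zero_le_one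
    linarith

/-- Two Lipschitz maps of the plane which agree outside a ball have the same weighted total
Jacobian. -/
theorem integral_weight_jac_sub_eq_zero {K K' : NNReal} {Φ Φ' : ℂ → ℂ} (hΦ : LipschitzWith K Φ)
    (hΦ' : LipschitzWith K' Φ') {R : ℝ} (h : ∀ z, R ≤ ‖z‖ → Φ z = Φ' z) :
    ∫ z, (weight (Φ z) * jac (fderiv ℝ Φ z) - weight (Φ' z) * jac (fderiv ℝ Φ' z)) = 0 := by
  obtain ⟨C, hC⟩ := exists_lipschitzWith_weightPotential
  have hN : LipschitzWith (C * K) fun z => weightPotential (Φ z) :=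
    LipschitzWith.of_dist_le_mul fun x y => by exact_mod_cast (hC.comp hΦ).dist_le_mul x y
  have hN' : LipschitzWith (C * K') fun z => weightPotential (Φ' z) :=
    LipschitzWith.of_dist_le_mul fun x y => by exact_mod_cast (hC.comp hΦ').dist_le_mul x y
  have im_lip : ∀ {L : NNReal} {Ψ : ℂ → ℂ}, LipschitzWith L Ψ →
      LipschitzWith L fun z => (Ψ z).im := fun {_ Ψ} hΨ => LipschitzWith.of_dist_le_mul fun x y =>
    le_trans (by
      rw [Real.dist_eq, dist_eq_norm]; simpa using Complex.abs_im_le_norm (Ψ x - Ψ y)) (hΨ.dist_le_mul x y)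
  have hV := im_lip hΦ
  have hV' := im_lip hΦ'
  have hout : ∀ z ∉ closedBall (0 : ℂ) R, Φ z = Φ' z := fun z hz => h z (by
    have : R < ‖z‖ := by simpa using hz
    exact this.le)
  have c1 : HasCompactSupport fun z => weightPotential (Φ z) - weightPotential (Φ' z) :=
    HasCompactSupport.intro (isCompact_closedBall 0 R) fun z hz => by simp [hout z hz]
  have c2 : HasCompactSupport fun z => (Φ z).im - (Φ' z).im :=
    HasCompactSupport.intro (isCompact_closedBall 0 R) fun z hz => by simp [hout z hz]
  have l1 : LipschitzWith (C * K + C * K') fun z => weightPotential (Φ z) - weightPotential (Φ' z) :=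
    hN.sub hN'
  have l2 : LipschitzWith (K + K') fun z => (Φ z).im - (Φ' z).im := hV.sub hV'
  have e1 := integral_lineDeriv_mul_lineDeriv_comm (μ := volume) hV l1 c1 Complex.I 1
  have e2 := integral_lineDeriv_mul_lineDeriv_comm (μ := volume) hN' l2 c2 1 Complex.I
  have i1 := fun v w => integrable_lineDeriv_mul_lineDeriv (μ := volume) hV l1 c1 v w
  have i2 := fun v w => integrable_lineDeriv_mul_lineDeriv (μ := volume) hN' l2 c2 v w
  have hae : (fun z => weight (Φ z) * jac (fderiv ℝ Φ z) - weight (Φ' z) * jac (fderiv ℝ Φ' z))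
      =ᵐ[volume] fun z =>
      (lineDeriv ℝ (fun z => (Φ z).im) z Complex.I *
          lineDeriv ℝ (fun z => weightPotential (Φ z) - weightPotential (Φ' z)) z 1 -
        lineDeriv ℝ (fun z => (Φ z).im) z 1 *
          lineDeriv ℝ (fun z => weightPotential (Φ z) - weightPotential (Φ' z)) z Complex.I) +
      (lineDeriv ℝ (fun z => weightPotential (Φ' z)) z 1 *
          lineDeriv ℝ (fun z => (Φ z).im - (Φ' z).im) z Complex.I -
        lineDeriv ℝ (fun z => weightPotential (Φ' z)) z Complex.I *
          lineDeriv ℝ (fun z => (Φ z).im - (Φ' z).im) z 1) := by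
    filter_upwards [hΦ.ae_differentiableAt (μ := volume), hΦ'.ae_differentiableAt (μ := volume),
      hN.ae_differentiableAt (μ := volume), hN'.ae_differentiableAt (μ := volume),
      hV.ae_differentiableAt (μ := volume), hV'.ae_differentiableAt (μ := volume)]
      with z d d' dN dN' dV dV'
    rw [← bracket_weightPotential d, ← bracket_weightPotential d']
    have s1 : ∀ v, lineDeriv ℝ (fun z => weightPotential (Φ z) - weightPotential (Φ' z)) z v =
        lineDeriv ℝ (fun z => weightPotential (Φ z)) z v -
          lineDeriv ℝ (fun z => weightPotential (Φ' z)) z v := fun v => by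
      rw [dN.lineDeriv_eq_fderiv, dN'.lineDeriv_eq_fderiv]
      exact ((dN.hasFDerivAt.sub dN'.hasFDerivAt).hasLineDerivAt v).lineDeriv
    have s2 : ∀ v, lineDeriv ℝ (fun z => (Φ z).im - (Φ' z).im) z v =
        lineDeriv ℝ (fun z => (Φ z).im) z v - lineDeriv ℝ (fun z => (Φ' z).im) z v := fun v => by
      rw [dV.lineDeriv_eq_fderiv, dV'.lineDeriv_eq_fderiv]
      exact ((dV.hasFDerivAt.sub dV'.hasFDerivAt).hasLineDerivAt v).lineDeriv
    rw [s1, s1, s2, s2]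
    ring
  have t1 := integral_sub (i1 Complex.I 1) (i1 1 Complex.I)
  have t2 := integral_sub (i2 1 Complex.I) (i2 Complex.I 1)
  have t3 := integral_add ((i1 Complex.I 1).sub (i1 1 Complex.I))
    ((i2 1 Complex.I).sub (i2 Complex.I 1))
  simp only [Pi.sub_apply] at t3
  rw [integral_congr_ae hae, t3, t1, t2, e1, e2]
  ring

/-- The weighted total Jacobian of `Φ` over the ball of radius `r`. -/
def degInt (r : ℝ) (Φ : ℂ → ℂ) : ℝ := ∫ z in ball (0 : ℂ) r, weight (Φ z) * jac (fderiv ℝ Φ z)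

/-- A Lipschitz cutoff, equal to `1` for `‖z‖ ≤ r` and to `0` for `R ≤ ‖z‖`. -/
def cutoff (r R : ℝ) (z : ℂ) : ℝ := max 0 (min 1 ((R - ‖z‖) / (R - r)))

theorem cutoff_nonneg (r R : ℝ) (z : ℂ) : 0 ≤ cutoff r R z := le_max_left _ _

theorem cutoff_le_one (r R : ℝ) (z : ℂ) : cutoff r R z ≤ 1 :=
  max_le zero_le_one (min_le_left _ _)

theorem cutoff_eq_one {r R : ℝ} (h : r < R) {z : ℂ} (hz : ‖z‖ ≤ r) : cutoff r R z = 1 := by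
  have : 1 ≤ (R - ‖z‖) / (R - r) := by
    rw [le_div_iff₀ (by linarith)]; linarith
  simp [cutoff, this]

theorem cutoff_eq_zero {r R : ℝ} (h : r < R) {z : ℂ} (hz : R ≤ ‖z‖) : cutoff r R z = 0 := by
  have : (R - ‖z‖) / (R - r) ≤ 0 := div_nonpos_of_nonpos_of_nonneg (by linarith) (by linarith)
  unfold cutoff
  exact max_eq_left ((min_le_right _ _).trans this)

theorem exists_lipschitzWith_cutoff {r R : ℝ} (h : r < R) : ∃ C, LipschitzWith C (cutoff r R) := by
  have h0 : 0 < R - r := by linarith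
  have h1 : LipschitzWith (Real.toNNReal (1 / (R - r))) fun z : ℂ => (R - ‖z‖) / (R - r) := by
    refine LipschitzWith.of_dist_le_mul fun x y => ?_
    rw [Real.coe_toNNReal _ (by positivity), Real.dist_eq, dist_eq_norm, ← sub_div, abs_div,
      abs_of_pos h0, div_eq_mul_one_div, mul_comm]
    gcongr
    have := abs_norm_sub_norm_le y x
    rw [norm_sub_rev] at this
    refine le_trans (le_of_eq ?_) this
    congr 1; ring
  exact ⟨_, (h1.const_min 1).const_max 0⟩

theorem exists_lipschitzWith_smul {C K : NNReal} {χ : ℂ → ℝ} {G : ℂ → ℂ} {R : ℝ}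
    (hχ : LipschitzWith C χ) (hG : LipschitzWith K G) (hχ1 : ∀ z, |χ z| ≤ 1)
    (hχ0 : ∀ z, R ≤ ‖z‖ → χ z = 0) : ∃ L, LipschitzWith L fun z => χ z • G z := by
  obtain ⟨M, hM⟩ := (isCompact_closedBall (0 : ℂ) R).exists_bound_of_continuousOn
    hG.continuous.continuousOn
  have key : ∀ x y, ‖x‖ ≤ R → ‖χ x • G x - χ y • G y‖ ≤ (C * |M| + K) * ‖x - y‖ := by
    intro x y hx
    have hGx : ‖G x‖ ≤ |M| := (hM x (by simpa using hx)).trans (le_abs_self M)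
    have e : χ x • G x - χ y • G y = (χ x - χ y) • G x + χ y • (G x - G y) := by
      simp only [sub_smul, smul_sub]; abel
    have a1 : |χ x - χ y| ≤ C * ‖x - y‖ := by
      simpa [Real.dist_eq, dist_eq_norm] using hχ.dist_le_mul x y
    have a2 : ‖G x - G y‖ ≤ K * ‖x - y‖ := by
      simpa [dist_eq_norm] using hG.dist_le_mul x y
    rw [e]
    refine (norm_add_le _ _).trans ?_
    rw [norm_smul, norm_smul, Real.norm_eq_abs, Real.norm_eq_abs]
    have b1 := mul_le_mul a1 hGx (norm_nonneg _) (by positivity)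
    have b2 := mul_le_mul (hχ1 y) a2 (norm_nonneg _) zero_le_one
    linarith
  refine ⟨C * Real.nnabs M + K, LipschitzWith.of_dist_le_mul fun x y => ?_⟩
  rw [dist_eq_norm, dist_eq_norm]
  push_cast
  rcases le_total ‖x‖ R with hx | hx
  · exact key x y hx
  rcases le_total ‖y‖ R with hy | hy
  · rw [norm_sub_rev, norm_sub_rev x y]
    exact key y x hy
  · simp only [hχ0 x hx, hχ0 y hy, zero_smul, sub_zero, norm_zero]
    positivity

theorem degInt_congr {K K' : NNReal} {Φ Φ' : ℂ → ℂ} (hΦ : LipschitzWith K Φ)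
    (hΦ' : LipschitzWith K' Φ') {r R : ℝ} (hrR : r < R)
    (h : ∀ z, r ≤ ‖z‖ → ‖z‖ ≤ R → ∀ s ∈ Icc (0 : ℝ) 1, 2 ≤ ‖Φ' z + s • (Φ z - Φ' z)‖) :
    degInt r Φ = degInt r Φ' := by
  obtain ⟨C, hC⟩ := exists_lipschitzWith_cutoff hrR
  obtain ⟨L, hL⟩ := exists_lipschitzWith_smul (R := R) hC (hΦ.sub hΦ')
    (fun z => by rw [abs_of_nonneg (cutoff_nonneg _ _ _)]; exact cutoff_le_one _ _ _)
    (fun z hz => cutoff_eq_zero hrR hz)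
  set Ψ : ℂ → ℂ := fun z => Φ' z + cutoff r R z • (Φ z - Φ' z) with hΨ
  have hΨL : LipschitzWith (K' + L) Ψ := hΦ'.add hL
  have hin : ∀ z, ‖z‖ ≤ r → Ψ z = Φ z := fun z hz => by simp [hΨ, cutoff_eq_one hrR hz]
  have hout : ∀ z, R ≤ ‖z‖ → Ψ z = Φ' z := fun z hz => by simp [hΨ, cutoff_eq_zero hrR hz]
  have h0 := integral_weight_jac_sub_eq_zero hΨL hΦ' hout
  have e1 : degInt r Φ = ∫ z in ball (0 : ℂ) r, weight (Ψ z) * jac (fderiv ℝ Ψ z) := by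
    refine setIntegral_congr_fun measurableSet_ball fun z hz => ?_
    have hz' : ‖z‖ < r := by simpa using hz
    have : Φ =ᶠ[𝓝 z] Ψ := by
      filter_upwards [isOpen_ball.mem_nhds hz] with y hy
      exact (hin y (le_of_lt (by simpa using hy))).symm
    simp only [this.fderiv_eq, this.eq_of_nhds]
  rw [← setIntegral_eq_integral_of_forall_compl_eq_zero (s := ball (0 : ℂ) r),
    integral_sub (integrable_weight_jac hΨL measure_ball_lt_top)
      (integrable_weight_jac hΦ' measure_ball_lt_top), ← e1] at h0
  · exact sub_eq_zero.1 h0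
  · intro z hz
    have hz' : r ≤ ‖z‖ := by simpa using hz
    rcases le_or_gt ‖z‖ R with hR | hR
    · have w1 : weight (Ψ z) = 0 :=
        weight_eq_zero (h z hz' hR _ ⟨cutoff_nonneg _ _ _, cutoff_le_one _ _ _⟩)
      have w2 : weight (Φ' z) = 0 := weight_eq_zero (by
        simpa using h z hz' hR 0 ⟨le_rfl, zero_le_one⟩)
      simp [w1, w2]
    · have : Ψ =ᶠ[𝓝 z] Φ' := by
        filter_upwards [(isOpen_lt continuous_const continuous_norm).mem_nhds hR] with y hy
        exact hout y (le_of_lt hy)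
      simp [this.fderiv_eq, this.eq_of_nhds]

/-- `HasDeg r Φ c`: the weighted total Jacobians over the ball of radius `r` of all large multiples
of `Φ` equal `c`. -/
def HasDeg (r : ℝ) (Φ : ℂ → ℂ) (c : ℝ) : Prop :=
  ∀ᶠ l : ℝ in atTop, degInt r (fun z => l • Φ z) = c

theorem HasDeg.unique {r : ℝ} {Φ : ℂ → ℂ} {c c' : ℝ} (h : HasDeg r Φ c) (h' : HasDeg r Φ c') :
    c = c' := by
  obtain ⟨l, h1, h2⟩ := (h.and h').exists
  exact h1.symm.trans h2

theorem lipschitzWith_smul {K : NNReal} {Φ : ℂ → ℂ} (hΦ : LipschitzWith K Φ) (l : ℝ) :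
    LipschitzWith (‖l‖₊ * K) fun z => l • Φ z := by
  refine LipschitzWith.of_dist_le_mul fun x y => ?_
  rw [dist_smul₀]
  push_cast
  rw [mul_assoc]
  gcongr
  exact hΦ.dist_le_mul x y

theorem exists_pos_le_norm_of_compact {X : Type*} [TopologicalSpace X] {s : Set X}
    (hs : IsCompact s) {g : X → ℂ} (hg : ContinuousOn g s) (h0 : ∀ x ∈ s, g x ≠ 0) :
    ∃ m > 0, ∀ x ∈ s, m ≤ ‖g x‖ := by
  rcases s.eq_empty_or_nonempty with rfl | hne
  · exact ⟨1, one_pos, by simp⟩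
  · obtain ⟨x, hx, hmin⟩ := hs.exists_isMinOn hne hg.norm
    exact ⟨‖g x‖, norm_pos_iff.2 (h0 x hx), fun y hy => hmin hy⟩

theorem isCompact_annulus (r R : ℝ) : IsCompact {z : ℂ | r ≤ ‖z‖ ∧ ‖z‖ ≤ R} := by
  refine (isCompact_closedBall (0 : ℂ) R).of_isClosed_subset ?_ fun z hz => by simpa using hz.2
  exact (isClosed_le continuous_const continuous_norm).inter
    (isClosed_le continuous_norm continuous_const)

/-- Homotopy invariance of the degree along segments. -/
theorem HasDeg.congr {K K' : NNReal} {Φ Φ' : ℂ → ℂ} (hΦ : LipschitzWith K Φ)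
    (hΦ' : LipschitzWith K' Φ') {r R c : ℝ} (hrR : r < R)
    (h : ∀ z, r ≤ ‖z‖ → ‖z‖ ≤ R → ∀ s ∈ Icc (0 : ℝ) 1, Φ' z + s • (Φ z - Φ' z) ≠ 0)
    (hc : HasDeg r Φ' c) : HasDeg r Φ c := by
  have hcont : Continuous fun p : ℂ × ℝ => Φ' p.1 + p.2 • (Φ p.1 - Φ' p.1) := by
    have := hΦ.continuous
    have := hΦ'.continuous
    fun_prop
  obtain ⟨m, hm, hle⟩ := exists_pos_le_norm_of_compact
    ((isCompact_annulus r R).prod (isCompact_Icc (a := (0 : ℝ)) (b := 1))) hcont.continuousOn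
    (fun p hp => h p.1 hp.1.1 hp.1.2 p.2 hp.2)
  filter_upwards [hc, eventually_ge_atTop (2 / m)] with l hl hlm
  rw [← hl]
  have hl2 : 2 ≤ l * m := (div_le_iff₀ hm).1 hlm
  have hl0 : 0 ≤ l := le_trans (by positivity) hlm
  refine degInt_congr (lipschitzWith_smul hΦ l) (lipschitzWith_smul hΦ' l) hrR
    fun z h1 h2 s hs => ?_
  have e : l • Φ' z + s • (l • Φ z - l • Φ' z) = l • (Φ' z + s • (Φ z - Φ' z)) := by
    rw [← smul_sub, smul_comm s l, ← smul_add]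
  rw [e, norm_smul, Real.norm_of_nonneg hl0]
  exact hl2.trans (mul_le_mul_of_nonneg_left (hle (z, s) ⟨⟨h1, h2⟩, hs⟩) hl0)

theorem degInt_smul_eq {K : NNReal} {Φ : ℂ → ℂ} (hΦ : LipschitzWith K Φ) {r R m l l' : ℝ}
    (hrR : r < R) (hm : ∀ z, r ≤ ‖z‖ → ‖z‖ ≤ R → m ≤ ‖Φ z‖) (h0 : 0 ≤ l) (h0' : 0 ≤ l')
    (h1 : 2 ≤ l * m) (h2 : 2 ≤ l' * m) :
    degInt r (fun z => l • Φ z) = degInt r (fun z => l' • Φ z) := by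
  refine degInt_congr (lipschitzWith_smul hΦ l) (lipschitzWith_smul hΦ l') hrR
    fun z hr hR s hs => ?_
  have e : l' • Φ z + s • (l • Φ z - l' • Φ z) = (l' + s * (l - l')) • Φ z := by
    rw [← sub_smul, smul_smul, ← add_smul]
  have hl : 0 ≤ l' + s * (l - l') := by nlinarith [hs.1, hs.2]
  rw [e, norm_smul, Real.norm_of_nonneg hl]
  refine le_trans ?_ (mul_le_mul_of_nonneg_left (hm z hr hR) hl)
  nlinarith [hs.1, hs.2, mul_le_mul_of_nonneg_left h1 hs.1,
    mul_le_mul_of_nonneg_left h2 (sub_nonneg.2 hs.2)]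

theorem hasDeg_degInt {K : NNReal} {Φ : ℂ → ℂ} (hΦ : LipschitzWith K Φ) {r R m l : ℝ}
    (hrR : r < R) (hm0 : 0 < m) (hm : ∀ z, r ≤ ‖z‖ → ‖z‖ ≤ R → m ≤ ‖Φ z‖) (h0 : 0 ≤ l)
    (h1 : 2 ≤ l * m) : HasDeg r Φ (degInt r fun z => l • Φ z) := by
  filter_upwards [eventually_ge_atTop (2 / m)] with l' hl'
  exact degInt_smul_eq hΦ hrR hm (le_trans (by positivity) hl') h0 ((div_le_iff₀ hm0).1 hl') h1

theorem exists_hasDeg {K : NNReal} {Φ : ℂ → ℂ} (hΦ : LipschitzWith K Φ) {r R : ℝ} (hrR : r < R)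
    (h : ∀ z, r ≤ ‖z‖ → ‖z‖ ≤ R → Φ z ≠ 0) : ∃ c, HasDeg r Φ c := by
  obtain ⟨m, hm, hle⟩ := exists_pos_le_norm_of_compact (isCompact_annulus r R)
    hΦ.continuous.continuousOn (fun z hz => h z hz.1 hz.2)
  refine ⟨_, hasDeg_degInt hΦ hrR hm (fun z h1 h2 => hle z ⟨h1, h2⟩) (l := 2 / m) (by positivity) ?_⟩
  rw [div_mul_cancel₀ _ hm.ne']

theorem hasDeg_const (r : ℝ) (w : ℂ) : HasDeg r (fun _ => w) 0 :=
  Eventually.of_forall fun l => by simp [degInt, jac]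

/-- The total mass of the weight. -/
def totalWeight : ℝ := ∫ w, weight w

theorem totalWeight_pos : 0 < totalWeight := by
  refine continuous_weight.integral_pos_of_hasCompactSupport_nonneg_nonzero
    (HasCompactSupport.intro (isCompact_closedBall (0 : ℂ) 2) fun w hw => ?_) weight_nonneg
    (x := 0) (weight_pos (by simp) (by simp)).ne'
  have : 2 < ‖w‖ := by simpa using hw
  exact weight_eq_zero this.le

theorem setIntegral_weight_jac_of_injOn {Ψ : ℂ → ℂ} {S : Set ℂ} (hS : MeasurableSet S)
    (hd : ∀ z ∈ S, DifferentiableAt ℝ Ψ z) (hinj : InjOn Ψ S)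
    (hj : ∀ z ∈ S, 0 ≤ jac (fderiv ℝ Ψ z)) (hsupp : ∀ w, weight w ≠ 0 → w ∈ Ψ '' S) :
    ∫ z in S, weight (Ψ z) * jac (fderiv ℝ Ψ z) = totalWeight := by
  have h := integral_image_eq_integral_abs_det_fderiv_smul volume hS
    (fun z hz => (hd z hz).hasFDerivAt.hasFDerivWithinAt) hinj weight
  rw [setIntegral_eq_integral_of_forall_compl_eq_zero (fun w hw => by
    by_contra h0; exact hw (hsupp w h0))] at h
  rw [totalWeight, h]
  refine setIntegral_congr_fun hS fun z hz => ?_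
  simp only [det_eq_jac, smul_eq_mul, abs_of_nonneg (hj z hz), mul_comm]

theorem exists_equiv_of_jac_ne_zero {A : ℂ →L[ℝ] ℂ} (h : jac A ≠ 0) :
    ∃ A' : ℂ ≃L[ℝ] ℂ, (A' : ℂ →L[ℝ] ℂ) = A :=
  ⟨A.toContinuousLinearEquivOfDetNeZero (by rwa [det_eq_jac]), rfl⟩

theorem map_nhds_eq_of_jac_ne_zero {Ψ : ℂ → ℂ} {A : ℂ →L[ℝ] ℂ} {p : ℂ}
    (h : HasStrictFDerivAt Ψ A p) (hj : jac A ≠ 0) : map Ψ (𝓝 p) = 𝓝 (Ψ p) := by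
  obtain ⟨A', rfl⟩ := exists_equiv_of_jac_ne_zero hj
  exact h.map_nhds_eq_of_equiv

theorem exists_open_injOn_of_jac_ne_zero {Ψ : ℂ → ℂ} {A : ℂ →L[ℝ] ℂ} {p : ℂ}
    (h : HasStrictFDerivAt Ψ A p) (hj : jac A ≠ 0) : ∃ S, IsOpen S ∧ p ∈ S ∧ InjOn Ψ S := by
  obtain ⟨A', rfl⟩ := exists_equiv_of_jac_ne_zero hj
  refine ⟨_, (h.toOpenPartialHomeomorph Ψ).open_source, h.mem_toOpenPartialHomeomorph_source, ?_⟩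
  have := (h.toOpenPartialHomeomorph Ψ).injOn
  rwa [h.toOpenPartialHomeomorph_coe] at this

theorem fderiv_const_smul_jac {Ψ : ℂ → ℂ} {z : ℂ} (h : DifferentiableAt ℝ Ψ z) (l : ℝ) :
    jac (fderiv ℝ (fun z => l • Ψ z) z) = l ^ 2 * jac (fderiv ℝ Ψ z) := by
  rw [← jac_smul]
  exact congrArg jac (h.hasFDerivAt.const_smul l).fderiv

/-- The degree is bounded below by the number of zeros, provided these are regular and the
Jacobian has a sign. -/
theorem eventually_card_mul_le_degInt {K : NNReal} {Ψ : ℂ → ℂ} (hΨ : LipschitzWith K Ψ) {r : ℝ}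
    {U : Set ℂ} (hU : IsOpen U) {D : ℂ → ℂ →L[ℝ] ℂ} (hD : ∀ z ∈ U, HasStrictFDerivAt Ψ (D z) z)
    (hDpos : ∀ z ∈ U, 0 < jac (D z))
    (hnn : ∀ᵐ z, z ∈ ball (0 : ℂ) r → 0 ≤ jac (fderiv ℝ Ψ z))
    (T : Finset ℂ) (hT : ∀ p ∈ T, p ∈ U ∧ p ∈ ball (0 : ℂ) r ∧ Ψ p = 0) :
    ∀ᶠ l : ℝ in atTop, T.card * totalWeight ≤ degInt r (fun z => l • Ψ z) := by
  obtain ⟨N, hN, hNd⟩ := T.finite_toSet.t2_separation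
  have hS : ∀ p : ℂ, ∃ S, p ∈ T → IsOpen S ∧ p ∈ S ∧ InjOn Ψ S := fun p => by
    by_cases hp : p ∈ T
    · obtain ⟨S, h⟩ := exists_open_injOn_of_jac_ne_zero (hD p (hT p hp).1) (hDpos p (hT p hp).1).ne'
      exact ⟨S, fun _ => h⟩
    · exact ⟨∅, fun h => absurd h hp⟩
  choose S hS using hS
  set V : ℂ → Set ℂ := fun p => S p ∩ N p ∩ (U ∩ ball 0 r) with hV
  have hVo : ∀ p ∈ T, IsOpen (V p) := fun p hp =>
    ((hS p hp).1.inter (hN p).2).inter (hU.inter isOpen_ball)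
  have hVd : (T : Set ℂ).PairwiseDisjoint V := fun p hp q hq hpq =>
    (hNd hp hq hpq).mono (fun z hz => hz.1.2) (fun z hz => hz.1.2)
  have hev : ∀ p ∈ T, ∀ᶠ l : ℝ in atTop,
      ∫ z in V p, weight (l • Ψ z) * jac (fderiv ℝ (fun z => l • Ψ z) z) = totalWeight := by
    intro p hp
    have himg : Ψ '' V p ∈ 𝓝 (0 : ℂ) := by
      rw [← (hT p hp).2.2, ← map_nhds_eq_of_jac_ne_zero (hD p (hT p hp).1) (hDpos p (hT p hp).1).ne']
      exact image_mem_map ((hVo p hp).mem_nhds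
        ⟨⟨(hS p hp).2.1, (hN p).1⟩, (hT p hp).1, (hT p hp).2.1⟩)
    obtain ⟨m, hm, hball⟩ := Metric.mem_nhds_iff.1 himg
    filter_upwards [eventually_ge_atTop (2 / m)] with l hl
    have hl0 : 0 < l := lt_of_lt_of_le (by positivity) hl
    refine setIntegral_weight_jac_of_injOn (hVo p hp).measurableSet
      (fun z hz => ((hD z hz.2.1).differentiableAt).const_smul l) ?_ ?_ ?_
    · intro z hz z' hz' hzz
      exact (hS p hp).2.2 hz.1.1 hz'.1.1 (smul_right_injective ℂ hl0.ne' hzz)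
    · intro z hz
      rw [fderiv_const_smul_jac (hD z hz.2.1).differentiableAt, (hD z hz.2.1).hasFDerivAt.fderiv]
      have := hDpos z hz.2.1
      positivity
    · intro w hw
      have hw2 : ‖w‖ < 2 := by
        by_contra h
        exact hw (weight_eq_zero (not_lt.1 h))
      have : l⁻¹ • w ∈ ball (0 : ℂ) m := by
        rw [mem_ball_zero_iff, norm_smul, norm_inv, Real.norm_of_nonneg hl0.le,
          inv_mul_lt_iff₀ hl0]
        have := (div_le_iff₀ hm).1 hl
        linarith
      obtain ⟨z, hz, hzw⟩ := hball this
      exact ⟨z, hz, by simp only [hzw, smul_inv_smul₀ hl0.ne']⟩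
  filter_upwards [(Finset.eventually_all T).2 hev] with l hl
  have hInt : IntegrableOn (fun z => weight (l • Ψ z) * jac (fderiv ℝ (fun z => l • Ψ z) z))
      (ball (0 : ℂ) r) := integrable_weight_jac (lipschitzWith_smul hΨ l) measure_ball_lt_top
  have hsub : (⋃ p ∈ T, V p) ⊆ ball (0 : ℂ) r := iUnion₂_subset fun p _ z hz => hz.2.2
  have hsum := integral_biUnion_finset (μ := volume) T (fun p hp => (hVo p hp).measurableSet) hVd
    (f := fun z => weight (l • Ψ z) * jac (fderiv ℝ (fun z => l • Ψ z) z))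
    (fun p hp => hInt.mono_set fun z hz => hz.2.2)
  rw [Finset.sum_congr rfl hl, Finset.sum_const, nsmul_eq_mul] at hsum
  rw [← hsum]
  refine setIntegral_mono_set hInt ?_ hsub.eventuallyLE
  refine (ae_restrict_iff' measurableSet_ball).2 ?_
  filter_upwards [hnn, hΨ.ae_differentiableAt (μ := volume)] with z hz hdz hzr
  rw [fderiv_const_smul_jac hdz]
  exact mul_nonneg (weight_nonneg _) (mul_nonneg (sq_nonneg _) (hz hzr))

theorem degInt_pos {K : NNReal} {Ψ : ℂ → ℂ} (hΨ : LipschitzWith K Ψ) {r : ℝ}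
    (hnn : ∀ᵐ z, z ∈ ball (0 : ℂ) r → 0 ≤ jac (fderiv ℝ Ψ z)) {O : Set ℂ} (hO : IsOpen O)
    (hne : O.Nonempty) (hOr : O ⊆ ball 0 r)
    (hpos : ∀ z ∈ O, 0 < weight (Ψ z) * jac (fderiv ℝ Ψ z)) : 0 < degInt r Ψ := by
  refine (setIntegral_pos_iff_support_of_nonneg_ae ?_
    (integrable_weight_jac hΨ measure_ball_lt_top)).2 ?_
  · refine (ae_restrict_iff' measurableSet_ball).2 ?_
    filter_upwards [hnn] with z hz hzr
    exact mul_nonneg (weight_nonneg _) (hz hzr)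
  · exact (hO.measure_pos volume hne).trans_le
      (measure_mono fun z hz => ⟨(hpos z hz).ne', hOr hz⟩)

theorem hasDeg_mul_const {c : ℂ} (hc : ‖c‖ = 1) {r : ℝ} (hr : 0 < r) :
    HasDeg r (fun z => z * c) totalWeight := by
  have hc0 : c ≠ 0 := fun h => by simp [h] at hc
  have hd : ∀ (l : ℝ) (z : ℂ), HasFDerivAt (fun z : ℂ => l • (z * c))
      (l • (ContinuousLinearMap.mul ℝ ℂ).flip c) z := fun l z =>
    (((ContinuousLinearMap.mul ℝ ℂ).flip c).hasFDerivAt).const_smul l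
  filter_upwards [eventually_ge_atTop (2 / r)] with l hl
  have hl0 : 0 < l := lt_of_lt_of_le (by positivity) hl
  refine setIntegral_weight_jac_of_injOn measurableSet_ball
    (fun z _ => (hd l z).differentiableAt) ?_ (fun z _ => ?_) fun w hw => ?_
  · intro z _ z' _ h
    exact mul_right_cancel₀ hc0 (smul_right_injective ℂ hl0.ne' h)
  · rw [(hd l z).fderiv, jac_smul]
    simp [jac]
    nlinarith [sq_nonneg l, sq_nonneg c.re, sq_nonneg c.im, mul_nonneg (sq_nonneg l) (sq_nonneg c.re),
      mul_nonneg (sq_nonneg l) (sq_nonneg c.im)]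
  · have hw2 : ‖w‖ < 2 := by
      by_contra h
      exact hw (weight_eq_zero (not_lt.1 h))
    refine ⟨l⁻¹ • (w * c⁻¹), ?_, ?_⟩
    · rw [mem_ball_zero_iff, norm_smul, norm_inv, Real.norm_of_nonneg hl0.le, norm_mul, norm_inv,
        hc, inv_one, mul_one, inv_mul_lt_iff₀ hl0]
      have := (div_le_iff₀ hr).1 hl
      linarith
    · simp only [smul_mul_assoc, smul_inv_smul₀ hl0.ne', inv_mul_cancel_right₀ hc0]

/-- A map whose Jacobian is nonpositive has nonpositive degree. -/
theorem HasDeg.nonpos {K : NNReal} {Ψ : ℂ → ℂ} (hΨ : LipschitzWith K Ψ) {r c : ℝ}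
    (h : HasDeg r Ψ c) (hj : ∀ z, jac (fderiv ℝ Ψ z) ≤ 0) : c ≤ 0 := by
  obtain ⟨l, hl⟩ := h.exists
  rw [← hl]
  refine integral_nonpos_of_ae (ae_restrict_of_ae ?_)
  filter_upwards [hΨ.ae_differentiableAt (μ := volume)] with z hz
  rw [fderiv_const_smul_jac hz]
  exact mul_nonpos_of_nonneg_of_nonpos (weight_nonneg _)
    (mul_nonpos_of_nonneg_of_nonpos (sq_nonneg _) (hj z))

/-- The flux `h(‖p‖) p / ‖p‖`. -/
def flux (h : ℝ → ℝ) (p : ℂ) : ℂ := (h ‖p‖ * ‖p‖⁻¹) • p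

theorem norm_flux {h : ℝ → ℝ} {p : ℂ} (hp : p ≠ 0) (hh : 0 ≤ h ‖p‖) : ‖flux h p‖ = h ‖p‖ := by
  rw [flux, norm_smul, norm_mul, norm_inv, norm_norm, Real.norm_of_nonneg hh,
    inv_mul_cancel_right₀ (norm_ne_zero_iff.2 hp)]

theorem flux_neg (h : ℝ → ℝ) (p : ℂ) : flux h (-p) = -flux h p := by simp [flux]

theorem continuousAt_flux {h : ℝ → ℝ} (hh : ContinuousOn h (Ici 0)) {p : ℂ} (hp : p ≠ 0) :
    ContinuousAt (flux h) p := by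
  have h1 : ContinuousAt h ‖p‖ := hh.continuousAt (Ici_mem_nhds (norm_pos_iff.2 hp))
  have h2 : ContinuousAt (fun p : ℂ => h ‖p‖) p := h1.comp continuous_norm.continuousAt
  exact (h2.mul (continuous_norm.continuousAt.inv₀ (norm_ne_zero_iff.2 hp))).smul continuousAt_id

/-- The scalar product of the plane in coordinates. -/
theorem inner_eq (p w : ℂ) : ⟪p, w⟫ = p.re * w.re + p.im * w.im := by
  rw [Complex.inner]; simp; ring

/-- The linear map of the plane whose components have gradients `p` and `i q`. -/
def pairCLM (p q : ℂ) : ℂ →L[ℝ] ℂ :=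
  (innerSL ℝ p).smulRight (1 : ℂ) + (innerSL ℝ (Complex.I * q)).smulRight Complex.I

theorem pairCLM_re (p q w : ℂ) : (pairCLM p q w).re = ⟪p, w⟫ := by
  simp [pairCLM]

theorem pairCLM_im (p q w : ℂ) : (pairCLM p q w).im = ⟪Complex.I * q, w⟫ := by
  simp [pairCLM]

theorem pairCLM_sub (p q p' q' : ℂ) :
    pairCLM p q - pairCLM p' q' = pairCLM (p - p') (q - q') := by
  ext w
  apply Complex.ext
  · simp [pairCLM_re, inner_sub_left]
  · simp [pairCLM_im, mul_sub, inner_sub_left]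

theorem jac_pairCLM (p q : ℂ) : jac (pairCLM p q) = ⟪p, q⟫ := by
  simp only [jac, pairCLM_re, pairCLM_im, inner_eq]
  simp
  ring

theorem continuous_pairCLM : Continuous fun x : ℂ × ℂ => pairCLM x.1 x.2 := by
  unfold pairCLM
  have h1 : Continuous fun x : ℂ × ℂ => innerSL ℝ x.1 := (innerSL ℝ).continuous.comp continuous_fst
  have h2 : Continuous fun x : ℂ × ℂ => innerSL ℝ (Complex.I * x.2) :=
    (innerSL ℝ).continuous.comp (continuous_const.mul continuous_snd)
  exact ((ContinuousLinearMap.smulRightL ℝ ℂ ℂ).continuous.comp h1 |>.clm_apply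
    continuous_const).add ((ContinuousLinearMap.smulRightL ℝ ℂ ℂ).continuous.comp h2 |>.clm_apply
    continuous_const)

theorem inner_flux_self {h : ℝ → ℝ} {p : ℂ} : ⟪p, flux h p⟫ = h ‖p‖ * ‖p‖ := by
  rw [flux, inner_smul_right, real_inner_self_eq_norm_sq]
  rcases eq_or_ne p 0 with rfl | hp
  · simp
  · have := norm_ne_zero_iff.2 hp
    field_simp

theorem le_inner_flux_sub {h : ℝ → ℝ} {p p' : ℂ} (hp : p ≠ 0) (hp' : p' ≠ 0) (h1 : 0 ≤ h ‖p‖)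
    (h2 : 0 ≤ h ‖p'‖) :
    (h ‖p‖ - h ‖p'‖) * (‖p‖ - ‖p'‖) ≤ ⟪p - p', flux h p - flux h p'⟫ := by
  have a1 := real_inner_le_norm p (flux h p')
  have a2 := real_inner_le_norm p' (flux h p)
  rw [norm_flux hp' h2] at a1
  rw [norm_flux hp h1] at a2
  rw [inner_sub_left, inner_sub_right, inner_sub_right, inner_flux_self, inner_flux_self]
  nlinarith

/-- Data produced by a solution with an isolated critical point at the origin: a function `u` with
gradient `p` vanishing only at `0`, and a stream function `v` with gradient `i h(‖p‖) p / ‖p‖`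
away from `0`. -/
structure ConjPair (h : ℝ → ℝ) (r₀ : ℝ) (p : ℂ → ℂ) (u v : ℂ → ℝ) : Prop where
  pos : 0 < r₀
  h_zero : 0 < h 0
  h_mono : StrictMonoOn h (Ici 0)
  h_cont : ContinuousOn h (Ici 0)
  lip_u : ∃ K, LipschitzWith K u
  lip_v : ∃ K, LipschitzWith K v
  u_zero : u 0 = 0
  v_zero : v 0 = 0
  p_zero : p 0 = 0
  p_ne : ∀ z, z ≠ 0 → ‖z‖ < r₀ → p z ≠ 0
  p_cont : ContinuousOn p (ball 0 r₀)
  deriv_u : ∀ z, ‖z‖ < r₀ → HasFDerivAt u (innerSL ℝ (p z)) z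
  deriv_v : ∀ z, z ≠ 0 → ‖z‖ < r₀ → HasFDerivAt v (innerSL ℝ (Complex.I * flux h (p z))) z

/-- The plane map with components `u` and `v`. -/
def pairMap (u v : ℂ → ℝ) (z : ℂ) : ℂ := ⟨u z, v z⟩

theorem exists_lipschitzWith_pairMap {u v : ℂ → ℝ} (hu : ∃ K, LipschitzWith K u)
    (hv : ∃ K, LipschitzWith K v) : ∃ K, LipschitzWith K (pairMap u v) := by
  obtain ⟨K, hK⟩ := hu
  obtain ⟨L, hL⟩ := hv
  refine ⟨K + L, LipschitzWith.of_dist_le_mul fun x y => ?_⟩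
  have a1 := hK.dist_le_mul x y
  have a2 := hL.dist_le_mul x y
  rw [Real.dist_eq] at a1 a2
  rw [dist_eq_norm (pairMap u v x)]
  refine (Complex.norm_le_abs_re_add_abs_im _).trans ?_
  simp only [pairMap, Complex.sub_re, Complex.sub_im]
  push_cast
  linarith

theorem hasFDerivAt_pairMap {u v : ℂ → ℝ} {p q z : ℂ} (hu : HasFDerivAt u (innerSL ℝ p) z)
    (hv : HasFDerivAt v (innerSL ℝ (Complex.I * q)) z) :
    HasFDerivAt (pairMap u v) (pairCLM p q) z := by
  have h := (hu.smul_const (1 : ℂ)).add (hv.smul_const Complex.I)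
  refine h.congr_of_eventuallyEq (Eventually.of_forall fun w => ?_)
  apply Complex.ext <;> simp [pairMap]

namespace ConjPair

variable {h : ℝ → ℝ} {r₀ : ℝ} {p : ℂ → ℂ} {u v : ℂ → ℝ}

theorem neg (H : ConjPair h r₀ p u v) :
    ConjPair h r₀ (fun z => -p z) (fun z => -u z) (fun z => -v z) where
  pos := H.pos
  h_zero := H.h_zero
  h_mono := H.h_mono
  h_cont := H.h_cont
  lip_u := H.lip_u.imp fun _ hK => hK.neg
  lip_v := H.lip_v.imp fun _ hK => hK.neg
  u_zero := by simp [H.u_zero]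
  v_zero := by simp [H.v_zero]
  p_zero := by simp [H.p_zero]
  p_ne z hz hr := neg_ne_zero.2 (H.p_ne z hz hr)
  p_cont := H.p_cont.neg
  deriv_u z hr := by
    rw [map_neg]; exact (H.deriv_u z hr).neg
  deriv_v z hz hr := by
    rw [flux_neg, mul_neg, map_neg]; exact (H.deriv_v z hz hr).neg

theorem isOpen_punctured : IsOpen (ball (0 : ℂ) r₀ \ {0}) := isOpen_ball.sdiff isClosed_singleton

theorem h_lt (H : ConjPair h r₀ p u v) {z : ℂ} (hz : z ≠ 0) (hr : ‖z‖ < r₀) : h 0 < h ‖p z‖ :=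
  H.h_mono self_mem_Ici (norm_nonneg _) (norm_pos_iff.2 (H.p_ne z hz hr))

theorem h_pos (H : ConjPair h r₀ p u v)
    {z : ℂ} (hz : z ≠ 0) (hr : ‖z‖ < r₀) : 0 < h ‖p z‖ := H.h_zero.trans (H.h_lt hz hr)

theorem norm_grad_v (H : ConjPair h r₀ p u v) {z : ℂ} (hz : z ≠ 0) (hr : ‖z‖ < r₀) :
    ‖Complex.I * flux h (p z)‖ = h ‖p z‖ := by
  rw [norm_mul, Complex.norm_I, one_mul, norm_flux (H.p_ne z hz hr) (H.h_pos hz hr).le]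

theorem continuousAt_p (H : ConjPair h r₀ p u v) {z : ℂ} (hr : ‖z‖ < r₀) : ContinuousAt p z :=
  H.p_cont.continuousAt (isOpen_ball.mem_nhds (by simpa using hr))

theorem hasFDerivAt (H : ConjPair h r₀ p u v) {z : ℂ} (hz : z ≠ 0) (hr : ‖z‖ < r₀) :
    HasFDerivAt (pairMap u v) (pairCLM (p z) (flux h (p z))) z :=
  hasFDerivAt_pairMap (H.deriv_u z hr) (H.deriv_v z hz hr)

theorem hasStrictFDerivAt (H : ConjPair h r₀ p u v) {z : ℂ} (hz : z ≠ 0) (hr : ‖z‖ < r₀) :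
    HasStrictFDerivAt (pairMap u v) (pairCLM (p z) (flux h (p z))) z := by
  refine hasStrictFDerivAt_of_hasFDerivAt_of_continuousAt
    (f' := fun z => pairCLM (p z) (flux h (p z))) ?_ ?_
  · filter_upwards [isOpen_punctured.mem_nhds ⟨by simpa using hr, hz⟩] with y hy
    exact H.hasFDerivAt hy.2 (by simpa using hy.1)
  · have hp := H.continuousAt_p hr
    have hq : ContinuousAt (fun z => flux h (p z)) z :=
      ContinuousAt.comp (continuousAt_flux H.h_cont (H.p_ne z hz hr)) hp
    exact continuous_pairCLM.continuousAt.comp (f := fun z => (p z, flux h (p z))) (hp.prodMk hq)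

theorem jac_pos (H : ConjPair h r₀ p u v)
    {z : ℂ} (hz : z ≠ 0) (hr : ‖z‖ < r₀) : 0 < jac (pairCLM (p z) (flux h (p z))) := by
  rw [jac_pairCLM, inner_flux_self]
  exact mul_pos (H.h_pos hz hr) (norm_pos_iff.2 (H.p_ne z hz hr))

theorem ae_jac_nonneg (H : ConjPair h r₀ p u v) {r : ℝ} (hr : r ≤ r₀) (q : ℂ) :
    ∀ᵐ z, z ∈ ball (0 : ℂ) r → 0 ≤ jac (fderiv ℝ (fun z => pairMap u v z - q) z) := by
  filter_upwards [compl_mem_ae_iff.2 (measure_singleton (μ := volume) (0 : ℂ))] with z hz hzr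
  have hr' : ‖z‖ < r₀ := lt_of_lt_of_le (by simpa using hzr) hr
  rw [((H.hasFDerivAt hz hr').sub_const q).fderiv]
  exact (H.jac_pos hz hr').le

theorem map_zero (H : ConjPair h r₀ p u v) : pairMap u v 0 = 0 := by
  apply Complex.ext <;> simp [pairMap, H.u_zero, H.v_zero]

theorem exists_lipschitzWith (H : ConjPair h r₀ p u v) : ∃ K, LipschitzWith K (pairMap u v) :=
  exists_lipschitzWith_pairMap H.lip_u H.lip_v

theorem continuous_map (H : ConjPair h r₀ p u v)
    : Continuous (pairMap u v) := H.exists_lipschitzWith.choose_spec.continuous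

theorem continuous_u (H : ConjPair h r₀ p u v) : Continuous u := H.lip_u.choose_spec.continuous

theorem continuous_v (H : ConjPair h r₀ p u v) : Continuous v := H.lip_v.choose_spec.continuous

theorem hasDeg_pos (H : ConjPair h r₀ p u v)
    {r c : ℝ} (hr0 : 0 < r) (hr : r ≤ r₀) (hc : HasDeg r (pairMap u v) c) :
    0 < c := by
  obtain ⟨K, hK⟩ := H.exists_lipschitzWith
  obtain ⟨l, hl, hl0⟩ := (hc.and (eventually_gt_atTop 0)).exists
  rw [← hl]
  have hw : ∀ᶠ z in 𝓝 (0 : ℂ), 0 < weight (l • pairMap u v z) := by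
    refine (continuous_weight.comp (H.continuous_map.const_smul l)).continuousAt.eventually
      (lt_mem_nhds ?_)
    have h0 : l • pairMap u v 0 = 0 := by rw [H.map_zero, smul_zero]
    rw [Function.comp_apply, Pi.smul_apply, h0]
    exact weight_pos (by simp) (by simp)
  obtain ⟨s, hs, hball⟩ := Metric.eventually_nhds_iff_ball.1 hw
  refine degInt_pos (lipschitzWith_smul hK l) ?_
    (O := ball 0 (min s r) \ {0}) (isOpen_ball.sdiff isClosed_singleton) ?_ ?_ ?_
  · filter_upwards [H.ae_jac_nonneg hr 0, hK.ae_differentiableAt (μ := volume)] with z hz hd hzr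
    rw [fderiv_const_smul_jac hd]
    exact mul_nonneg (sq_nonneg _) (by simpa using hz hzr)
  · have hm : 0 < min s r := lt_min hs hr0
    refine ⟨((min s r / 2 : ℝ) : ℂ), ?_, ?_⟩
    · rw [mem_ball_zero_iff, Complex.norm_real, Real.norm_of_nonneg (by positivity)]
      linarith
    · simpa using hm.ne'
  · exact fun z hz => ball_subset_ball (min_le_right _ _) hz.1
  · intro z hz
    have hz1 : ‖z‖ < min s r := by simpa using hz.1
    have hzr : ‖z‖ < r₀ := (hz1.trans_le (min_le_right _ _)).trans_le hr
    have hd := H.hasFDerivAt hz.2 hzr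
    rw [fderiv_const_smul_jac hd.differentiableAt, hd.fderiv]
    exact mul_pos (hball z (ball_subset_ball (min_le_left _ _) hz.1))
      (mul_pos (by positivity) (H.jac_pos hz.2 hzr))

theorem exists_v_nonneg (H : ConjPair h r₀ p u v)
    {s : ℝ} (hs : 0 < s) : ∃ y, y ≠ 0 ∧ ‖y‖ < s ∧ 0 ≤ v y := by
  by_contra! hcon
  obtain ⟨K, hK⟩ := H.exists_lipschitzWith
  set m := min s r₀ with hm
  have hm0 : 0 < m := lt_min hs H.pos
  have hdeg : HasDeg (m / 3) (pairMap u v) 0 := by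
    refine HasDeg.congr hK (LipschitzWith.const (-Complex.I)) (R := m / 2) (by linarith) ?_
      (hasDeg_const _ _)
    intro z h1 h2 t ht h0
    have hv : v z < 0 := hcon z (norm_pos_iff.1 (by linarith)) (by
      have := min_le_left s r₀; linarith)
    have := congrArg Complex.im h0
    simp [pairMap] at this
    rcases ht.1.eq_or_lt with rfl | ht0
    · simp at this
    · nlinarith [ht.2, mul_pos_of_neg_of_neg hv (neg_lt_zero.2 ht0)]
  exact lt_irrefl _ (H.hasDeg_pos (by positivity) (by have := min_le_right s r₀; linarith) hdeg)

end ConjPair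

/-- The mean value inequality for a function which is only known to be continuous at the origin. -/
theorem abs_sub_le_of_hasFDerivAt_punctured {g : ℂ → ℝ} {g' : ℂ → ℂ →L[ℝ] ℝ} {r C : ℝ}
    (hg : ContinuousAt g 0) (hd : ∀ z, z ≠ 0 → ‖z‖ < r → HasFDerivAt g (g' z) z)
    (hb : ∀ z, z ≠ 0 → ‖z‖ < r → ‖g' z‖ ≤ C) {z w : ℂ} (hz : ‖z‖ < r) (hw : ‖w‖ < r) :
    |g z - g w| ≤ C * ‖z - w‖ := by
  have hA : ∀ z w : ℂ, ‖z‖ < r → ‖w‖ < r → (0 : ℂ) ∉ segment ℝ w z →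
      |g z - g w| ≤ C * ‖z - w‖ := by
    intro z w hz hw h0
    have hsub : ∀ y ∈ segment ℝ w z, ‖y‖ < r := fun y hy => by
      have := (convex_ball (0 : ℂ) r).segment_subset (by simpa using hw) (by simpa using hz) hy
      simpa using this
    exact (convex_segment w z).norm_image_sub_le_of_norm_hasFDerivWithin_le
      (fun y hy => (hd y (fun h => h0 (h ▸ hy)) (hsub y hy)).hasFDerivWithinAt)
      (fun y hy => hb y (fun h => h0 (h ▸ hy)) (hsub y hy))
      (left_mem_segment ℝ w z) (right_mem_segment ℝ w z)
  have hB : ∀ z : ℂ, ‖z‖ < r → |g z - g 0| ≤ C * ‖z‖ := by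
    intro z hz
    rcases eq_or_ne z 0 with rfl | hz0
    · simp
    have ht : Tendsto (fun t : ℝ => t • z) (𝓝[>] 0) (𝓝 0) := by
      have : Tendsto (fun t : ℝ => t • z) (𝓝 0) (𝓝 ((0 : ℝ) • z)) :=
        (continuous_id.smul continuous_const).continuousAt
      rw [zero_smul] at this
      exact this.mono_left nhdsWithin_le_nhds
    have h1 : Tendsto (fun t : ℝ => |g z - g (t • z)|) (𝓝[>] 0) (𝓝 |g z - g 0|) :=
      (tendsto_const_nhds.sub (hg.tendsto.comp ht)).abs
    have h2 : Tendsto (fun t : ℝ => C * ‖z - t • z‖) (𝓝[>] 0) (𝓝 (C * ‖z - 0‖)) :=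
      (tendsto_const_nhds.sub ht).norm.const_mul C
    rw [sub_zero] at h2
    refine le_of_tendsto_of_tendsto h1 h2 ?_
    filter_upwards [Ioc_mem_nhdsGT (one_pos)] with t ht
    refine hA z (t • z) hz ?_ ?_
    · rw [norm_smul, Real.norm_of_nonneg ht.1.le]
      exact lt_of_le_of_lt (mul_le_of_le_one_left (norm_nonneg _) ht.2) hz
    · rintro ⟨a, b, ha, hb', hab, h0⟩
      rw [smul_smul, ← add_smul] at h0
      have hpos : 0 < a * t + b := by
        rcases ha.eq_or_lt with rfl | ha'
        · linarith
        · nlinarith [mul_pos ha' ht.1]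
      exact (smul_ne_zero hpos.ne' hz0) h0
  by_cases h0 : (0 : ℂ) ∈ segment ℝ w z
  · have hd := dist_add_dist_of_mem_segment h0
    simp only [dist_eq_norm, sub_zero, zero_sub, norm_neg] at hd
    rw [norm_sub_rev, ← hd]
    have h1 := abs_le.1 (hB z hz)
    have h2 := abs_le.1 (hB w hw)
    rw [abs_le]
    constructor <;> linarith [h1.1, h1.2, h2.1, h2.2]
  · exact hA z w hz hw h0

theorem norm_le_of_eventually_le {g : ℂ → ℝ} {q y : ℂ} {a : ℝ}
    (hg : HasFDerivAt g (innerSL ℝ q) y) (h : ∀ᶠ y' in 𝓝 y, g y' ≤ g y + a * ‖y' - y‖) :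
    ‖q‖ ≤ a ∨ q = 0 := by
  rcases eq_or_ne q 0 with hq | hq
  · exact Or.inr hq
  left
  have hline := (hg.hasLineDerivAt q)
  have hl : HasDerivAt (fun t : ℝ => g (y + t • q)) (‖q‖ ^ 2) 0 := by
    have : HasDerivAt (fun t : ℝ => g (y + t • q)) (innerSL ℝ q q) 0 := hline
    rwa [innerSL_apply_apply, real_inner_self_eq_norm_sq] at this
  have hs := hl.tendsto_slope_zero_right
  have ht : Tendsto (fun t : ℝ => y + t • q) (𝓝[>] 0) (𝓝 y) := by
    have : Tendsto (fun t : ℝ => y + t • q) (𝓝 0) (𝓝 (y + (0 : ℝ) • q)) :=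
      (continuous_const.add (continuous_id.smul continuous_const)).continuousAt
    rw [zero_smul, add_zero] at this
    exact this.mono_left nhdsWithin_le_nhds
  have hle : ‖q‖ ^ 2 ≤ a * ‖q‖ := by
    refine le_of_tendsto hs ?_
    filter_upwards [ht.eventually h, self_mem_nhdsWithin] with t h1 (h2 : 0 < t)
    rw [add_sub_cancel_left, norm_smul, Real.norm_of_nonneg h2.le] at h1
    simp only [zero_add, zero_smul, add_zero, smul_eq_mul]
    rw [inv_mul_le_iff₀ h2]
    linarith
  have := norm_pos_iff.2 hq
  nlinarith

namespace ConjPair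

variable {h : ℝ → ℝ} {r₀ : ℝ} {p : ℂ → ℂ} {u v : ℂ → ℝ}

theorem exists_lipschitz_bound (H : ConjPair h r₀ p u v) {ε : ℝ} (hε : 0 < ε) :
    ∃ r, 0 < r ∧ r ≤ r₀ ∧ ∀ z w, ‖z‖ < r → ‖w‖ < r → |v z - v w| ≤ (h 0 + ε) * ‖z - w‖ := by
  have h1 : ContinuousWithinAt h (Ici 0) 0 := H.h_cont 0 self_mem_Ici
  have h2 : ∀ᶠ t in 𝓝[≥] (0 : ℝ), h t < h 0 + ε := h1.eventually (gt_mem_nhds (by linarith))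
  have h3 : Tendsto (fun z => ‖p z‖) (𝓝 0) (𝓝[≥] 0) := by
    refine tendsto_nhdsWithin_iff.2 ⟨?_, Eventually.of_forall fun z => norm_nonneg _⟩
    have := (H.continuousAt_p (z := 0) (by simpa using H.pos)).norm.tendsto
    simpa [H.p_zero] using this
  obtain ⟨s, hs, hball⟩ := Metric.eventually_nhds_iff_ball.1 (h3.eventually h2)
  refine ⟨min s r₀, lt_min hs H.pos, min_le_right _ _, fun z w hz hw => ?_⟩
  refine abs_sub_le_of_hasFDerivAt_punctured (r := min s r₀) H.continuous_v.continuousAt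
    (fun z h0 hz => H.deriv_v z h0 (hz.trans_le (min_le_right _ _)))
    (fun z h0 hz => ?_) hz hw
  rw [innerSL_apply_norm, H.norm_grad_v h0 (hz.trans_le (min_le_right _ _))]
  exact (hball z (by simpa using hz.trans_le (min_le_left _ _))).le

theorem exists_ascent (H : ConjPair h r₀ p u v) {R ε : ℝ} (hR : 0 < R) (hRr : R < r₀) (hε : 0 < ε)
    (hε1 : ε < 1) : ∃ P, ‖P‖ = R ∧ h 0 * R * (1 - ε) ≤ v P := by
  obtain ⟨y₀, hy₀, hy₀R, hvy₀⟩ := H.exists_v_nonneg (s := ε * R) (by positivity)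
  have ha := H.h_zero
  have hg : Continuous fun y => v y - h 0 * ‖y - y₀‖ := by
    have := H.continuous_v
    fun_prop
  have hyR : ‖y₀‖ < R := by nlinarith
  obtain ⟨y, hy, hmax⟩ := (isCompact_closedBall (0 : ℂ) R).exists_isMaxOn
    ⟨y₀, by simpa using hyR.le⟩ hg.continuousOn
  have hyR' : ‖y‖ ≤ R := by simpa using hy
  have h1 := hmax (show y₀ ∈ closedBall (0 : ℂ) R by simpa using hyR.le)
  simp only [mem_ofPred_eq, sub_self, norm_zero, mul_zero, sub_zero] at h1
  rcases hyR'.eq_or_lt with heq | hlt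
  · refine ⟨y, heq, ?_⟩
    have h2 := norm_sub_norm_le y y₀
    nlinarith
  · exfalso
    have hy0 : y ≠ 0 := by
      rintro rfl
      have := mul_pos ha (norm_pos_iff.2 hy₀)
      simp [H.v_zero] at h1
      linarith
    have hyr := hlt.trans hRr
    have h3 := norm_le_of_eventually_le (a := h 0) (H.deriv_v y hy0 hyr) (by
      filter_upwards [isOpen_ball.mem_nhds (show y ∈ ball (0 : ℂ) R by simpa using hlt)] with y' hy'
      have h2 := hmax (ball_subset_closedBall hy')
      simp only [mem_ofPred_eq] at h2
      have h4 : ‖y' - y₀‖ ≤ ‖y' - y‖ + ‖y - y₀‖ := norm_sub_le_norm_sub_add_norm_sub y' y y₀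
      nlinarith)
    have h5 := H.norm_grad_v hy0 hyr
    have h6 := H.h_lt hy0 hyr
    rcases h3 with h3 | h3
    · linarith
    · rw [h3, norm_zero] at h5
      linarith

theorem norm_sub_le_of_norm_eq {P z : ℂ} {R r : ℝ} (hR0 : 0 < R) (hrR : 2 * r ≤ R) (hr : 0 < r)
    (hP : ‖P‖ = R) (hz : ‖z‖ ≤ r) : ‖P - z‖ ≤ R - ⟪P, z⟫ / R + ‖z‖ ^ 2 / (2 * R) := by
  have hi : ⟪P, z⟫ ≤ R * r := (real_inner_le_norm P z).trans (by rw [hP]; gcongr)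
  have hi' : ⟪P, z⟫ / R ≤ r := by rw [div_le_iff₀ hR0]; linarith
  have hs : 0 ≤ ‖z‖ ^ 2 / (2 * R) := by positivity
  refine le_of_sq_le_sq ?_ (by linarith)
  rw [norm_sub_sq_real, hP]
  have e : (R - ⟪P, z⟫ / R + ‖z‖ ^ 2 / (2 * R)) ^ 2 = R ^ 2 - 2 * ⟪P, z⟫ + ‖z‖ ^ 2 +
      (-(⟪P, z⟫ / R) + ‖z‖ ^ 2 / (2 * R)) ^ 2 := by
    field_simp
    ring
  rw [e]
  nlinarith [sq_nonneg (-(⟪P, z⟫ / R) + ‖z‖ ^ 2 / (2 * R))]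

theorem norm_add_le_of_le_norm_sub {P Q : ℂ} {R κ : ℝ} (hR0 : 0 < R) (hκ0 : 0 ≤ κ)
    (hκ1 : κ ^ 2 ≤ 1) (hP : ‖P‖ = R) (hQ : ‖Q‖ = R)
    (h2 : 2 * R * (1 - κ ^ 2) ≤ (1 + κ ^ 2) * ‖P - Q‖) : ‖P + Q‖ ≤ 4 * κ * R := by
  have h3 : ‖P + Q‖ ^ 2 + ‖P - Q‖ ^ 2 = 4 * R ^ 2 := by
    have := parallelogram_law_with_norm ℝ P Q
    rw [hP, hQ] at this
    nlinarith
  have h4 : (2 * R * (1 - κ ^ 2)) ^ 2 ≤ ((1 + κ ^ 2) * ‖P - Q‖) ^ 2 :=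
    pow_le_pow_left₀ (by nlinarith) h2 2
  have h5 : (1 + κ ^ 2) ^ 2 * ‖P + Q‖ ^ 2 =
      (1 + κ ^ 2) ^ 2 * (4 * R ^ 2) - ((1 + κ ^ 2) * ‖P - Q‖) ^ 2 := by
    linear_combination (1 + κ ^ 2) ^ 2 * h3
  have h6 : (1 + κ ^ 2) ^ 2 * ‖P + Q‖ ^ 2 ≤ (4 * κ * R) ^ 2 := by linarith
  have h7 : 1 ≤ (1 + κ ^ 2) ^ 2 := by nlinarith [sq_nonneg κ]
  refine le_of_sq_le_sq ?_ (by positivity)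
  exact (le_mul_of_one_le_left (sq_nonneg _) h7).trans h6

/-- On small balls `v` is uniformly close to a linear function of slope `h 0`. -/
theorem exists_approx_linear (H : ConjPair h r₀ p u v) {δ : ℝ} (hδ : 0 < δ) :
    ∃ r₁ > 0, ∀ r, 0 < r → r ≤ r₁ → ∃ e : ℂ, ‖e‖ = 1 ∧
      ∀ z, ‖z‖ ≤ r → |v z - h 0 * ⟪e, z⟫| ≤ δ * r := by
  set a := h 0 with ha_def
  have ha : 0 < a := H.h_zero
  set K : ℝ := max 2 (8 * a / δ) with hK
  have hK2 : 2 ≤ K := le_max_left _ _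
  have hK0 : 0 < K := by linarith
  have hKδ : 8 * a ≤ K * δ := (div_le_iff₀ hδ).1 (le_max_right _ _)
  set κ : ℝ := (K ^ 2)⁻¹ with hκ
  have hκ0 : 0 < κ := by positivity
  have hκK : κ * K ^ 2 = 1 := inv_mul_cancel₀ (by positivity)
  have hκ1 : κ ≤ 1 / 4 := by
    have : 4 ≤ K ^ 2 := by nlinarith
    nlinarith
  have hε0 : 0 < κ ^ 2 := by positivity
  have hε1 : κ ^ 2 < 1 := by nlinarith
  obtain ⟨r₂, hr₂, hr₂', hlip⟩ := H.exists_lipschitz_bound (ε := a * κ ^ 2) (by positivity)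
  rw [← ha_def] at hlip
  refine ⟨r₂ / (2 * K), by positivity, fun r hr hrr => ?_⟩
  have hrr' : 2 * (K * r) ≤ r₂ := by
    rw [le_div_iff₀ (by positivity)] at hrr; linarith
  set R := K * r with hR
  have hR0 : 0 < R := by positivity
  have hRr : R < r₂ := by linarith
  have hrR : 2 * r ≤ R := by nlinarith
  obtain ⟨P, hP, hvP⟩ := H.exists_ascent hR0 (hRr.trans_le hr₂') hε0 hε1
  obtain ⟨Q, hQ, hvQ⟩ := H.neg.exists_ascent hR0 (hRr.trans_le hr₂') hε0 hε1
  rw [← ha_def] at hvP hvQ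
  have hPQ : ‖P + Q‖ ≤ 4 * κ * R := by
    refine norm_add_le_of_le_norm_sub hR0 hκ0.le (by nlinarith) hP hQ
      (le_of_mul_le_mul_left ?_ ha)
    have h1 : v P - v Q ≤ (a + a * κ ^ 2) * ‖P - Q‖ :=
      (le_abs_self _).trans (hlip P Q (by rw [hP]; exact hRr) (by rw [hQ]; exact hRr))
    linarith
  have hsum : a * (3 * K * κ ^ 2 + 1 / (2 * K) + 4 * κ) ≤ δ := by
    have e : 3 * K * κ ^ 2 + 1 / (2 * K) + 4 * κ = (3 / K ^ 2 + 1 / 2 + 4 / K) / K := by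
      rw [hκ]; field_simp
    rw [e, mul_div_assoc', div_le_iff₀ hK0]
    have a1 : 3 / K ^ 2 ≤ 1 := by rw [div_le_iff₀ (by positivity)]; nlinarith
    have a2 : 4 / K ≤ 2 := by rw [div_le_iff₀ hK0]; linarith
    nlinarith
  refine ⟨R⁻¹ • P, by rw [norm_smul, norm_inv, Real.norm_of_nonneg hR0.le, hP,
    inv_mul_cancel₀ hR0.ne'], fun z hz => ?_⟩
  have hinner : ⟪R⁻¹ • P, z⟫ = ⟪P, z⟫ / R := by
    rw [real_inner_smul_left]; ring
  have hzr₂ : ‖z‖ < r₂ := by linarith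
  have bP : ‖P - z‖ ≤ 2 * R := (norm_sub_le _ _).trans (by rw [hP]; linarith)
  have bQ : ‖Q - z‖ ≤ 2 * R := (norm_sub_le _ _).trans (by rw [hQ]; linarith)
  have lP : v P - v z ≤ (a + a * κ ^ 2) * ‖P - z‖ :=
    (le_abs_self _).trans (hlip P z (by rw [hP]; exact hRr) hzr₂)
  have lQ : v z - v Q ≤ (a + a * κ ^ 2) * ‖Q - z‖ := by
    rw [norm_sub_rev]
    exact (le_abs_self _).trans (hlip z Q hzr₂ (by rw [hQ]; exact hRr))
  have dP := mul_le_mul_of_nonneg_left (norm_sub_le_of_norm_eq hR0 hrR hr hP hz) ha.le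
  have dQ := mul_le_mul_of_nonneg_left (norm_sub_le_of_norm_eq hR0 hrR hr hQ hz) ha.le
  have bP' := mul_le_mul_of_nonneg_left bP (show 0 ≤ a * κ ^ 2 by positivity)
  have bQ' := mul_le_mul_of_nonneg_left bQ (show 0 ≤ a * κ ^ 2 by positivity)
  have hz2 : ‖z‖ ^ 2 / (2 * R) ≤ r * (1 / (2 * K)) := by
    rw [hR, mul_one_div, div_le_div_iff₀ (by positivity) (by positivity)]
    have : ‖z‖ ^ 2 ≤ r ^ 2 := by gcongr
    nlinarith
  have hz2' := mul_le_mul_of_nonneg_left hz2 ha.le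
  have hPQz : -(⟪Q, z⟫ / R) ≤ ⟪P, z⟫ / R + 4 * κ * r := by
    have h1 : -⟪P + Q, z⟫ ≤ 4 * κ * R * r := by
      refine (neg_le_abs _).trans ((abs_real_inner_le_norm _ _).trans ?_)
      exact mul_le_mul hPQ hz (norm_nonneg _) (by positivity)
    rw [inner_add_left] at h1
    rw [← neg_div, div_le_iff₀ hR0, add_mul, div_mul_cancel₀ _ hR0.ne']
    linarith
  have hPQz' := mul_le_mul_of_nonneg_left hPQz ha.le
  have hfin := mul_le_mul_of_nonneg_right hsum hr.le
  have hRK : a * κ ^ 2 * R = a * (K * κ ^ 2) * r := by rw [hR]; ring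
  have hκr : 0 ≤ a * (4 * κ) * r := by positivity
  rw [hinner, abs_le]
  constructor <;> linarith

end ConjPair

namespace ConjPair

variable {h : ℝ → ℝ} {r₀ : ℝ} {p : ℂ → ℂ} {u v : ℂ → ℝ}

theorem exists_injOn (H : ConjPair h r₀ p u v) {z : ℂ} (hz : z ≠ 0) (hr : ‖z‖ < r₀) :
    ∃ S, IsOpen S ∧ z ∈ S ∧ InjOn (pairMap u v) S :=
  exists_open_injOn_of_jac_ne_zero (H.hasStrictFDerivAt hz hr) (H.jac_pos hz hr).ne'

theorem countable_zeros (H : ConjPair h r₀ p u v) :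
    {z : ℂ | z ≠ 0 ∧ ‖z‖ < r₀ ∧ pairMap u v z = 0}.Countable := by
  have hS : ∀ z : ℂ, ∃ S, (z ≠ 0 ∧ ‖z‖ < r₀) → IsOpen S ∧ z ∈ S ∧ InjOn (pairMap u v) S := fun z => by
    by_cases hz : z ≠ 0 ∧ ‖z‖ < r₀
    · obtain ⟨S, hS⟩ := H.exists_injOn hz.1 hz.2
      exact ⟨S, fun _ => hS⟩
    · exact ⟨∅, fun h => absurd h hz⟩
  choose S hS using hS
  obtain ⟨t, ht, htc, hcov⟩ := TopologicalSpace.countable_cover_nhdsWithin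
    (s := {z : ℂ | z ≠ 0 ∧ ‖z‖ < r₀ ∧ pairMap u v z = 0}) (f := S) fun z hz =>
      mem_nhdsWithin_of_mem_nhds (((hS z ⟨hz.1, hz.2.1⟩).1).mem_nhds (hS z ⟨hz.1, hz.2.1⟩).2.1)
  refine htc.mono fun z hz => ?_
  obtain ⟨y, hy, hzy⟩ := mem_iUnion₂.1 (hcov hz)
  have hy' := ht hy
  have := (hS y ⟨hy'.1, hy'.2.1⟩).2.2 hzy (hS y ⟨hy'.1, hy'.2.1⟩).2.1 (hz.2.2.trans hy'.2.2.symm)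
  rwa [this]

theorem ne_zero_of_annulus {K : NNReal} {Φ : ℂ → ℂ} (hΦ : LipschitzWith K Φ) {r : ℝ} (hr : 0 < r)
    (h : ∀ z, ‖z‖ = r → Φ z ≠ 0) : ∃ R, r < R ∧ ∀ z, r ≤ ‖z‖ → ‖z‖ ≤ R → Φ z ≠ 0 := by
  obtain ⟨m, hm, hle⟩ := exists_pos_le_norm_of_compact (isCompact_sphere (0 : ℂ) r)
    hΦ.continuous.continuousOn (fun z hz => h z (by simpa using hz))
  have hK : (0 : ℝ) ≤ K := K.2
  refine ⟨r + m / (2 * (K + 1)), by linarith [show 0 < m / (2 * (K + 1 : ℝ)) by positivity],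
    fun z hz hzR h0 => ?_⟩
  have hz0 : 0 < ‖z‖ := hr.trans_le hz
  have h1 := hle ((r / ‖z‖) • z) (by
    rw [mem_sphere_zero_iff_norm, norm_smul, Real.norm_of_nonneg (by positivity),
      div_mul_cancel₀ _ hz0.ne'])
  have h2 := hΦ.dist_le_mul ((r / ‖z‖) • z) z
  have h3 : dist ((r / ‖z‖) • z) z = ‖z‖ - r := by
    rw [dist_comm, dist_eq_norm]
    nth_rw 1 [← one_smul ℝ z]
    rw [← sub_smul, norm_smul, Real.norm_of_nonneg, sub_mul, div_mul_cancel₀ _ hz0.ne', one_mul]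
    rw [sub_nonneg, div_le_one hz0]
    exact hz
  rw [h3, h0, dist_zero_right] at h2
  have h4 : ‖z‖ - r ≤ m / (2 * (K + 1)) := by linarith
  rw [le_div_iff₀ (by positivity)] at h4
  nlinarith

theorem exists_pos_forall_ne_zero (H : ConjPair h r₀ p u v) :
    ∃ ρ > 0, ρ ≤ r₀ ∧ ∀ z, z ≠ 0 → ‖z‖ < ρ → pairMap u v z ≠ 0 := by
  set Z := {z : ℂ | z ≠ 0 ∧ ‖z‖ < r₀ ∧ pairMap u v z = 0} with hZ
  obtain ⟨r, hrZ, hr0, hr⟩ := ((H.countable_zeros.image norm).dense_compl ℝ).exists_between H.pos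
  obtain ⟨K, hK⟩ := H.exists_lipschitzWith
  obtain ⟨R, hrR, hne⟩ := ne_zero_of_annulus hK hr0 fun z hz h0 => hrZ
    ⟨z, ⟨norm_pos_iff.1 (hz ▸ hr0), hz ▸ hr, h0⟩, hz⟩
  obtain ⟨c, hc⟩ := exists_hasDeg hK hrR hne
  have hfin : (Z ∩ ball 0 r).Finite := by
    by_contra hinf
    obtain ⟨n, hn⟩ := exists_nat_gt (c / totalWeight)
    obtain ⟨T, hT, hcard⟩ := Set.Infinite.exists_subset_card_eq hinf n
    have hev := eventually_card_mul_le_degInt hK (r := r) (U := ball 0 r₀ \ {0}) isOpen_punctured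
      (fun z hz => H.hasStrictFDerivAt hz.2 (by simpa using hz.1))
      (fun z hz => H.jac_pos hz.2 (by simpa using hz.1))
      (by simpa using H.ae_jac_nonneg hr.le 0) T
      (fun z hz => ⟨⟨by simpa using (hT hz).1.2.1, (hT hz).1.1⟩, (hT hz).2, (hT hz).1.2.2⟩)
    obtain ⟨l, h1, h2⟩ := (hev.and hc).exists
    rw [h2, hcard, ← le_div_iff₀ totalWeight_pos] at h1
    linarith
  obtain ⟨s, hs, hball⟩ := Metric.isOpen_iff.1 hfin.isClosed.isOpen_compl 0 (by simp [hZ])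
  refine ⟨min s r, lt_min hs hr0, (min_le_right _ _).trans hr.le, fun z hz hzs h0 => ?_⟩
  refine hball (show z ∈ ball 0 s by simpa using hzs.trans_le (min_le_left _ _)) ⟨⟨hz, ?_, h0⟩, ?_⟩
  · exact (hzs.trans_le (min_le_right _ _)).trans hr
  · simpa using hzs.trans_le (min_le_right _ _)

/-- Following the level set of `u`, the value of `v` can be lowered at rate larger than `h 0`. -/
theorem exists_curve (H : ConjPair h r₀ p u v) {y : ℂ} (hy : y ≠ 0) (hyr : ‖y‖ < r₀) :
    ∃ γ : ℝ → ℂ, γ 0 = y ∧ ContinuousAt γ 0 ∧ ∀ᶠ t in 𝓝[>] (0 : ℝ),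
      u (γ t) = u y ∧ v (γ t) = v y - t ∧ h 0 * ‖γ t - y‖ < t := by
  obtain ⟨A, hA⟩ := exists_equiv_of_jac_ne_zero (H.jac_pos hy hyr).ne'
  have hs := H.hasStrictFDerivAt hy hyr
  rw [← hA] at hs
  set G := hs.localInverse (pairMap u v) A y with hG
  have hG0 : G (pairMap u v y) = y := hs.localInverse_apply_image
  have hGd : HasStrictFDerivAt G (A.symm : ℂ →L[ℝ] ℂ) (pairMap u v y) := hs.to_localInverse
  have hl : HasDerivAt (fun t : ℝ => pairMap u v y - t • Complex.I) (-Complex.I) 0 := by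
    simpa using ((hasDerivAt_id (0 : ℝ)).smul_const Complex.I).const_sub (pairMap u v y)
  have hcont : Tendsto (fun t : ℝ => pairMap u v y - t • Complex.I) (𝓝 0) (𝓝 (pairMap u v y)) := by
    simpa using hl.continuousAt.tendsto
  have hγ : HasDerivAt (fun t : ℝ => G (pairMap u v y - t • Complex.I)) (A.symm (-Complex.I)) 0 := by
    have hG' : HasFDerivAt G (A.symm : ℂ →L[ℝ] ℂ) (pairMap u v y - (0 : ℝ) • Complex.I) := by
      simpa using hGd.hasFDerivAt
    exact hG'.comp_hasDerivAt (0 : ℝ) hl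
  have hp : 0 < ‖p y‖ := norm_pos_iff.2 (H.p_ne y hy hyr)
  have hh := H.h_pos hy hyr
  have hd : A.symm (-Complex.I) = (-(h ‖p y‖ * ‖p y‖)⁻¹) • (Complex.I * p y) := by
    rw [ContinuousLinearEquiv.symm_apply_eq]
    change _ = (A : ℂ →L[ℝ] ℂ) _
    rw [hA]
    have e : ‖p y‖ ^ 2 = (p y).re ^ 2 + (p y).im ^ 2 := by
      rw [Complex.sq_norm, Complex.normSq_apply]; ring
    apply Complex.ext
    · rw [pairCLM_re, inner_eq]
      simp
      ring
    · rw [pairCLM_im, inner_eq, flux]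
      simp
      field_simp
      linear_combination -e
  have hnorm : ‖A.symm (-Complex.I)‖ < (h 0)⁻¹ := by
    rw [hd, norm_smul, norm_mul, Complex.norm_I, one_mul, norm_neg, norm_inv, norm_mul, norm_norm,
      mul_inv, inv_mul_cancel_right₀ hp.ne', Real.norm_of_nonneg hh.le]
    exact inv_strictAnti₀ H.h_zero (H.h_lt hy hyr)
  refine ⟨fun t => G (pairMap u v y - t • Complex.I), by simpa using hG0, hγ.continuousAt, ?_⟩
  have e1 : ∀ᶠ t : ℝ in 𝓝[>] 0,
      pairMap u v (G (pairMap u v y - t • Complex.I)) = pairMap u v y - t • Complex.I :=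
    (hcont.eventually hs.eventually_right_inverse).filter_mono nhdsWithin_le_nhds
  filter_upwards [e1, hγ.hasDerivWithinAt.limsup_norm_slope_le hnorm, self_mem_nhdsWithin]
    with t h1 h2 ht
  have ht0 : 0 < t := ht
  refine ⟨by simpa [pairMap] using congrArg Complex.re h1,
    by simpa [pairMap] using congrArg Complex.im h1, ?_⟩
  rw [sub_zero, Real.norm_of_nonneg ht0.le, zero_smul, sub_zero, hG0, inv_mul_lt_iff₀ ht0,
    lt_mul_inv_iff₀ H.h_zero] at h2
  linarith

theorem le_of_u_eq_zero (H : ConjPair h r₀ p u v) {R : ℝ} (hRr : R < r₀)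
    (hne : ∀ z, z ≠ 0 → ‖z‖ ≤ R → pairMap u v z ≠ 0) {z : ℂ} (hz : 2 * ‖z‖ ≤ R) (hu : u z = 0)
    (hv : 0 ≤ v z) : h 0 * ‖z‖ ≤ v z := by
  have ha := H.h_zero
  have hvc := H.continuous_v
  have hzn := norm_nonneg z
  have hS : IsCompact (closedBall (0 : ℂ) R ∩ {y | u y = 0 ∧ 0 ≤ v y}) :=
    (isCompact_closedBall _ _).inter_right
      ((isClosed_eq H.continuous_u continuous_const).inter (isClosed_le continuous_const hvc))
  have hg : Continuous fun y => v y + h 0 * ‖y - z‖ := by fun_prop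
  obtain ⟨y, ⟨hyR, huy, hvy⟩, hmin⟩ := hS.exists_isMinOn
    ⟨z, by rw [mem_closedBall_zero_iff]; linarith, hu, hv⟩ hg.continuousOn
  have hle : v y + h 0 * ‖y - z‖ ≤ v z := by
    have := hmin (show z ∈ closedBall (0 : ℂ) R ∩ {y | u y = 0 ∧ 0 ≤ v y} from
      ⟨by rw [mem_closedBall_zero_iff]; linarith, hu, hv⟩)
    simpa using this
  rw [mem_closedBall_zero_iff] at hyR
  rcases eq_or_ne y 0 with rfl | hy0
  · rw [zero_sub, norm_neg] at hle
    linarith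
  rcases hyR.eq_or_lt with heq | hlt
  · have := norm_sub_norm_le y z
    nlinarith
  exfalso
  have hvy' : 0 < v y := lt_of_le_of_ne hvy fun h0 =>
    hne y hy0 hyR (Complex.ext (by simpa [pairMap] using huy) (by simpa [pairMap] using h0.symm))
  obtain ⟨γ, hγ0, hγc, hγ⟩ := H.exists_curve hy0 (hyR.trans_lt hRr)
  have h1 : ∀ᶠ t in 𝓝[>] (0 : ℝ), ‖γ t‖ < R := by
    refine (hγc.norm.eventually (gt_mem_nhds ?_)).filter_mono nhdsWithin_le_nhds
    simpa [hγ0] using hlt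
  have h2 : ∀ᶠ t in 𝓝[>] (0 : ℝ), t < v y :=
    (gt_mem_nhds hvy').filter_mono nhdsWithin_le_nhds
  obtain ⟨t, h1, h2, h3, h4, h5⟩ := (h1.and (h2.and hγ)).exists
  have := hmin (show γ t ∈ closedBall (0 : ℂ) R ∩ {y | u y = 0 ∧ 0 ≤ v y} from
    ⟨by simpa using h1.le, h3.trans huy, by show 0 ≤ v (γ t); linarith⟩)
  simp only [mem_ofPred_eq] at this
  have h6 : ‖γ t - z‖ ≤ ‖γ t - y‖ + ‖y - z‖ := norm_sub_le_norm_sub_add_norm_sub _ _ _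
  nlinarith

theorem le_abs_of_u_eq_zero (H : ConjPair h r₀ p u v) {R : ℝ} (hRr : R < r₀)
    (hne : ∀ z, z ≠ 0 → ‖z‖ ≤ R → pairMap u v z ≠ 0) {z : ℂ} (hz : 2 * ‖z‖ ≤ R) (hu : u z = 0) :
    h 0 * ‖z‖ ≤ |v z| := by
  rcases le_total 0 (v z) with hv | hv
  · exact (H.le_of_u_eq_zero hRr hne hz hu hv).trans (le_abs_self _)
  · refine (H.neg.le_of_u_eq_zero hRr (fun z hz hzR h0 => hne z hz hzR ?_) hz (by simpa using hu)
      (by simpa using hv)).trans (neg_le_abs _)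
    apply Complex.ext
    · simpa [pairMap] using congrArg Complex.re h0
    · simpa [pairMap] using congrArg Complex.im h0

end ConjPair
theorem combination_ne_zero {x y s : ℝ} (hs : s ∈ Icc (0 : ℝ) 1) (h : 0 < x * y) :
    y + s * (x - y) ≠ 0 := by
  have h1 : 0 ≤ 1 - s := by linarith [hs.2]
  have h2 := hs.1
  rcases pos_and_pos_or_neg_and_neg_of_mul_pos h with ⟨hx, hy⟩ | ⟨hx, hy⟩
  · have : 0 < (1 - s) * y + s * x := by
      rcases h2.eq_or_lt with rfl | h3
      · linarith
      · nlinarith [mul_pos h3 hx, mul_nonneg h1 hy.le]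
    intro h0
    linarith
  · have : (1 - s) * y + s * x < 0 := by
      rcases h2.eq_or_lt with rfl | h3
      · linarith
      · nlinarith [mul_pos h3 (neg_pos.2 hx), mul_nonneg h1 (neg_pos.2 hy).le]
    intro h0
    linarith

theorem HasDeg.of_same_sign {K K' : NNReal} {Φ Φ' : ℂ → ℂ} (hΦ : LipschitzWith K Φ)
    (hΦ' : LipschitzWith K' Φ') {r R c : ℝ} (hrR : r < R)
    (h : ∀ z, r ≤ ‖z‖ → ‖z‖ ≤ R → 0 < (Φ z).re * (Φ' z).re ∨ 0 < (Φ z).im * (Φ' z).im)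
    (hc : HasDeg r Φ' c) : HasDeg r Φ c := by
  refine HasDeg.congr hΦ hΦ' hrR (fun z h1 h2 s hs h0 => ?_) hc
  rcases h z h1 h2 with h3 | h3
  · exact combination_ne_zero hs h3 (by simpa using congrArg Complex.re h0)
  · exact combination_ne_zero hs h3 (by simpa using congrArg Complex.im h0)

theorem IsPreconnected.sign_const {T : Set ℂ} (hT : IsPreconnected T) {u : ℂ → ℝ}
    (hu : Continuous u) (h0 : ∀ z ∈ T, u z ≠ 0) :
    ∃ σ : ℝ, (σ = 1 ∨ σ = -1) ∧ ∀ z ∈ T, 0 < u z * σ := by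
  by_cases h : ∃ y ∈ T, u y < 0
  · obtain ⟨y, hy, huy⟩ := h
    refine ⟨-1, Or.inr rfl, fun z hz => ?_⟩
    by_contra! hcon
    obtain ⟨w, hw, hw0⟩ := hT.intermediate_value₂ hy hz hu.continuousOn
      (continuousOn_const (c := (0 : ℝ))) huy.le (by linarith)
    exact h0 w hw hw0
  · push Not at h
    exact ⟨1, Or.inl rfl, fun z hz => by
      rw [mul_one]; exact lt_of_le_of_ne (h z hz) (h0 z hz).symm⟩

theorem normSq_eq_inner_sq {e : ℂ} (he : ‖e‖ = 1) (z : ℂ) :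
    ‖z‖ ^ 2 = ⟪-(Complex.I * e), z⟫ ^ 2 + ⟪e, z⟫ ^ 2 := by
  have e1 : e.re ^ 2 + e.im ^ 2 = 1 := by
    have : ‖e‖ ^ 2 = 1 := by rw [he, one_pow]
    rw [Complex.sq_norm, Complex.normSq_apply] at this
    linarith
  rw [Complex.sq_norm, Complex.normSq_apply, inner_eq, inner_eq]
  simp
  linear_combination (-(z.re ^ 2) - z.im ^ 2) * e1

/-- The affine map with components `α x + β` and `y`, in the frame given by `e`. -/
def frameMap (e : ℂ) (α β : ℝ) : ℂ → ℂ :=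
  pairMap (fun z => α * ⟪-(Complex.I * e), z⟫ + β) (fun z => ⟪e, z⟫)

theorem hasFDerivAt_frameMap (e : ℂ) (α β : ℝ) (z : ℂ) :
    HasFDerivAt (frameMap e α β) (pairCLM (α • -(Complex.I * e)) (-(Complex.I * e))) z := by
  refine hasFDerivAt_pairMap ?_ ?_
  · have := (((innerSL ℝ (-(Complex.I * e))).hasFDerivAt (x := z)).const_mul α).add_const β
    refine this.congr_fderiv ?_
    rw [map_smul]
  · have e1 : Complex.I * -(Complex.I * e) = e := by
      rw [mul_neg, ← mul_assoc, Complex.I_mul_I]; ring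
    rw [e1]
    exact (innerSL ℝ e).hasFDerivAt

theorem jac_frameMap {e : ℂ} (he : ‖e‖ = 1) (α β : ℝ) (z : ℂ) :
    jac (fderiv ℝ (frameMap e α β) z) = α := by
  rw [(hasFDerivAt_frameMap e α β z).fderiv, jac_pairCLM, real_inner_smul_left,
    real_inner_self_eq_norm_sq, norm_neg, norm_mul, Complex.norm_I, he]
  ring

theorem exists_lipschitzWith_frameMap (e : ℂ) (α β : ℝ) :
    ∃ K, LipschitzWith K (frameMap e α β) := by
  refine exists_lipschitzWith_pairMap ?_ ⟨_, (innerSL ℝ e).lipschitz⟩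
  refine ⟨‖α • innerSL ℝ (-(Complex.I * e))‖₊, LipschitzWith.of_dist_le_mul fun x y => ?_⟩
  have := (α • innerSL ℝ (-(Complex.I * e))).lipschitz.dist_le_mul x y
  refine le_trans (le_of_eq ?_) this
  simp only [Real.dist_eq, smul_apply, innerSL_apply_apply, smul_eq_mul]
  congr 1
  ring

theorem frameMap_one_zero (e z : ℂ) :
    frameMap e 1 0 z = z * (Complex.I * (starRingEnd ℂ) e) := by
  apply Complex.ext
  · simp [frameMap, pairMap]
  · simp [frameMap, pairMap]

theorem hasDeg_frameMap {e : ℂ} (he : ‖e‖ = 1) {r : ℝ} (hr : 0 < r) :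
    HasDeg r (frameMap e 1 0) totalWeight := by
  rw [show frameMap e 1 0 = fun z => z * (Complex.I * (starRingEnd ℂ) e) from
    funext (frameMap_one_zero e)]
  exact hasDeg_mul_const (by simp [he]) hr

theorem convex_strip (q e : ℂ) (a b c : ℝ) :
    Convex ℝ {z : ℂ | ‖z‖ ≤ a ∧ b ≤ ⟪q, z⟫ ∧ |⟪e, z⟫| ≤ c} := by
  intro x hx y hy s t hs ht hst
  have hx3 := abs_le.1 hx.2.2
  have hy3 := abs_le.1 hy.2.2
  refine ⟨?_, ?_, ?_⟩
  · have := convex_closedBall (0 : ℂ) a (x := x) (by simpa using hx.1) (y := y)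
      (by simpa using hy.1) hs ht hst
    simpa using this
  · rw [inner_add_right, inner_smul_right, inner_smul_right]
    have h1 := mul_le_mul_of_nonneg_left hx.2.1 hs
    have h2 := mul_le_mul_of_nonneg_left hy.2.1 ht
    have h3 : s * b + t * b = b := by rw [← add_mul, hst, one_mul]
    linarith
  · rw [inner_add_right, inner_smul_right, inner_smul_right, abs_le]
    constructor
    · nlinarith
    · nlinarith

namespace ConjPair

variable {h : ℝ → ℝ} {r₀ : ℝ} {p : ℂ → ℂ} {u v : ℂ → ℝ}

theorem exists_frame (H : ConjPair h r₀ p u v) :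
    ∃ r₁ > 0, r₁ < r₀ ∧ (∀ z, z ≠ 0 → ‖z‖ ≤ 2 * r₁ → pairMap u v z ≠ 0) ∧
      ∀ r, 0 < r → r ≤ r₁ → ∃ e : ℂ, ‖e‖ = 1 ∧
      (∀ z, ‖z‖ ≤ 2 * r → |v z - h 0 * ⟪e, z⟫| ≤ h 0 * r / 5) ∧
      ∀ z, 4 / 5 * r ≤ ‖z‖ → ‖z‖ ≤ 2 * r → |⟪e, z⟫| ≤ r / 2 → u z ≠ 0 := by
  obtain ⟨ρ, hρ, hρr, hne⟩ := H.exists_pos_forall_ne_zero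
  have ha := H.h_zero
  obtain ⟨r₂, hr₂, happ⟩ := H.exists_approx_linear (δ := h 0 / 10) (by positivity)
  refine ⟨min (ρ / 8) (r₂ / 2), by positivity, ?_, ?_, ?_⟩
  · have := min_le_left (ρ / 8) (r₂ / 2)
    linarith
  · intro z hz hz'
    have := min_le_left (ρ / 8) (r₂ / 2)
    exact hne z hz (by linarith)
  intro r hr hrr
  have h1 : r ≤ ρ / 8 := hrr.trans (min_le_left _ _)
  have h2 : r ≤ r₂ / 2 := hrr.trans (min_le_right _ _)
  obtain ⟨e, he, hv⟩ := happ (2 * r) (by positivity) (by linarith)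
  refine ⟨e, he, fun z hz => (hv z hz).trans (by linarith), fun z hz hz' hez hu => ?_⟩
  have h3 := H.le_abs_of_u_eq_zero (R := ρ / 2) (by linarith)
    (fun z hz hzR => hne z hz (by linarith)) (z := z) (by linarith) hu
  have h4 := abs_le.1 (hv z hz')
  have h5 := abs_le.1 hez
  have h6 : |v z| ≤ 7 / 10 * (h 0 * r) := by
    rw [abs_le]
    constructor <;> nlinarith
  have h7 : 0 < h 0 * r := by positivity
  nlinarith

theorem exists_hasDeg_totalWeight (H : ConjPair h r₀ p u v) :
    ∃ r₁ > 0, r₁ < r₀ ∧ (∀ z, z ≠ 0 → ‖z‖ ≤ 2 * r₁ → pairMap u v z ≠ 0) ∧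
      ∀ r, 0 < r → r ≤ r₁ → HasDeg r (pairMap u v) totalWeight := by
  obtain ⟨r₁, hr₁, hr₁', hne, hfr⟩ := H.exists_frame
  refine ⟨r₁, hr₁, hr₁', hne, fun r hr hrr => ?_⟩
  obtain ⟨e, he, hv, hu⟩ := hfr r hr hrr
  have ha := H.h_zero
  have har : 0 < h 0 * r := by positivity
  obtain ⟨K, hK⟩ := H.exists_lipschitzWith
  have hlow : ∀ q z : ℂ, ‖q‖ = 1 → 4 / 5 * r ≤ ⟪q, z⟫ → 4 / 5 * r ≤ ‖z‖ := fun q z hq hz => by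
    have := real_inner_le_norm q z
    rw [hq] at this
    linarith
  have hq1 : ‖-(Complex.I * e)‖ = 1 := by simp [he]
  have hq2 : ‖Complex.I * e‖ = 1 := by simp [he]
  obtain ⟨σ, hσ, hσT⟩ := IsPreconnected.sign_const
    (convex_strip (-(Complex.I * e)) e (2 * r) (4 / 5 * r) (r / 2)).isPreconnected H.continuous_u
    fun z hz => hu z (hlow _ z hq1 hz.2.1) hz.1 hz.2.2
  obtain ⟨τ, hτ, hτT⟩ := IsPreconnected.sign_const
    (convex_strip (Complex.I * e) e (2 * r) (4 / 5 * r) (r / 2)).isPreconnected H.continuous_u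
    fun z hz => hu z (hlow _ z hq2 hz.2.1) hz.1 hz.2.2
  have key : ∀ α β : ℝ, (∀ x : ℝ, 4 / 5 * r ≤ x → 0 < σ * (α * x + β)) →
      (∀ x : ℝ, x ≤ -(4 / 5 * r) → 0 < τ * (α * x + β)) → ∀ z, r ≤ ‖z‖ → ‖z‖ ≤ 2 * r →
      0 < (pairMap u v z).re * (frameMap e α β z).re ∨
        0 < (pairMap u v z).im * (frameMap e α β z).im := by
    intro α β h1 h2 z hz hz'
    have hvz := abs_le.1 (hv z hz')
    by_cases hy : |⟪e, z⟫| ≤ r / 2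
    · left
      have hy2 : ⟪e, z⟫ ^ 2 ≤ (r / 2) ^ 2 := sq_le_sq' (abs_le.1 hy).1 (abs_le.1 hy).2
      have hx2 := normSq_eq_inner_sq he z
      have hz2 : r ^ 2 ≤ ‖z‖ ^ 2 := by gcongr
      have hx3 : (4 / 5 * r) ^ 2 ≤ ⟪-(Complex.I * e), z⟫ ^ 2 := by nlinarith
      rcases le_abs.1 ((le_abs_self _).trans (sq_le_sq.1 hx3)) with hx | hx
      · have a1 := hσT z ⟨hz', hx, hy⟩
        have a2 := h1 _ hx
        change 0 < u z * (α * ⟪-(Complex.I * e), z⟫ + β)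
        rcases hσ with rfl | rfl <;> nlinarith
      · have a1 := hτT z ⟨hz', by rw [inner_neg_left, neg_neg] at hx; exact hx, hy⟩
        have a2 := h2 ⟪-(Complex.I * e), z⟫ (by linarith)
        change 0 < u z * (α * ⟪-(Complex.I * e), z⟫ + β)
        rcases hτ with rfl | rfl <;> nlinarith
    · right
      push Not at hy
      change 0 < v z * ⟪e, z⟫
      rcases lt_abs.1 hy with hy | hy
      · exact mul_pos (by nlinarith) (by linarith)
      · exact mul_pos_of_neg_of_neg (by nlinarith) (by linarith)
  have bad : ∀ α β : ℝ, α ≤ 0 → (∀ x : ℝ, 4 / 5 * r ≤ x → 0 < σ * (α * x + β)) →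
      (∀ x : ℝ, x ≤ -(4 / 5 * r) → 0 < τ * (α * x + β)) → False := by
    intro α β hα h1 h2
    obtain ⟨K', hK'⟩ := exists_lipschitzWith_frameMap e α β
    obtain ⟨c, hc⟩ := exists_hasDeg hK' (show r < 2 * r by linarith) fun z hz hz' h0 => by
      have := key α β h1 h2 z hz hz'
      simp [h0] at this
    have hc0 : c ≤ 0 := hc.nonpos hK' fun z => by rwa [jac_frameMap he]
    exact hc0.not_gt (H.hasDeg_pos hr (by linarith)
      (HasDeg.of_same_sign hK hK' (by linarith) (key α β h1 h2) hc))
  rcases hσ with rfl | rfl <;> rcases hτ with rfl | rfl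
  · exact (bad 0 1 le_rfl (fun x hx => by norm_num) (fun x hx => by norm_num)).elim
  · obtain ⟨K', hK'⟩ := exists_lipschitzWith_frameMap e 1 0
    exact HasDeg.of_same_sign hK hK' (show r < 2 * r by linarith)
      (key 1 0 (fun x hx => by linarith) (fun x hx => by linarith)) (hasDeg_frameMap he hr)
  · exact (bad (-1) 0 (by norm_num) (fun x hx => by linarith) (fun x hx => by linarith)).elim
  · exact (bad 0 (-1) le_rfl (fun x hx => by norm_num) (fun x hx => by norm_num)).elim

theorem exists_ball_injOn (H : ConjPair h r₀ p u v) :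
    ∃ s > 0, s < r₀ ∧ InjOn (pairMap u v) (ball 0 s) := by
  obtain ⟨r, hr, hrr, hne, hdeg⟩ := H.exists_hasDeg_totalWeight
  obtain ⟨K, hK⟩ := H.exists_lipschitzWith
  obtain ⟨m, hm, hle⟩ := exists_pos_le_norm_of_compact (isCompact_annulus r (2 * r))
    hK.continuous.continuousOn fun z hz => hne z (norm_pos_iff.1 (hr.trans_le hz.1)) hz.2
  have hsm : ∀ᶠ z in 𝓝 (0 : ℂ), ‖pairMap u v z‖ < m := by
    refine H.continuous_map.norm.continuousAt.eventually (gt_mem_nhds ?_)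
    simpa [H.map_zero] using hm
  obtain ⟨s, hs, hball⟩ := Metric.eventually_nhds_iff_ball.1 hsm
  refine ⟨min s r, lt_min hs hr, (min_le_right _ _).trans_lt hrr, fun z₁ hz₁ z₂ hz₂ heq => ?_⟩
  by_contra hz
  have hr1 : ∀ z ∈ ball (0 : ℂ) (min s r), ‖z‖ < r := fun z hz =>
    (mem_ball_zero_iff.1 hz).trans_le (min_le_right _ _)
  set q := pairMap u v z₁ with hq
  have hqm : ‖q‖ < m := hball _ (ball_subset_ball (min_le_left _ _) hz₁)
  have hq0 : q ≠ 0 := fun h0 => by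
    have a1 : z₁ = 0 := by_contra fun h1 => hne z₁ h1 (by linarith [hr1 z₁ hz₁]) h0
    have a2 : z₂ = 0 := by_contra fun h1 => hne z₂ h1 (by linarith [hr1 z₂ hz₂]) (heq.symm.trans h0)
    exact hz (a1.trans a2.symm)
  have h1 : z₁ ≠ 0 := fun h => hq0 (by rw [hq, h, H.map_zero])
  have h2 : z₂ ≠ 0 := fun h => hq0 (by rw [heq, h, H.map_zero])
  have hKq : LipschitzWith K fun z => pairMap u v z - q :=
    LipschitzWith.of_dist_le_mul fun x y => by
      rw [dist_sub_right]; exact hK.dist_le_mul x y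
  have hd : HasDeg r (fun z => pairMap u v z - q) totalWeight := by
    refine HasDeg.congr hKq hK (show r < 2 * r by linarith) (fun z hz hz' t ht h0 => ?_)
      (hdeg r hr le_rfl)
    have h3 : pairMap u v z = t • q := by
      rw [sub_sub_cancel_left, smul_neg, ← sub_eq_add_neg] at h0
      exact sub_eq_zero.1 h0
    have h4 := hle z ⟨hz, hz'⟩
    rw [h3, norm_smul, Real.norm_of_nonneg ht.1] at h4
    have := mul_le_of_le_one_left (norm_nonneg q) ht.2
    linarith
  have hev := eventually_card_mul_le_degInt hKq (r := r) (U := ball 0 r₀ \ {0}) isOpen_punctured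
    (fun z hz => (H.hasStrictFDerivAt hz.2 (by simpa using hz.1)).sub_const q)
    (fun z hz => H.jac_pos hz.2 (by simpa using hz.1))
    (H.ae_jac_nonneg hrr.le q) {z₁, z₂} (by
      intro z hz
      rcases Finset.mem_insert.1 hz with rfl | hz
      · exact ⟨⟨by simpa using (hr1 _ hz₁).trans hrr, h1⟩, by simpa using hr1 _ hz₁, sub_self _⟩
      · rw [Finset.mem_singleton.1 hz]
        exact ⟨⟨by simpa using (hr1 _ hz₂).trans hrr, h2⟩, by simpa using hr1 _ hz₂,
          sub_eq_zero.2 heq.symm⟩)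
  obtain ⟨l, h3, h4⟩ := (hev.and hd).exists
  rw [h4, Finset.card_pair hz] at h3
  have := totalWeight_pos
  push_cast at h3
  linarith

end ConjPair
theorem isPreconnected_punctured_closedBall (r : ℝ) :
    IsPreconnected {η : ℂ | η ≠ 0 ∧ ‖η‖ ≤ r} := by
  have h : {η : ℂ | η ≠ 0 ∧ ‖η‖ ≤ r} =
      (fun x : ℝ × ℝ => (x.1 : ℂ) * Complex.exp (x.2 * Complex.I)) '' (Ioc 0 r ×ˢ univ) := by
    ext η
    constructor
    · rintro ⟨h1, h2⟩
      exact ⟨(‖η‖, η.arg), ⟨⟨norm_pos_iff.2 h1, h2⟩, mem_univ _⟩, Complex.norm_mul_exp_arg_mul_I η⟩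
    · rintro ⟨x, ⟨h1, -⟩, rfl⟩
      refine ⟨mul_ne_zero (by exact_mod_cast h1.1.ne') (Complex.exp_ne_zero _), ?_⟩
      dsimp only
      rw [norm_mul, Complex.norm_exp_ofReal_mul_I, Complex.norm_real, mul_one,
        Real.norm_of_nonneg h1.1.le]
      exact h1.2
  rw [h]
  exact (isPreconnected_Ioc.prod isPreconnected_univ).image _ (by fun_prop)

/-- The increment of a plane map. -/
def increment (F : ℂ → ℂ) (η z : ℂ) : ℂ := F (z + η) - F z

theorem lipschitzWith_increment {K : NNReal} {F : ℂ → ℂ} (hF : LipschitzWith K F) (η : ℂ) :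
    LipschitzWith (K + K) (increment F η) := by
  refine LipschitzWith.of_dist_le_mul fun x y => ?_
  have h1 := hF.dist_le_mul (x + η) (y + η)
  have h2 := hF.dist_le_mul x y
  rw [dist_add_right] at h1
  have h3 := dist_sub_sub_le (F (x + η)) (F x) (F (y + η)) (F y)
  push_cast
  rw [add_mul]
  exact h3.trans (add_le_add h1 h2)

/-- The degree of the increment does not depend on the increment, as long as the map is injective. -/
theorem hasDeg_increment_of_injOn {K : NNReal} {F : ℂ → ℂ} (hF : LipschitzWith K F) {r s c : ℝ}
    (hr : 0 < r) (hrs : 3 * r < s) (hinj : InjOn F (ball 0 s)) {η₁ η₂ : ℂ} (h₁ : η₁ ≠ 0)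
    (h₁' : ‖η₁‖ ≤ r) (h₂ : η₂ ≠ 0) (h₂' : ‖η₂‖ ≤ r) (hd : HasDeg r (increment F η₁) c) :
    HasDeg r (increment F η₂) c := by
  have key : ∀ η, η ≠ 0 → ‖η‖ ≤ r → ∃ m > 0, ∀ z, r ≤ ‖z‖ → ‖z‖ ≤ 2 * r → m ≤ ‖increment F η z‖ := by
    intro η h0 hη
    obtain ⟨m, hm, hle⟩ := exists_pos_le_norm_of_compact (isCompact_annulus r (2 * r))
      (lipschitzWith_increment hF η).continuous.continuousOn fun z hz h => by
        have h1 := norm_add_le z η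
        have := hinj (show z + η ∈ ball (0 : ℂ) s by
          rw [mem_ball_zero_iff]; linarith [hz.2]) (show z ∈ ball (0 : ℂ) s by
          rw [mem_ball_zero_iff]; linarith [hz.2]) (sub_eq_zero.1 h)
        exact h0 (by simpa using this)
    exact ⟨m, hm, fun z h1 h2 => hle z ⟨h1, h2⟩⟩
  have hloc : ∀ η, η ≠ 0 → ‖η‖ ≤ r → ∀ᶠ η' in 𝓝 η,
      (HasDeg r (increment F η) c ↔ HasDeg r (increment F η') c) := by
    intro η h0 hη
    obtain ⟨m, hm, hle⟩ := key η h0 hη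
    filter_upwards [Metric.ball_mem_nhds η (show 0 < m / (K + 1) by positivity)] with η' hη'
    rw [mem_ball, lt_div_iff₀ (by positivity)] at hη'
    have hdiff : ∀ z, ‖increment F η' z - increment F η z‖ < m := fun z => by
      have h1 := hF.dist_le_mul (z + η') (z + η)
      rw [dist_add_left, dist_eq_norm] at h1
      rw [increment, increment, sub_sub_sub_cancel_right]
      have := dist_nonneg (x := η') (y := η)
      nlinarith
    have hne : ∀ z, r ≤ ‖z‖ → ‖z‖ ≤ 2 * r → ∀ s ∈ Icc (0 : ℝ) 1,
        increment F η z + s • (increment F η' z - increment F η z) ≠ 0 := by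
      intro z hz hz' s hs h
      have h1 := hle z hz hz'
      rw [eq_neg_of_add_eq_zero_left h, norm_neg, norm_smul, Real.norm_of_nonneg hs.1] at h1
      have := mul_le_of_le_one_left (norm_nonneg (increment F η' z - increment F η z)) hs.2
      linarith [hdiff z]
    constructor
    · exact HasDeg.congr (lipschitzWith_increment hF _) (lipschitzWith_increment hF _)
        (show r < 2 * r by linarith) hne
    · refine HasDeg.congr (lipschitzWith_increment hF _) (lipschitzWith_increment hF _)
        (show r < 2 * r by linarith) fun z hz hz' s hs h => ?_
      refine hne z hz hz' (1 - s) ⟨by linarith [hs.2], by linarith [hs.1]⟩ ?_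
      rw [← h]
      module
  refine ((isPreconnected_punctured_closedBall r).induction₂
    (fun η η' : ℂ => (HasDeg r (increment F η) c ↔ HasDeg r (increment F η') c))
    (fun η hη => (hloc η hη.1 hη.2).filter_mono nhdsWithin_le_nhds)
    (fun x y z _ _ _ h1 h2 => h1.trans h2) (fun x y _ _ h1 => h1.symm)
    ⟨h₁, h₁'⟩ ⟨h₂, h₂'⟩).1 hd

/-- A uniform lower bound for small increments on a compact set of regular points. -/
theorem exists_le_norm_increment {F : ℂ → ℂ} {D : ℂ → ℂ →L[ℝ] ℂ} {A : Set ℂ} (hA : IsCompact A)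
    (hD : ∀ z ∈ A, HasStrictFDerivAt F (D z) z) (hj : ∀ z ∈ A, 0 < jac (D z)) :
    ∃ c > 0, ∃ s > 0, ∀ z ∈ A, ∀ η, ‖η‖ < s → c * ‖η‖ ≤ ‖increment F η z‖ := by
  refine hA.induction_on (p := fun S => ∃ c > 0, ∃ s > 0, ∀ z ∈ S, ∀ η, ‖η‖ < s →
    c * ‖η‖ ≤ ‖increment F η z‖) ⟨1, one_pos, 1, one_pos, by simp⟩ ?_ ?_ ?_
  · rintro S T hST ⟨c, hc, s, hs, h⟩
    exact ⟨c, hc, s, hs, fun z hz => h z (hST hz)⟩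
  · rintro S T ⟨c, hc, s, hs, h⟩ ⟨c', hc', s', hs', h'⟩
    refine ⟨min c c', lt_min hc hc', min s s', lt_min hs hs', fun z hz η hη => ?_⟩
    rcases hz with hz | hz
    · refine le_trans ?_ (h z hz η (hη.trans_le (min_le_left _ _)))
      gcongr
      exact min_le_left _ _
    · refine le_trans ?_ (h' z hz η (hη.trans_le (min_le_right _ _)))
      gcongr
      exact min_le_right _ _
  · intro z hz
    obtain ⟨B, hB⟩ := exists_equiv_of_jac_ne_zero (hj z hz).ne'
    have hs := hD z hz
    rw [← hB] at hs
    obtain ⟨C, hC, hbig⟩ := (hs.isTheta_sub B.toHomeomorph.isInducing).2.exists_pos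
    obtain ⟨ε, hε, hball⟩ := Metric.eventually_nhds_iff_ball.1 hbig.bound
    refine ⟨ball z (ε / 2), mem_nhdsWithin_of_mem_nhds (ball_mem_nhds _ (by positivity)), C⁻¹,
      by positivity, ε / 2, by positivity, fun w hw η hη => ?_⟩
    rw [mem_ball] at hw
    have := hball (w + η, w) (by
      rw [mem_ball, Prod.dist_eq, max_lt_iff]
      refine ⟨?_, by linarith⟩
      calc dist (w + η) z ≤ dist (w + η) w + dist w z := dist_triangle _ _ _
        _ < ε := by rw [dist_self_add_left]; linarith)
    simp only [add_sub_cancel_left] at this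
    rw [inv_mul_le_iff₀ hC]
    exact this

namespace ConjPair

variable {h : ℝ → ℝ} {r₀ : ℝ} {p : ℂ → ℂ} {u v : ℂ → ℝ}

theorem hasFDerivAt_increment (H : ConjPair h r₀ p u v) {z η : ℂ} (hz : z ≠ 0) (hzr : ‖z‖ < r₀)
    (hη : z + η ≠ 0) (hηr : ‖z + η‖ < r₀) :
    HasFDerivAt (increment (pairMap u v) η)
      (pairCLM (p (z + η) - p z) (flux h (p (z + η)) - flux h (p z))) z := by
  rw [← pairCLM_sub]
  exact ((hasFDerivAt_comp_add_right η).2 (H.hasFDerivAt hη hηr)).sub (H.hasFDerivAt hz hzr)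

theorem exists_v_eq_zero (H : ConjPair h r₀ p u v) :
    ∃ r₁ > 0, ∀ t, 0 < t → t ≤ r₁ → ∃ η : ℂ, ‖η‖ = t ∧ v η = 0 := by
  have ha := H.h_zero
  obtain ⟨r₁, hr₁, happ⟩ := H.exists_approx_linear (δ := h 0 / 2) (by positivity)
  refine ⟨r₁, hr₁, fun t ht htr => ?_⟩
  obtain ⟨e, he, hv⟩ := happ t ht htr
  have n1 : ‖t • e‖ = t := by rw [norm_smul, he, mul_one, Real.norm_of_nonneg ht.le]
  have n2 : ‖-(t • e)‖ = t := by rw [norm_neg, n1]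
  have h1 := abs_le.1 (hv (t • e) n1.le)
  have h2 := abs_le.1 (hv (-(t • e)) n2.le)
  have i1 : ⟪e, t • e⟫ = t := by
    rw [real_inner_smul_right, real_inner_self_eq_norm_sq, he]; ring
  rw [inner_neg_right, i1] at h2
  rw [i1] at h1
  have hat : 0 < h 0 * t := by positivity
  have hrank : 1 < Module.rank ℝ ℂ := by rw [Complex.rank_real_complex]; norm_num
  obtain ⟨η, hη, hη0⟩ := (isPreconnected_sphere hrank (0 : ℂ) t).intermediate_value₂
    (show -(t • e) ∈ sphere (0 : ℂ) t by simpa using n2) (show t • e ∈ sphere (0 : ℂ) t by simpa using n1)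
    H.continuous_v.continuousOn (continuousOn_const (c := (0 : ℝ))) (by linarith) (by linarith)
  exact ⟨η, by simpa using hη, hη0⟩

theorem degInt_increment_pos (H : ConjPair h r₀ p u v) {r l : ℝ} {η : ℂ} (hr : 0 < r)
    (hrr : 2 * r < r₀) (hη : η ≠ 0) (hηr : ‖η‖ ≤ r) (hl : 0 < l) (hv : v η = 0)
    (hu : |l * u η| < 1) : 0 < degInt r fun z => l • increment (pairMap u v) η z := by
  obtain ⟨K, hK⟩ := H.exists_lipschitzWith
  have hL := lipschitzWith_increment hK η
  have hη0 : 0 < ‖η‖ := norm_pos_iff.2 hη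
  have hmono : MonotoneOn h (Ici 0) := H.h_mono.monotoneOn
  have hw : ∀ᶠ z in 𝓝 (0 : ℂ), 0 < weight (l • increment (pairMap u v) η z) := by
    refine (continuous_weight.comp (hL.continuous.const_smul l)).continuousAt.eventually
      (lt_mem_nhds ?_)
    have h0 : increment (pairMap u v) η 0 = ⟨u η, 0⟩ := by
      rw [increment, H.map_zero, zero_add, sub_zero, pairMap, hv]
    rw [Function.comp_apply, Pi.smul_apply, h0]
    exact weight_pos (by simpa using hu) (by simp)
  have hp : ∀ᶠ z in 𝓝 (0 : ℂ), ‖p z‖ < ‖p (z + η)‖ := by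
    have c1 : ContinuousAt p 0 := H.continuousAt_p (by simpa using H.pos)
    have c2 : ContinuousAt (fun z => p (z + η)) 0 := by
      have : ContinuousAt p (0 + η) := H.continuousAt_p (by rw [zero_add]; linarith)
      exact ContinuousAt.comp this (continuous_add_const η).continuousAt
    refine c1.norm.eventually_lt c2.norm ?_
    rw [H.p_zero, norm_zero, zero_add]
    exact norm_pos_iff.2 (H.p_ne η hη (by linarith))
  obtain ⟨s, hs, hball⟩ := Metric.eventually_nhds_iff_ball.1 (hw.and hp)
  set τ := min s ‖η‖ with hτ
  have hτ0 : 0 < τ := lt_min hs hη0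
  have hz0 : ∀ z : ℂ, ‖z‖ < τ → z + η ≠ 0 := fun z hz h0 => by
    have : ‖z‖ = ‖η‖ := by rw [eq_neg_of_add_eq_zero_left h0, norm_neg]
    have := min_le_right s ‖η‖
    linarith
  refine degInt_pos (lipschitzWith_smul hL l) ?_ (O := ball 0 τ \ {0})
    (isOpen_ball.sdiff isClosed_singleton) ?_ ?_ ?_
  · filter_upwards [compl_mem_ae_iff.2 (measure_singleton (μ := volume) (0 : ℂ)),
      compl_mem_ae_iff.2 (measure_singleton (μ := volume) (-η))] with z h0 hηz hzr
    rw [mem_ball_zero_iff] at hzr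
    have h1 : z + η ≠ 0 := fun h => hηz (eq_neg_of_add_eq_zero_left h)
    have n1 := norm_add_le z η
    have hd := H.hasFDerivAt_increment h0 (by linarith) h1 (by linarith)
    rw [fderiv_const_smul_jac hd.differentiableAt, hd.fderiv, jac_pairCLM]
    refine mul_nonneg (sq_nonneg _) (le_trans ?_ (le_inner_flux_sub (H.p_ne _ h1 (by linarith))
      (H.p_ne _ h0 (by linarith)) (H.h_pos h1 (by linarith)).le (H.h_pos h0 (by linarith)).le))
    rcases le_total ‖p (z + η)‖ ‖p z‖ with h2 | h2
    · exact mul_nonneg_of_nonpos_of_nonpos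
        (sub_nonpos.2 (hmono (norm_nonneg _) (norm_nonneg _) h2)) (sub_nonpos.2 h2)
    · exact mul_nonneg (sub_nonneg.2 (hmono (norm_nonneg _) (norm_nonneg _) h2)) (sub_nonneg.2 h2)
  · refine ⟨((τ / 2 : ℝ) : ℂ), ?_, ?_⟩
    · rw [mem_ball_zero_iff, Complex.norm_real, Real.norm_of_nonneg (by positivity)]
      linarith
    · simpa using hτ0.ne'
  · exact fun z hz => ball_subset_ball ((min_le_right _ _).trans hηr) hz.1
  · intro z hz
    have hz1 : ‖z‖ < τ := by simpa using hz.1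
    have h1 := hz0 z hz1
    have n1 := norm_add_le z η
    have n2 : ‖z‖ < ‖η‖ := hz1.trans_le (min_le_right _ _)
    obtain ⟨h2, h3⟩ := hball z (ball_subset_ball (min_le_left _ _) hz.1)
    have hd := H.hasFDerivAt_increment hz.2 (by linarith) h1 (by linarith)
    rw [fderiv_const_smul_jac hd.differentiableAt, hd.fderiv, jac_pairCLM]
    refine mul_pos h2 (mul_pos (by positivity) (lt_of_lt_of_le ?_
      (le_inner_flux_sub (H.p_ne _ h1 (by linarith))
      (H.p_ne _ hz.2 (by linarith)) (H.h_pos h1 (by linarith)).le (H.h_pos hz.2 (by linarith)).le)))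
    exact mul_pos (sub_pos.2 (H.h_mono (norm_nonneg _) (norm_nonneg _) h3)) (sub_pos.2 h3)

theorem absurd (H : ConjPair h r₀ p u v) : False := by
  have ha := H.h_zero
  obtain ⟨K, hK⟩ := H.exists_lipschitzWith
  obtain ⟨s, hs, hsr, hinj⟩ := H.exists_ball_injOn
  obtain ⟨r₁, hr₁, happ⟩ := H.exists_approx_linear (δ := h 0 / 10) (by positivity)
  set r := min (s / 4) (r₁ / 3) with hr_def
  have hr : 0 < r := by positivity
  have hrs : 3 * r < s := by
    have := min_le_left (s / 4) (r₁ / 3)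
    linarith
  have hr1 : 3 * r ≤ r₁ := by
    have := min_le_right (s / 4) (r₁ / 3)
    linarith
  obtain ⟨e, he, hv⟩ := happ (3 * r) (by positivity) hr1
  have n1 : ‖r • e‖ = r := by rw [norm_smul, he, mul_one, Real.norm_of_nonneg hr.le]
  have hdeg : HasDeg r (increment (pairMap u v) (r • e)) 0 := by
    refine HasDeg.of_same_sign (lipschitzWith_increment hK _) (LipschitzWith.const Complex.I)
      (show r < 2 * r by linarith) (fun z hz hz' => Or.inr ?_) (hasDeg_const _ _)
    have h1 := abs_le.1 (hv z (by linarith))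
    have h2 := abs_le.1 (hv (z + r • e) ((norm_add_le _ _).trans (by rw [n1]; linarith)))
    rw [inner_add_right, real_inner_smul_right, real_inner_self_eq_norm_sq, he] at h2
    rw [Complex.I_im, mul_one]
    change 0 < v (z + r • e) - v z
    have : 0 < h 0 * r := by positivity
    nlinarith
  obtain ⟨c, hc, s₀, hs₀, hle⟩ := exists_le_norm_increment (isCompact_annulus r (2 * r))
    (fun z hz => H.hasStrictFDerivAt (norm_pos_iff.1 (hr.trans_le hz.1)) (by linarith [hz.2]))
    (fun z hz => H.jac_pos (norm_pos_iff.1 (hr.trans_le hz.1)) (by linarith [hz.2]))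
  have hu : ∀ᶠ z in 𝓝 (0 : ℂ), |u z| ≤ c / 4 * ‖z‖ := by
    have h1 := (H.deriv_u 0 (by simpa using H.pos)).isLittleO.def (show 0 < c / 4 by positivity)
    simpa [H.u_zero, H.p_zero] using h1
  obtain ⟨s₁, hs₁, hball⟩ := Metric.eventually_nhds_iff_ball.1 hu
  obtain ⟨s₂, hs₂, hzero⟩ := H.exists_v_eq_zero
  set t := min (min (s₀ / 2) (s₁ / 2)) (min s₂ r) with ht_def
  have ht : 0 < t := by positivity
  have t0 : t ≤ s₀ / 2 := (min_le_left _ _).trans (min_le_left _ _)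
  have t1 : t ≤ s₁ / 2 := (min_le_left _ _).trans (min_le_right _ _)
  have t2 : t ≤ s₂ := (min_le_right _ _).trans (min_le_left _ _)
  have t3 : t ≤ r := (min_le_right _ _).trans (min_le_right _ _)
  obtain ⟨η, hη, hvη⟩ := hzero t ht t2
  have hη0 : η ≠ 0 := norm_pos_iff.1 (hη ▸ ht)
  have huη := hball η (by rw [mem_ball_zero_iff]; linarith)
  have hdegη : HasDeg r (increment (pairMap u v) η) 0 :=
    hasDeg_increment_of_injOn hK hr hrs hinj
      (norm_pos_iff.1 (hr.trans_eq n1.symm)) n1.le hη0 (hη ▸ t3) hdeg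
  have hct : 0 < c * t := by positivity
  have h1 := hasDeg_degInt (lipschitzWith_increment hK η) (show r < 2 * r by linarith) hct
    (fun z hz hz' => hη ▸ hle z ⟨hz, hz'⟩ η (by linarith)) (l := 2 / (c * t)) (by positivity)
    (by rw [div_mul_cancel₀ _ hct.ne'])
  have h2 := H.degInt_increment_pos (l := 2 / (c * t)) hr (by linarith) hη0 (hη ▸ t3)
    (by positivity) hvη (by
      rw [abs_mul, abs_of_pos (show 0 < 2 / (c * t) by positivity), div_mul_eq_mul_div,
        div_lt_one hct]
      rw [hη] at huη
      linarith)
  exact h2.ne' (h1.unique hdegη)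

end ConjPair

open scoped Convolution

/-- The mollification of a planar vector field by a normalized bump function. -/
def mollify (ψ : ContDiffBump (0 : ℂ)) (X : ℂ → ℂ) : ℂ → ℂ :=
  ψ.normed volume ⋆[ContinuousLinearMap.lsmul ℝ ℝ, volume] X

theorem norm_mollify_le {ψ : ContDiffBump (0 : ℂ)} {X : ℂ → ℂ} {M : ℝ} (hM : ∀ z, ‖X z‖ ≤ M)
    (x : ℂ) : ‖mollify ψ X x‖ ≤ M := by
  rw [mollify, convolution_def]
  have h1 : Integrable (fun t : ℂ => ψ.normed volume t * M) volume :=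
    ψ.integrable_normed.mul_const M
  calc ‖∫ t, ContinuousLinearMap.lsmul ℝ ℝ (ψ.normed volume t) (X (x - t))‖
      ≤ ∫ t, ψ.normed volume t * M := by
        refine norm_integral_le_of_norm_le h1 (ae_of_all _ fun t => ?_)
        rw [ContinuousLinearMap.lsmul_apply, norm_smul, Real.norm_of_nonneg (ψ.nonneg_normed t)]
        exact mul_le_mul_of_nonneg_left (hM _) (ψ.nonneg_normed t)
    _ = M := by rw [integral_mul_const, ψ.integral_normed, one_mul]

theorem hasFDerivAt_mollify (ψ : ContDiffBump (0 : ℂ)) {X : ℂ → ℂ} (hX : LocallyIntegrable X)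
    (x : ℂ) : ∃ D : ℂ →L[ℝ] ℂ, HasFDerivAt (mollify ψ X) D x ∧
      (∀ w, Integrable fun t => fderiv ℝ (ψ.normed volume) t w • X (x - t)) ∧
      ∀ w, D w = ∫ t, fderiv ℝ (ψ.normed volume) t w • X (x - t) := by
  have hs : HasCompactSupport (ψ.normed volume) := ψ.hasCompactSupport_normed
  have hc : ContDiff ℝ 1 (ψ.normed volume) := ψ.contDiff_normed
  have hd := hs.hasFDerivAt_convolution_left (ContinuousLinearMap.lsmul ℝ ℝ) hc hX x
  have hi : ConvolutionExistsAt (fderiv ℝ (ψ.normed volume)) X x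
      ((ContinuousLinearMap.lsmul ℝ ℝ).precompL ℂ) volume :=
    (hs.fderiv ℝ).convolutionExists_left _ (hc.continuous_fderiv one_ne_zero) hX x
  refine ⟨_, hd, fun w => ?_, fun w => ?_⟩
  · exact ((ContinuousLinearMap.apply ℝ ℂ w).integrable_comp hi).congr
      (ae_of_all _ fun t => by simp)
  · rw [convolution_def, ContinuousLinearMap.integral_apply hi]
    exact integral_congr_ae (ae_of_all _ fun t => by simp)

/-- The mollification of a weakly divergence free field is divergence free. -/
theorem div_mollify_eq_zero {ψ : ContDiffBump (0 : ℂ)} {X : ℂ → ℂ} {R : ℝ}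
    (hψ : ψ.rOut < R / 2)
    (hdiv : ∀ φ : ℂ → ℝ, ContDiff ℝ (⊤ : ℕ∞) φ → HasCompactSupport φ → tsupport φ ⊆ ball 0 R →
      ∫ z, fderiv ℝ φ z (X z) = 0)
    {x : ℂ} (hx : ‖x‖ < R / 2) {D : ℂ →L[ℝ] ℂ}
    (hi : ∀ w, Integrable fun t => fderiv ℝ (ψ.normed volume) t w • X (x - t))
    (hD : ∀ w, D w = ∫ t, fderiv ℝ (ψ.normed volume) t w • X (x - t)) :
    (D 1).re + (D Complex.I).im = 0 := by
  have hc : ContDiff ℝ (⊤ : ℕ∞) (ψ.normed volume) := ψ.contDiff_normed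
  have h1 : (D 1).re = ∫ t, fderiv ℝ (ψ.normed volume) t 1 * (X (x - t)).re := by
    rw [hD, ← Complex.reCLM_apply, ← Complex.reCLM.integral_comp_comm (hi 1)]
    simp
  have h2 : (D Complex.I).im = ∫ t, fderiv ℝ (ψ.normed volume) t Complex.I * (X (x - t)).im := by
    rw [hD, ← Complex.imCLM_apply, ← Complex.imCLM.integral_comp_comm (hi Complex.I)]
    simp
  have i1 : Integrable fun t => fderiv ℝ (ψ.normed volume) t 1 * (X (x - t)).re := by
    simpa using Complex.reCLM.integrable_comp (hi 1)
  have i2 : Integrable fun t => fderiv ℝ (ψ.normed volume) t Complex.I * (X (x - t)).im := by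
    simpa using Complex.imCLM.integrable_comp (hi Complex.I)
  have h3 : (D 1).re + (D Complex.I).im =
      ∫ t, fderiv ℝ (ψ.normed volume) t (X (x - t)) := by
    rw [h1, h2, ← integral_add i1 i2]
    refine integral_congr_ae (ae_of_all _ fun t => ?_)
    have : X (x - t) = (X (x - t)).re • (1 : ℂ) + (X (x - t)).im • Complex.I := by
      simp [Complex.re_add_im]
    beta_reduce
    conv_rhs => rw [this, map_add, map_smul, map_smul]
    simp only [smul_eq_mul]
    ring
  have h4 := integral_sub_left_eq_self
    (fun t => fderiv ℝ (ψ.normed volume) t (X (x - t))) volume x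
  simp only [sub_sub_cancel] at h4
  rw [h3, ← h4, ← neg_eq_zero, ← integral_neg]
  have hsup : Function.support (fun y => ψ.normed volume (x - y)) ⊆ closedBall x ψ.rOut := by
    intro y hy
    have : x - y ∈ Function.support (ψ.normed volume) := hy
    rw [ψ.support_normed_eq, mem_ball_zero_iff] at this
    rw [mem_closedBall, dist_comm, dist_eq_norm]
    exact this.le
  have hts : tsupport (fun y => ψ.normed volume (x - y)) ⊆ closedBall x ψ.rOut :=
    closure_minimal hsup isClosed_closedBall
  rw [← hdiv (fun y => ψ.normed volume (x - y)) (hc.comp (contDiff_const.sub contDiff_id))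
    (HasCompactSupport.of_support_subset_isCompact (isCompact_closedBall x ψ.rOut) hsup)
    (hts.trans fun y hy => ?_)]
  · refine integral_congr_ae (ae_of_all _ fun y => ?_)
    have hd := ((hc.differentiable (by simp)) (x - y)).hasFDerivAt.comp y
      ((hasFDerivAt_id y).const_sub x)
    have : fderiv ℝ (fun y => ψ.normed volume (x - y)) y = _ := hd.fderiv
    simp only [this]
    simp
  · rw [mem_ball_zero_iff]
    have hy' : ‖y - x‖ ≤ ψ.rOut := by rwa [mem_closedBall, dist_eq_norm] at hy
    have := norm_add_le (y - x) x
    rw [sub_add_cancel] at this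
    linarith

/-- A divergence free field on a disc has a stream function. -/
theorem hasFDerivAt_integral_of_div_eq_zero {Y : ℂ → ℂ} {r : ℝ} {D : ℂ → ℂ →L[ℝ] ℂ}
    (hD : ∀ x, ‖x‖ < r → HasFDerivAt Y (D x) x)
    (hdiv : ∀ x, ‖x‖ < r → (D x 1).re + (D x Complex.I).im = 0) {w : ℂ} (hw : ‖w‖ < r) :
    HasFDerivAt (fun w => ∫ t in (0 : ℝ)..1, ⟪Complex.I * Y (t • w), w⟫)
      (innerSL ℝ (Complex.I * Y w)) w := by
  let L : ℂ →L[ℝ] ℂ := ContinuousLinearMap.mul ℝ ℂ Complex.I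
  have hω : ∀ x ∈ ball (0 : ℂ) r, HasFDerivWithinAt (fun x => innerSL ℝ (Complex.I * Y x))
      ((innerSL ℝ : ℂ →L[ℝ] ℂ →L[ℝ] ℝ).comp (L.comp (D x))) (ball 0 r) x := fun x hx =>
    ((innerSL ℝ : ℂ →L[ℝ] ℂ →L[ℝ] ℝ).hasFDerivAt.comp x
      (L.hasFDerivAt.comp x (hD x (mem_ball_zero_iff.1 hx)))).hasFDerivWithinAt
  have hsym : ∀ a ∈ ball (0 : ℂ) r, ∀ x ∈ tangentConeAt ℝ (ball 0 r) a,
      ∀ y ∈ tangentConeAt ℝ (ball 0 r) a,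
      ((innerSL ℝ : ℂ →L[ℝ] ℂ →L[ℝ] ℝ).comp (L.comp (D a))) x y =
      ((innerSL ℝ : ℂ →L[ℝ] ℂ →L[ℝ] ℝ).comp (L.comp (D a))) y x := by
    intro a ha x _ y _
    have hlin : ∀ x : ℂ, D a x = x.re • D a 1 + x.im • D a Complex.I := fun x => by
      rw [← map_smul, ← map_smul, ← map_add]
      simp [Complex.re_add_im]
    have h := hdiv a (mem_ball_zero_iff.1 ha)
    simp only [ContinuousLinearMap.comp_apply, innerSL_apply_apply, L,
      ContinuousLinearMap.mul_apply', inner_eq]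
    rw [hlin x, hlin y]
    simp
    linear_combination (x.re * y.im - x.im * y.re) * h
  have hw' := mem_ball_zero_iff.2 hw
  have h0 : (0 : ℂ) ∈ ball (0 : ℂ) r := mem_ball_self ((norm_nonneg w).trans_lt hw)
  have := (convex_ball (0 : ℂ) r).hasFDerivWithinAt_curveIntegral_segment_of_hasFDerivWithinAt_symmetric
    hω hsym h0 hw'
  refine (this.hasFDerivAt (isOpen_ball.mem_nhds hw')).congr_of_eventuallyEq
    (Eventually.of_forall fun w => ?_)
  simp only [curveIntegral_segment, AffineMap.lineMap_apply_module']
  simp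

/-- Bump functions at the origin of radius tending to zero. -/
def bump (R : ℝ) (hR : 0 < R) (n : ℕ) : ContDiffBump (0 : ℂ) where
  rIn := R / (n + 4) / 2
  rOut := R / (n + 4)
  rIn_pos := by positivity
  rIn_lt_rOut := half_lt_self (by positivity)

theorem bump_rOut_lt {R : ℝ} (hR : 0 < R) (n : ℕ) : (bump R hR n).rOut < R / 2 := by
  change R / (n + 4) < R / 2
  exact div_lt_div_of_pos_left hR two_pos (by linarith [n.cast_nonneg (α := ℝ)])

theorem tendsto_bump_rOut {R : ℝ} (hR : 0 < R) :
    Tendsto (fun n => (bump R hR n).rOut) atTop (𝓝 0) := by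
  change Tendsto (fun n : ℕ => R / ((n : ℝ) + 4)) atTop (𝓝 0)
  exact tendsto_const_nhds.div_atTop
    (tendsto_atTop_add_const_right _ _ tendsto_natCast_atTop_atTop)

theorem tendstoLocallyUniformlyOn_mollify {X : ℂ → ℂ} {R : ℝ} (hR : 0 < R) {s : Set ℂ}
    (hs : IsOpen s) (hX : ContinuousOn X s) (hm : AEStronglyMeasurable X volume) :
    TendstoLocallyUniformlyOn (fun n => mollify (bump R hR n) X) X atTop s := by
  rw [tendstoLocallyUniformlyOn_iff_forall_isCompact hs]
  intro K hKs hK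
  rw [Metric.tendstoUniformlyOn_iff]
  intro ε hε
  obtain ⟨d, hd, hdK⟩ := hK.exists_cthickening_subset_open hs hKs
  have hu : UniformContinuousOn X (cthickening d K) :=
    hK.cthickening.uniformContinuousOn_of_continuous (hX.mono hdK)
  obtain ⟨e, he, hue⟩ := Metric.uniformContinuousOn_iff.1 hu (ε / 2) (half_pos hε)
  filter_upwards [(tendsto_bump_rOut hR).eventually (gt_mem_nhds (lt_min hd he))] with n hn z hz
  rw [dist_comm]
  refine lt_of_le_of_lt (ContDiffBump.dist_normed_convolution_le (φ := bump R hR n) hm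
    (fun x hx => ?_)) (half_lt_self hε)
  have hxz : dist x z < min d e := (mem_ball.1 hx).trans hn
  exact (hue x (mem_cthickening_of_dist_le x z d K hz (hxz.le.trans (min_le_left _ _))) z
    (self_subset_cthickening K hz) (hxz.trans_le (min_le_right _ _))).le

theorem exists_streamFunction {X : ℂ → ℂ} {R M : ℝ} (hR : 0 < R)
    (hX : ContinuousOn X (ball 0 R \ {0})) (hM : ∀ z, ‖X z‖ ≤ M)
    (h0 : ∀ z, R ≤ ‖z‖ → X z = 0)
    (hdiv : ∀ φ : ℂ → ℝ, ContDiff ℝ (⊤ : ℕ∞) φ → HasCompactSupport φ → tsupport φ ⊆ ball 0 R →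
      ∫ z, fderiv ℝ φ z (X z) = 0) :
    ∃ v : ℂ → ℝ, v 0 = 0 ∧ ContinuousAt v 0 ∧
      ∀ z, z ≠ 0 → ‖z‖ < R / 2 → HasFDerivAt v (innerSL ℝ (Complex.I * X z)) z := by
  have ho : IsOpen (ball (0 : ℂ) R \ {0}) := isOpen_ball.sdiff isClosed_singleton
  have hXm : AEStronglyMeasurable X volume := by
    have h1 : AEStronglyMeasurable (indicator (ball (0 : ℂ) R \ {0}) X) volume :=
      (aestronglyMeasurable_indicator_iff ho.measurableSet).2
        (hX.aestronglyMeasurable ho.measurableSet)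
    refine h1.congr ?_
    have h2 : ∀ᵐ z : ℂ, z ≠ 0 := by simp [ae_iff]
    filter_upwards [h2] with z hz
    by_cases h : ‖z‖ < R
    · exact indicator_of_mem (show z ∈ ball (0 : ℂ) R \ {0} from ⟨mem_ball_zero_iff.2 h, hz⟩) X
    · rw [indicator_of_notMem (fun h' => h (mem_ball_zero_iff.1 h'.1)), h0 z (not_lt.1 h)]
  have hloc : LocallyIntegrable X volume := by
    refine (locallyIntegrable_const M).mono hXm (ae_of_all _ fun z => ?_)
    exact (hM z).trans (le_abs_self M)
  have hsub : ball (0 : ℂ) (R / 2) \ {0} ⊆ ball 0 R \ {0} :=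
    sdiff_subset_sdiff_left (ball_subset_ball (by linarith))
  have hlim := (tendstoLocallyUniformlyOn_mollify hR ho hX hXm).mono hsub
  have hv0 : ∀ w : ℂ, |∫ t in (0 : ℝ)..1, ⟪Complex.I * X (t • w), w⟫| ≤ M * ‖w‖ := fun w => by
    have := intervalIntegral.norm_integral_le_of_norm_le_const (a := 0) (b := 1) (C := M * ‖w‖)
      (f := fun t : ℝ => ⟪Complex.I * X (t • w), w⟫) (fun t _ => ?_)
    · simpa using this
    · refine (norm_inner_le_norm _ _).trans ?_
      rw [norm_mul, Complex.norm_I, one_mul]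
      exact mul_le_mul_of_nonneg_right (hM _) (norm_nonneg _)
  refine ⟨fun w => ∫ t in (0 : ℝ)..1, ⟪Complex.I * X (t • w), w⟫, by simp, ?_, ?_⟩
  · rw [ContinuousAt, tendsto_iff_norm_sub_tendsto_zero]
    refine squeeze_zero (fun _ => norm_nonneg _) (fun w => ?_)
      (g := fun w : ℂ => M * ‖w‖) ?_
    · simpa using hv0 w
    · have : ContinuousAt (fun w : ℂ => M * ‖w‖) 0 := by fun_prop
      simpa [ContinuousAt] using this
  · intro z hz hzR
    choose D hD hDi hDw using fun n => fun x => hasFDerivAt_mollify (bump R hR n) hloc x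
    refine hasFDerivAt_of_tendstoLocallyUniformlyOn (l := atTop)
      (f := fun n w => ∫ t in (0 : ℝ)..1, ⟪Complex.I * mollify (bump R hR n) X (t • w), w⟫)
      (f' := fun n x => innerSL ℝ (Complex.I * mollify (bump R hR n) X x))
      (g' := fun x => innerSL ℝ (Complex.I * X x))
      (isOpen_ball.sdiff isClosed_singleton (s := ball (0 : ℂ) (R / 2)) (t := {0})) ?_ ?_ ?_
      ⟨mem_ball_zero_iff.2 hzR, hz⟩
    · let L : ℂ →L[ℝ] ℂ →L[ℝ] ℝ :=
        (innerSL ℝ : ℂ →L[ℝ] ℂ →L[ℝ] ℝ).comp (ContinuousLinearMap.mul ℝ ℂ Complex.I)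
      exact L.uniformContinuous.comp_tendstoLocallyUniformlyOn hlim
    · intro n x hx
      exact hasFDerivAt_integral_of_div_eq_zero (r := R / 2) (fun y _ => hD n y)
        (fun y hy => div_mollify_eq_zero (bump_rOut_lt hR n) hdiv hy (hDi n y) (hDw n y))
        (mem_ball_zero_iff.1 hx.1)
    · intro w hw
      have hw0 : w ≠ 0 := hw.2
      have hwR : ‖w‖ < R / 2 := mem_ball_zero_iff.1 hw.1
      refine intervalIntegral.tendsto_integral_filter_of_dominated_convergence
        (fun _ => M * ‖w‖) (Eventually.of_forall fun n => ?_)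
        (Eventually.of_forall fun n => ae_of_all _ fun t _ => ?_) intervalIntegrable_const
        (ae_of_all _ fun t ht => ?_)
      · have hc : Continuous (mollify (bump R hR n) X) :=
          continuous_iff_continuousAt.2 fun x => (hD n x).continuousAt
        exact Continuous.aestronglyMeasurable (by fun_prop)
      · refine (norm_inner_le_norm _ _).trans ?_
        rw [norm_mul, Complex.norm_I, one_mul]
        exact mul_le_mul_of_nonneg_right (norm_mollify_le hM _) (norm_nonneg _)
      · rw [uIoc_of_le zero_le_one] at ht
        have h1 : t • w ∈ ball (0 : ℂ) (R / 2) \ {0} := by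
          refine ⟨?_, smul_ne_zero ht.1.ne' hw0⟩
          rw [mem_ball_zero_iff, norm_smul, Real.norm_of_nonneg ht.1.le]
          exact (mul_le_of_le_one_left (norm_nonneg _) ht.2).trans_lt hwR
        have h2 := hlim.tendsto_at h1
        exact (h2.const_mul Complex.I).inner tendsto_const_nhds

theorem norm_flux_le {h : ℝ → ℝ} (hh : ∀ t, 0 ≤ t → 0 ≤ h t) (p : ℂ) : ‖flux h p‖ ≤ h ‖p‖ := by
  rcases eq_or_ne p 0 with rfl | hp
  · simpa [flux] using hh 0 le_rfl
  · exact (norm_flux hp (hh _ (norm_nonneg p))).le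

/-- A function with prescribed derivatives on a disc and Lipschitz there has a globally Lipschitz
modification with the same derivatives. -/
theorem exists_lipschitz_extension {g : ℂ → ℝ} {r C : ℝ} (hC : 0 ≤ C)
    (hg : ∀ z w, ‖z‖ < r → ‖w‖ < r → |g z - g w| ≤ C * ‖z - w‖) :
    ∃ G : ℂ → ℝ, (∃ K, LipschitzWith K G) ∧ ∀ z, ‖z‖ < r → G =ᶠ[𝓝 z] g ∧ G z = g z := by
  have h1 : LipschitzOnWith C.toNNReal g (ball 0 r) := by
    refine LipschitzOnWith.of_dist_le_mul fun z hz w hw => ?_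
    rw [Real.dist_eq, dist_eq_norm, Real.coe_toNNReal _ hC]
    exact hg z w (mem_ball_zero_iff.1 hz) (mem_ball_zero_iff.1 hw)
  obtain ⟨G, hG, hGg⟩ := h1.extend_real
  refine ⟨G, ⟨_, hG⟩, fun z hz => ?_⟩
  have hz' : z ∈ ball (0 : ℂ) r := mem_ball_zero_iff.2 hz
  exact ⟨eventually_of_mem (isOpen_ball.mem_nhds hz') fun w hw => (hGg hw).symm, (hGg hz').symm⟩

/-- A weak solution in a disc of the plane has no isolated critical point at the center. -/
theorem false_of_isolated_critical_point {h : ℝ → ℝ} (h_zero : 0 < h 0)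
    (h_mono : StrictMonoOn h (Ici 0)) (h_cont : ContinuousOn h (Ici 0))
    {U : ℂ → ℝ} {P : ℂ → ℂ} {R : ℝ} (hR : 0 < R)
    (hU : ∀ z, ‖z‖ < R → HasFDerivAt U (innerSL ℝ (P z)) z)
    (hP : ContinuousOn P (ball 0 R)) (hP0 : P 0 = 0)
    (hPne : ∀ z, z ≠ 0 → ‖z‖ < R → P z ≠ 0)
    (hdiv : ∀ φ : ℂ → ℝ, ContDiff ℝ (⊤ : ℕ∞) φ → HasCompactSupport φ → tsupport φ ⊆ ball 0 R →
      ∫ z, fderiv ℝ φ z (flux h (P z)) = 0) : False := by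
  have hnn : ∀ t, 0 ≤ t → 0 ≤ h t := fun t ht =>
    h_zero.le.trans (h_mono.monotoneOn self_mem_Ici ht ht)
  have hsub : closedBall (0 : ℂ) (R / 2) ⊆ ball 0 R := closedBall_subset_ball (by linarith)
  have hPc : ContinuousOn P (closedBall 0 (R / 2)) := hP.mono hsub
  obtain ⟨M, hM⟩ := (isCompact_closedBall (0 : ℂ) (R / 2)).exists_bound_of_continuousOn hPc
  have hM0 : 0 ≤ M := (norm_nonneg _).trans (hM 0 (mem_closedBall_self (by linarith)))
  set X : ℂ → ℂ := fun z => if ‖z‖ < R / 2 then flux h (P z) else 0 with hXdef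
  have hXin : ∀ z, ‖z‖ < R / 2 → X z = flux h (P z) := fun z hz => if_pos hz
  have hXM : ∀ z, ‖X z‖ ≤ h M := fun z => by
    by_cases hz : ‖z‖ < R / 2
    · rw [hXin z hz]
      exact (norm_flux_le hnn _).trans (h_mono.monotoneOn (mem_Ici.2 (norm_nonneg _))
        (mem_Ici.2 hM0) (hM z (mem_closedBall_zero_iff.2 hz.le)))
    · simp only [hXdef, if_neg hz, norm_zero]
      exact hnn M hM0
  have hXc : ContinuousOn X (ball 0 (R / 2) \ {0}) := by
    intro z hz
    have hz1 : ‖z‖ < R / 2 := mem_ball_zero_iff.1 hz.1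
    have hz2 : ‖z‖ < R := by linarith
    have h1 : ContinuousAt (fun z => flux h (P z)) z :=
      (continuousAt_flux h_cont (hPne z hz.2 hz2)).comp
        (hP.continuousAt (isOpen_ball.mem_nhds (mem_ball_zero_iff.2 hz2)))
    refine (h1.congr ?_).continuousWithinAt
    filter_upwards [isOpen_ball.mem_nhds hz.1] with w hw
    exact (hXin w (mem_ball_zero_iff.1 hw)).symm
  obtain ⟨v, hv0, hvc, hvd⟩ := exists_streamFunction (half_pos hR) hXc hXM
    (fun z hz => if_neg (not_lt.2 hz)) fun φ hφ hφc hφs => by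
      rw [← hdiv φ hφ hφc (hφs.trans (ball_subset_ball (by linarith)))]
      refine integral_congr_ae (ae_of_all _ fun z => ?_)
      by_cases hz : ‖z‖ < R / 2
      · simp only [hXin z hz]
      · have : fderiv ℝ φ z = 0 := by
          by_contra hne
          exact hz (mem_ball_zero_iff.1 (hφs (support_fderiv_subset ℝ hne)))
        simp [this]
  set r := R / 2 / 2 with hr
  have hr0 : 0 < r := by positivity
  have hvd' : ∀ z, z ≠ 0 → ‖z‖ < r →
      HasFDerivAt v (innerSL ℝ (Complex.I * flux h (P z))) z := fun z hz hzr => by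
    rw [← hXin z (by linarith)]
    exact hvd z hz hzr
  have hvL : ∀ z w, ‖z‖ < r → ‖w‖ < r → |v z - v w| ≤ h M * ‖z - w‖ := fun z w hz hw =>
    abs_sub_le_of_hasFDerivAt_punctured hvc hvd (fun z _ _ => by
      rw [innerSL_apply_norm, norm_mul, Complex.norm_I, one_mul]
      exact hXM z) hz hw
  have hUL : ∀ z w, ‖z‖ < r → ‖w‖ < r → |(U z - U 0) - (U w - U 0)| ≤ M * ‖z - w‖ :=
    fun z w hz hw => by
      have h0 : ‖(0 : ℂ)‖ < R := by simpa using hR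
      rw [sub_sub_sub_cancel_right]
      refine abs_sub_le_of_hasFDerivAt_punctured (r := r) (hU 0 h0).continuousAt
        (fun z _ hz => hU z (by linarith)) (fun z _ hz => ?_) hz hw
      rw [innerSL_apply_norm]
      exact hM z (mem_closedBall_zero_iff.2 (by linarith))
  obtain ⟨G, hGl, hG⟩ := exists_lipschitz_extension (g := fun z => U z - U 0) hM0 hUL
  obtain ⟨V, hVl, hV⟩ := exists_lipschitz_extension (hnn M hM0) hvL
  have h0 : ‖(0 : ℂ)‖ < r := by simpa using hr0
  have H : ConjPair h r P G V :=
    { pos := hr0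
      h_zero := h_zero
      h_mono := h_mono
      h_cont := h_cont
      lip_u := hGl
      lip_v := hVl
      u_zero := by rw [(hG 0 h0).2, sub_self]
      v_zero := by rw [(hV 0 h0).2, hv0]
      p_zero := hP0
      p_ne := fun z hz hzr => hPne z hz (by linarith)
      p_cont := hP.mono (ball_subset_ball (by linarith))
      deriv_u := fun z hz => ((hU z (by linarith)).sub_const _).congr_of_eventuallyEq (hG z hz).1
      deriv_v := fun z hz hzr => (hvd' z hz hzr).congr_of_eventuallyEq (hV z hzr).1 }
  exact H.absurd

/-- The isometry identifying `ℂ` with the Euclidean plane. -/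
abbrev planeIso : ℂ ≃ₗᵢ[ℝ] EuclideanSpace ℝ (Fin 2) := Complex.orthonormalBasisOneI.repr

theorem integral_planeIso (z₀ : EuclideanSpace ℝ (Fin 2)) (F : EuclideanSpace ℝ (Fin 2) → ℝ) :
    ∫ z : ℂ, F (z₀ + planeIso z) = ∫ x, F x := by
  have h1 : MeasurePreserving planeIso := planeIso.measurePreserving
  rw [h1.integral_comp planeIso.toHomeomorph.measurableEmbedding fun x => F (z₀ + x)]
  exact integral_add_left_eq_self F z₀

theorem inner_gradient_comp_planeIso_symm {φ : ℂ → ℝ} {z₀ x : E2}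
    (hφ : DifferentiableAt ℝ φ (planeIso.symm (x - z₀))) (w : E2) :
    ⟪w, gradient (fun x => φ (planeIso.symm (x - z₀))) x⟫ =
      fderiv ℝ φ (planeIso.symm (x - z₀)) (planeIso.symm w) := by
  have h1 : HasFDerivAt (fun x => planeIso.symm (x - z₀))
      (planeIso.symm.toContinuousLinearEquiv : E2 →L[ℝ] ℂ) x := by
    have := (planeIso.symm.toContinuousLinearEquiv : E2 →L[ℝ] ℂ).hasFDerivAt.comp x
      ((hasFDerivAt_id x).sub_const z₀)
    rwa [ContinuousLinearMap.comp_id] at this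
  have h2 : HasFDerivAt (fun x => φ (planeIso.symm (x - z₀))) _ x := hφ.hasFDerivAt.comp x h1
  rw [real_inner_comm, gradient, InnerProductSpace.toDual_symm_apply, h2.fderiv,
    ContinuousLinearMap.comp_apply]
  rfl

/-- The weak equation in the complex coordinate. -/
theorem integral_fderiv_flux_eq_zero {h : ℝ → ℝ} {Ω : Set E2} {u : E2 → ℝ} (hu : WeakSol h Ω u)
    {z₀ : E2} {R : ℝ} (hb : ball z₀ R ⊆ Ω) {φ : ℂ → ℝ} (hφ : ContDiff ℝ (⊤ : ℕ∞) φ)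
    (hφc : HasCompactSupport φ) (hφs : tsupport φ ⊆ ball 0 R) :
    ∫ z, fderiv ℝ φ z (flux h (planeIso.symm (gradient u (z₀ + planeIso z)))) = 0 := by
  let e : E2 ≃ₜ ℂ := (Homeomorph.subRight z₀).trans planeIso.symm.toHomeomorph
  have he : ∀ x, e x = planeIso.symm (x - z₀) := fun x => rfl
  have hes : ContDiff ℝ (⊤ : ℕ∞) e :=
    planeIso.symm.contDiff.comp (contDiff_id.sub contDiff_const)
  have hts : tsupport (φ ∘ e) ⊆ Ω := by
    rw [tsupport_comp_eq_preimage]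
    refine fun x hx => hb ?_
    have h1 := mem_ball_zero_iff.1 (hφs hx)
    rwa [he, LinearIsometryEquiv.norm_map, ← dist_eq_norm] at h1
  have key := hu (φ ∘ e) (hφ.comp hes) (hφc.comp_homeomorph e) hts
  have hder : ∀ x w, ⟪w, gradient (φ ∘ e) x⟫ = fderiv ℝ φ (e x) (planeIso.symm w) := fun x w =>
    inner_gradient_comp_planeIso_symm (hφ.differentiable (by simp) _) w
  rw [setIntegral_eq_integral_of_forall_compl_eq_zero] at key
  · rw [← key, ← integral_planeIso z₀]
    refine integral_congr_ae (ae_of_all _ fun z => ?_)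
    have hez : e (z₀ + planeIso z) = z := by simp [he]
    simp only [hder, hez]
    split_ifs with h0
    · simp [h0, flux]
    · rw [flux, LinearIsometryEquiv.norm_map, map_smul, map_smul, map_smul, smul_eq_mul, smul_eq_mul,
        mul_assoc]
  · intro x hx
    have : gradient (φ ∘ e) x = 0 := by
      have : fderiv ℝ (φ ∘ e) x = 0 := by
        by_contra hne
        exact hx (hts (support_fderiv_subset ℝ hne))
      simp [gradient, this]
    simp [this]

theorem hasFDerivAt_comp_planeIso {u : E2 → ℝ} {z₀ : E2} {z : ℂ}
    (hu : DifferentiableAt ℝ u (z₀ + planeIso z)) :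
    HasFDerivAt (fun z => u (z₀ + planeIso z))
      (innerSL ℝ (planeIso.symm (gradient u (z₀ + planeIso z)))) z := by
  have h1 : HasFDerivAt (fun z => z₀ + planeIso z)
      (planeIso.toContinuousLinearEquiv : ℂ →L[ℝ] E2) z :=
    planeIso.toContinuousLinearEquiv.hasFDerivAt.const_add z₀
  refine (hu.hasFDerivAt.comp z h1).congr_fderiv (ContinuousLinearMap.ext fun w => ?_)
  rw [innerSL_apply_apply, ← planeIso.inner_map_map, LinearIsometryEquiv.apply_symm_apply,
    gradient, InnerProductSpace.toDual_symm_apply, ContinuousLinearMap.comp_apply]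
  rfl

theorem strictMonoOn_dtop {f : ℝ → ℝ} (hf : StdF f) : StrictMonoOn (dtop f) (Ici 0) :=
  hf.1.strictMonoOn_derivWithin (hf.2.1.differentiableOn one_ne_zero)

theorem continuousOn_dtop {f : ℝ → ℝ} (hf : StdF f) : ContinuousOn (dtop f) (Ici 0) :=
  hf.2.1.continuousOn_derivWithin (uniqueDiffOn_Ici 0) le_rfl

end CriticalPoint

/-- A `C¹` weak solution of `div(f'(‖∇u‖)∇u/‖∇u‖) = 0` in an open
`Ω ⊆ ℝ²` cannot have isolated critical points. -/
theorem weakSolution_hasNoIsolatedCriticalPoint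
    (f : ℝ → ℝ) (hf : StdF f)
    (Ω : Set E2) (hΩo : IsOpen Ω)
    (u : E2 → ℝ) (huC1 : ContDiffOn ℝ 1 u Ω) (hu : WeakSol (dtop f) Ω u) :
    ¬ HasIsolatedCritPt Ω u := by
  rintro ⟨z₀, hz₀, r, hr, hg0, hg⟩
  obtain ⟨r', hr', hrΩ⟩ := Metric.isOpen_iff.1 hΩo z₀ hz₀
  set R := min r r'
  have hR : 0 < R := lt_min hr hr'
  have hb : ball z₀ R ⊆ Ω := (ball_subset_ball (min_le_right _ _)).trans hrΩ
  have hmem : ∀ z : ℂ, ‖z‖ < R → z₀ + CriticalPoint.planeIso z ∈ ball z₀ R := fun z hz => by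
    simpa [dist_eq_norm] using hz
  have hd : ∀ x ∈ Ω, DifferentiableAt ℝ u x := fun x hx =>
    (huC1.differentiableOn one_ne_zero).differentiableAt (hΩo.mem_nhds hx)
  have hgc : ContinuousOn (gradient u) Ω :=
    (InnerProductSpace.toDual ℝ E2).symm.continuous.comp_continuousOn
      (huC1.continuousOn_fderiv_of_isOpen hΩo le_rfl)
  refine CriticalPoint.false_of_isolated_critical_point hf.2.2.2.2
    (CriticalPoint.strictMonoOn_dtop hf) (CriticalPoint.continuousOn_dtop hf) hR
    (fun z hz => CriticalPoint.hasFDerivAt_comp_planeIso (hd _ (hb (hmem z hz)))) ?_ ?_ ?_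
    fun φ hφ hφc hφs => CriticalPoint.integral_fderiv_flux_eq_zero hu hb hφ hφc hφs
  · refine CriticalPoint.planeIso.symm.continuous.comp_continuousOn (hgc.comp ?_ fun z hz =>
      hb (hmem z (mem_ball_zero_iff.1 hz)))
    exact (continuous_const.add CriticalPoint.planeIso.continuous).continuousOn
  · simp [hg0]
  · intro z hz hzR h0
    rw [LinearIsometryEquiv.map_eq_zero_iff] at h0
    refine hg _ (hb (hmem z hzR)) ?_ ((mem_ball.1 (hmem z hzR)).trans_le (min_le_left _ _)) h0
    simpa using hz
end
end

section
/- Let Ω ⊂ ℝ² be open and let u, v : Ω → ℝ be continuously differentiable functions such that at every z ∈ Ω with ∇u(z) ≠ 0 one has ∂ₓv(z) = −f'(‖∇u(z)‖)·∂ᵧu(z)/‖∇u(z)‖ and ∂ᵧv(z) = f'(‖∇u(z)‖)·∂ₓu(z)/‖∇u(z)‖. Then u cannot have isolated critical points: there exist no z₀ ∈ Ω and r > 0 with ∇u(z₀) = 0 and ∇u(z) ≠ 0 for all z with 0 < ‖z − z₀‖ < r. -/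
open Set MeasureTheory Metric Filter
open scoped RealInnerProductSpace Topology Classical

noncomputable section

section NullLagrangian

variable {E : Type*} [NormedAddCommGroup E] [NormedSpace ℝ E] [FiniteDimensional ℝ E]
  [MeasurableSpace E] [BorelSpace E]

/-- The `2 × 2` minors of the Jacobian matrix of a `C¹` pair are null Lagrangians. -/
theorem integral_fderiv_mul_fderiv_comm (μ : Measure E) [μ.IsAddHaarMeasure] {φ w : E → ℝ}
    (hφ : ContDiff ℝ 1 φ) (hφc : HasCompactSupport φ)
    (hw : ContDiff ℝ 1 w) (hwc : HasCompactSupport w) (a b : E) :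
    ∫ x, fderiv ℝ φ x a * fderiv ℝ w x b ∂μ = ∫ x, fderiv ℝ φ x b * fderiv ℝ w x a ∂μ := by
  have lip : ∀ g : E → ℝ, ContDiff ℝ 1 g → HasCompactSupport g → ∃ C, LipschitzWith C g :=
    fun g hg hgc => hg.lipschitzWith_of_hasCompactSupport hgc one_ne_zero
  have line : ∀ g : E → ℝ, ContDiff ℝ 1 g → ∀ x c, lineDeriv ℝ g x c = fderiv ℝ g x c :=
    fun g hg x c => ((hg.differentiable one_ne_zero) x).lineDeriv_eq_fderiv
  have int : ∀ g : E → ℝ, ContDiff ℝ 1 g → HasCompactSupport g → ∀ c,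
      Integrable (fun x => fderiv ℝ g x c) μ := fun g hg hgc c =>
    ((hg.continuous_fderiv one_ne_zero).clm_apply continuous_const).integrable_of_hasCompactSupport
      (hgc.fderiv_apply ℝ c)
  obtain ⟨C, hC⟩ := lip w hw hwc
  obtain ⟨D, hD⟩ := lip φ hφ hφc
  have key : ∀ t : ℝ, ∫ x, (t⁻¹ • (w (x + t • b) - w x)) * fderiv ℝ φ x a ∂μ =
      - ∫ x, (t⁻¹ • (φ (x + t • (-b)) - φ x)) * fderiv ℝ w x a ∂μ := by
    intro t
    let w₁ : E → ℝ := fun x => w (x + t • b)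
    have hw₁ : ContDiff ℝ 1 w₁ := by fun_prop
    have hw₁c : HasCompactSupport w₁ := hwc.comp_homeomorph (Homeomorph.addRight (t • b))
    have ibp : ∀ g : E → ℝ, ContDiff ℝ 1 g → HasCompactSupport g →
        ∫ x, g x * fderiv ℝ φ x a ∂μ = - ∫ x, fderiv ℝ g x a * φ x ∂μ := by
      intro g hg hgc
      obtain ⟨G, hG⟩ := lip g hg hgc
      have h := LipschitzWith.integral_lineDeriv_mul_eq (μ := μ) hG hD hφc a
      simp only [line g hg, line φ hφ, map_neg, neg_mul, integral_neg] at h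
      rw [h, neg_neg]
      exact integral_congr_ae (Eventually.of_forall fun x => mul_comm _ _)
    have h₁ : ∀ g : E → ℝ, ContDiff ℝ 1 g → Integrable (fun x => g x * fderiv ℝ φ x a) μ :=
      fun g hg => (hg.continuous.mul ((hφ.continuous_fderiv one_ne_zero).clm_apply
        continuous_const)).integrable_of_hasCompactSupport (hφc.fderiv_apply ℝ a).mul_left
    have h₂ : ∀ g h : E → ℝ, ContDiff ℝ 1 g → ContDiff ℝ 1 h → HasCompactSupport h →
        Integrable (fun x => fderiv ℝ g x a * h x) μ :=
      fun g h hg hh hhc => (((hg.continuous_fderiv one_ne_zero).clm_apply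
        continuous_const).mul hh.continuous).integrable_of_hasCompactSupport hhc.mul_left
    have hshift : ∫ x, fderiv ℝ w₁ x a * φ x ∂μ = ∫ x, fderiv ℝ w x a * φ (x + t • (-b)) ∂μ := by
      rw [← integral_add_right_eq_self (fun x => fderiv ℝ w x a * φ (x + t • (-b))) (t • b)]
      refine integral_congr_ae (Eventually.of_forall fun x => ?_)
      simp [w₁, fderiv_comp_add_right]
    have hφ₁ : ContDiff ℝ 1 (fun x => φ (x + t • (-b))) := by fun_prop
    have hφ₁c : HasCompactSupport (fun x => φ (x + t • (-b))) :=
      hφc.comp_homeomorph (Homeomorph.addRight (t • (-b)))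
    calc ∫ x, (t⁻¹ • (w (x + t • b) - w x)) * fderiv ℝ φ x a ∂μ
        = t⁻¹ * (∫ x, w₁ x * fderiv ℝ φ x a ∂μ - ∫ x, w x * fderiv ℝ φ x a ∂μ) := by
          rw [← integral_sub (h₁ _ hw₁) (h₁ _ hw), ← integral_const_mul]
          refine integral_congr_ae (Eventually.of_forall fun x => ?_)
          simp only [smul_eq_mul, w₁]; ring
      _ = - (t⁻¹ * (∫ x, fderiv ℝ w x a * φ (x + t • (-b)) ∂μ
            - ∫ x, fderiv ℝ w x a * φ x ∂μ)) := by
          rw [ibp _ hw₁ hw₁c, ibp _ hw hwc, hshift]; ring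
      _ = - ∫ x, (t⁻¹ • (φ (x + t • (-b)) - φ x)) * fderiv ℝ w x a ∂μ := by
          rw [← integral_sub (h₂ _ _ hw hφ₁ hφ₁c) (h₂ _ _ hw hφ hφc), ← integral_const_mul]
          congr 1
          refine integral_congr_ae (Eventually.of_forall fun x => ?_)
          simp only [smul_eq_mul]; ring
  have lim₁ := hC.integral_inv_smul_sub_mul_tendsto_integral_lineDeriv_mul (int φ hφ hφc a) b
  have lim₂ := (hD.integral_inv_smul_sub_mul_tendsto_integral_lineDeriv_mul
    (int w hw hwc a) (-b)).neg
  simp only [← key] at lim₂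
  have h := tendsto_nhds_unique lim₁ lim₂
  simp only [line w hw, line φ hφ, map_neg, neg_mul, integral_neg, neg_neg] at h
  rw [← h]
  exact integral_congr_ae (Eventually.of_forall fun x => mul_comm _ _)

/-- There is a `C¹` function vanishing on `(-∞, 0]` whose derivative is `max s 0`. -/
theorem exists_contDiff_hasDerivAt_max_zero :
    ∃ g : ℝ → ℝ, ContDiff ℝ 1 g ∧ (∀ s, HasDerivAt g (max s 0) s) ∧ ∀ s ≤ 0, g s = 0 := by
  have hc : Continuous fun s : ℝ => max s 0 := by fun_prop
  have hd : ∀ s : ℝ, HasDerivAt (fun s : ℝ => ∫ τ in (0 : ℝ)..s, max τ 0) (max s 0) s :=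
    fun s => (hc.integral_hasStrictDerivAt 0 s).hasDerivAt
  refine ⟨fun s => ∫ τ in (0 : ℝ)..s, max τ 0, ?_, hd, fun s hs => ?_⟩
  · rw [contDiff_one_iff_deriv]
    refine ⟨fun s => (hd s).differentiableAt, ?_⟩
    rwa [funext fun s => (hd s).deriv]
  · refine intervalIntegral.integral_zero_ae (Eventually.of_forall fun τ hτ => ?_)
    rw [uIoc_of_ge hs] at hτ
    exact max_eq_right hτ.2

/-- Comparison principle: if the minor `∂ₐU ∂_bV - ∂_bU ∂ₐV` is nonnegative on a ball and `U > c`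
on the bounding sphere, then the minor vanishes wherever `U < c` in the ball. -/
theorem jacobian_nonpos_of_lt (a b : E) {U V : E → ℝ}
    (hU : ContDiff ℝ 1 U) (hV : ContDiff ℝ 1 V) (hVc : HasCompactSupport V)
    {z₀ z₁ : E} {r c : ℝ} (hz₁ : z₁ ∈ ball z₀ r) (hsph : ∀ z ∈ sphere z₀ r, c < U z)
    (hJ : ∀ z ∈ ball z₀ r,
      0 ≤ fderiv ℝ U z a * fderiv ℝ V z b - fderiv ℝ U z b * fderiv ℝ V z a)
    (hc : U z₁ < c) :
    fderiv ℝ U z₁ a * fderiv ℝ V z₁ b - fderiv ℝ U z₁ b * fderiv ℝ V z₁ a ≤ 0 := by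
  obtain ⟨g, hg, hgd, hg0⟩ := exists_contDiff_hasDerivAt_max_zero
  let φ : E → ℝ := fun z => g (c - U z)
  let χ : E → ℝ := (closedBall z₀ r).indicator φ
  have hφ : ContDiff ℝ 1 φ := hg.comp (contDiff_const.sub hU)
  have hin : ∀ z ∈ ball z₀ r, χ =ᶠ[𝓝 z] φ := fun z hz => by
    filter_upwards [isOpen_ball.mem_nhds hz] with y hy
    exact indicator_of_mem (ball_subset_closedBall hy) _
  have hout : ∀ z ∉ ball z₀ r, χ =ᶠ[𝓝 z] 0 := fun z hz => by
    by_cases hs : z ∈ sphere z₀ r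
    · filter_upwards [hU.continuous.continuousAt.eventually (lt_mem_nhds (hsph z hs))] with y hy
      exact indicator_apply_eq_zero.2 fun _ => hg0 _ (by linarith)
    · have : z ∈ (closedBall z₀ r)ᶜ := by
        rw [← ball_union_sphere]; exact fun h => h.elim hz hs
      filter_upwards [isClosed_closedBall.isOpen_compl.mem_nhds this] with y hy
      exact indicator_of_notMem hy _
  have hχ : ContDiff ℝ 1 χ := contDiff_iff_contDiffAt.2 fun z => by
    by_cases hz : z ∈ ball z₀ r
    · exact hφ.contDiffAt.congr_of_eventuallyEq (hin z hz)
    · exact contDiffAt_const.congr_of_eventuallyEq (hout z hz)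
  have hχc : HasCompactSupport χ :=
    HasCompactSupport.intro (isCompact_closedBall z₀ r) fun z hz => indicator_of_notMem hz _
  have hdin : ∀ z ∈ ball z₀ r, fderiv ℝ χ z = -(max (c - U z) 0 • fderiv ℝ U z) := fun z hz => by
    rw [(hin z hz).fderiv_eq]
    have h := (hgd (c - U z)).comp_hasFDerivAt z
      (((hU.differentiable one_ne_zero) z).hasFDerivAt.const_sub c)
    simpa using (show HasFDerivAt φ _ z from h).fderiv
  have hdout : ∀ z ∉ ball z₀ r, fderiv ℝ χ z = 0 := fun z hz => by
    rw [(hout z hz).fderiv_eq]; simp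
  let P : E → ℝ := fun z => fderiv ℝ χ z b * fderiv ℝ V z a - fderiv ℝ χ z a * fderiv ℝ V z b
  have cont : ∀ g : E → ℝ, ContDiff ℝ 1 g → ∀ d, Continuous fun z => fderiv ℝ g z d :=
    fun g hg d => (hg.continuous_fderiv one_ne_zero).clm_apply continuous_const
  have hc₁ : ∀ d e, Continuous fun z => fderiv ℝ χ z d * fderiv ℝ V z e :=
    fun d e => (cont χ hχ d).mul (cont V hV e)
  have hs₁ : ∀ d e, HasCompactSupport fun z => fderiv ℝ χ z d * fderiv ℝ V z e :=
    fun d e => (hχc.fderiv_apply ℝ d).mul_right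
  have hPeq : ∀ z ∈ ball z₀ r, P z = max (c - U z) 0 *
      (fderiv ℝ U z a * fderiv ℝ V z b - fderiv ℝ U z b * fderiv ℝ V z a) := fun z hz => by
    simp only [P, hdin z hz, neg_apply, smul_apply,
      smul_eq_mul]
    ring
  have hP0 : 0 ≤ P := fun z => by
    by_cases hz : z ∈ ball z₀ r
    · rw [hPeq z hz]; exact mul_nonneg (le_max_right _ _) (hJ z hz)
    · simp [P, hdout z hz]
  have hint : ∫ z, P z ∂Measure.addHaar = 0 := by
    rw [integral_sub ((hc₁ b a).integrable_of_hasCompactSupport (hs₁ b a))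
      ((hc₁ a b).integrable_of_hasCompactSupport (hs₁ a b)),
      integral_fderiv_mul_fderiv_comm _ hχ hχc hV hVc, sub_self]
  by_contra! hpos
  have hPz : P z₁ ≠ 0 := by
    rw [hPeq z₁ hz₁]
    exact (mul_pos (lt_max_of_lt_left (sub_pos.2 hc)) hpos).ne'
  exact (((hc₁ b a).sub (hc₁ a b)).integral_pos_of_hasCompactSupport_nonneg_nonzero
    (μ := Measure.addHaar) ((hs₁ b a).sub (hs₁ a b)) hP0 hPz).ne' hint

end NullLagrangian

theorem gradient_apply (w : E2 → ℝ) (z : E2) (i : Fin 2) :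
    gradient w z i = fderiv ℝ w z (EuclideanSpace.single i 1) := by
  rw [← inner_gradient_left, EuclideanSpace.inner_single_right]
  simp

theorem ContDiff.continuous_gradient {w : E2 → ℝ} (hw : ContDiff ℝ 1 w) :
    Continuous (gradient w) :=
  (InnerProductSpace.toDual ℝ E2).symm.continuous.comp (hw.continuous_fderiv one_ne_zero)

/-- The pointwise relation between `p = ∇u` and `q = ∇v`: there is a unit vector `(α, β)` with
`p = ‖p‖ (α, β)` and `q = F ‖p‖ (-β, α)`. -/
def IsConjugate (F : ℝ → ℝ) (p q : E2) : Prop :=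
  ∃ α β : ℝ, α ^ 2 + β ^ 2 = 1 ∧ p 0 = ‖p‖ * α ∧ p 1 = ‖p‖ * β ∧
    q 0 = -(F ‖p‖ * β) ∧ q 1 = F ‖p‖ * α

theorem E2.norm_sq (p : E2) : ‖p‖ ^ 2 = p 0 ^ 2 + p 1 ^ 2 := by
  rw [EuclideanSpace.real_norm_sq_eq, Fin.sum_univ_two]

/-- Away from critical points, `IsConjugate` is the Cauchy–Riemann-type system. -/
theorem isConjugate_of_ne_zero {F : ℝ → ℝ} {p q : E2} (hp : p ≠ 0)
    (h₀ : q 0 = -(F ‖p‖ * p 1 / ‖p‖)) (h₁ : q 1 = F ‖p‖ * p 0 / ‖p‖) : IsConjugate F p q := by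
  have hn : ‖p‖ ≠ 0 := norm_ne_zero_iff.2 hp
  refine ⟨p 0 / ‖p‖, p 1 / ‖p‖, ?_, ?_, ?_, ?_, ?_⟩
  · rw [div_pow, div_pow, ← add_div, ← E2.norm_sq, div_self (pow_ne_zero 2 hn)]
  · field_simp
  · field_simp
  · rw [h₀, mul_div_assoc]
  · rw [h₁, mul_div_assoc]

theorem isConjugate_zero {F : ℝ → ℝ} {q : E2} (hF : F 0 ≠ 0) (hq : q 0 ^ 2 + q 1 ^ 2 = F 0 ^ 2) :
    IsConjugate F 0 q := by
  refine ⟨q 1 / F 0, -(q 0 / F 0), ?_, ?_, ?_, ?_, ?_⟩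
  · rw [neg_sq, div_pow, div_pow, ← add_div, add_comm, hq, div_self (pow_ne_zero 2 hF)]
  · simp
  · simp
  · rw [norm_zero]; field_simp
  · rw [norm_zero]; field_simp

theorem IsConjugate.sq_add_sq {F : ℝ → ℝ} {p q : E2} (h : IsConjugate F p q) :
    q 0 ^ 2 + q 1 ^ 2 = F ‖p‖ ^ 2 := by
  obtain ⟨α, β, h₁, -, -, h₀, h₂⟩ := h
  rw [h₀, h₂]
  linear_combination F ‖p‖ ^ 2 * h₁

/-- Monotonicity of the rotated flux. -/
theorem IsConjugate.mul_sub_le {F : ℝ → ℝ} (hF : ∀ s, 0 ≤ s → 0 ≤ F s) {p q p' q' : E2}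
    (h : IsConjugate F p q) (h' : IsConjugate F p' q') :
    (‖p'‖ - ‖p‖) * (F ‖p'‖ - F ‖p‖) ≤
      (p' 0 - p 0) * (q' 1 - q 1) - (p' 1 - p 1) * (q' 0 - q 0) := by
  obtain ⟨α, β, h₁, h₂, h₃, h₄, h₅⟩ := h
  obtain ⟨α', β', h₁', h₂', h₃', h₄', h₅'⟩ := h'
  rw [h₂, h₃, h₄, h₅, h₂', h₃', h₄', h₅']
  have hcos : α * α' + β * β' ≤ 1 := by nlinarith [sq_nonneg (α - α'), sq_nonneg (β - β')]
  have hn := norm_nonneg p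
  have hn' := norm_nonneg p'
  have := mul_nonneg (add_nonneg (mul_nonneg hn' (hF _ hn)) (mul_nonneg hn (hF _ hn')))
    (sub_nonneg.2 hcos)
  generalize ‖p‖ = ρ at *
  generalize ‖p'‖ = ρ' at *
  have e : (ρ' * α' - ρ * α) * (F ρ' * α' - F ρ * α)
      - (ρ' * β' - ρ * β) * (-(F ρ' * β') - -(F ρ * β)) =
      (ρ' - ρ) * (F ρ' - F ρ) + (ρ' * F ρ + ρ * F ρ') * (1 - (α * α' + β * β')) := by
    linear_combination (ρ * F ρ) * h₁ + (ρ' * F ρ') * h₁'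
  linarith

theorem isConjugate_of_isolated {F : ℝ → ℝ} (hFc : ContinuousOn F (Ici 0)) (hF0 : F 0 ≠ 0)
    {u v : E2 → ℝ} (hu : ContDiff ℝ 1 u) (hv : ContDiff ℝ 1 v) {z₀ : E2} (h₀ : gradient u z₀ = 0)
    (h : ∀ᶠ z in 𝓝[≠] z₀, IsConjugate F (gradient u z) (gradient v z)) :
    IsConjugate F (gradient u z₀) (gradient v z₀) := by
  rw [h₀]
  refine isConjugate_zero hF0 ?_
  have hgv := hv.continuous_gradient
  have l₁ : Tendsto (fun z => gradient v z 0 ^ 2 + gradient v z 1 ^ 2) (𝓝[≠] z₀)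
      (𝓝 (gradient v z₀ 0 ^ 2 + gradient v z₀ 1 ^ 2)) := by
    refine Tendsto.mono_left (Continuous.tendsto ?_ z₀) nhdsWithin_le_nhds
    fun_prop
  have l₂ : Tendsto (fun z => F ‖gradient u z‖ ^ 2) (𝓝[≠] z₀) (𝓝 (F 0 ^ 2)) := by
    refine Tendsto.mono_left (Tendsto.pow ?_ 2) nhdsWithin_le_nhds
    have hn : Continuous fun z => ‖gradient u z‖ := hu.continuous_gradient.norm
    refine (hFc 0 self_mem_Ici).tendsto.comp
      (tendsto_nhdsWithin_iff.2 ⟨?_, Eventually.of_forall fun z => norm_nonneg _⟩)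
    simpa [h₀] using hn.tendsto z₀
  exact tendsto_nhds_unique l₁ (l₂.congr' (h.mono fun z hz => hz.sq_add_sq.symm))

theorem not_isConjugate_of_isolated {F : ℝ → ℝ} (hF : StrictMonoOn F (Ici 0)) (hF0 : 0 < F 0)
    {u v : E2 → ℝ} (hu : ContDiff ℝ 1 u) (hv : ContDiff ℝ 1 v) (hvc : HasCompactSupport v)
    {z₀ : E2} {R : ℝ} (hR : 0 < R) (h₀ : gradient u z₀ = 0)
    (hne : ∀ z ∈ ball z₀ R, z ≠ z₀ → gradient u z ≠ 0) :
    ¬ ∀ z ∈ ball z₀ R, IsConjugate F (gradient u z) (gradient v z) := by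
  intro hconj
  have hpos : ∀ s, 0 ≤ s → 0 < F s := fun s hs =>
    hF0.trans_le (hF.monotoneOn self_mem_Ici hs hs)
  obtain ⟨α₀, β₀, h₁, -, -, hv₀, hv₁⟩ := hconj z₀ (mem_ball_self hR)
  rw [h₀, norm_zero] at hv₀ hv₁
  let n : E2 := EuclideanSpace.single 0 α₀ + EuclideanSpace.single 1 β₀
  have hn : ‖n‖ = 1 := by
    rw [← sq_eq_sq₀ (norm_nonneg _) zero_le_one, E2.norm_sq]
    simpa [n] using h₁
  have hdn : ∀ z, fderiv ℝ u z n = α₀ * gradient u z 0 + β₀ * gradient u z 1 := fun z => by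
    rw [← inner_gradient_left, inner_add_right, EuclideanSpace.inner_single_right,
      EuclideanSpace.inner_single_right]
    simp
  have hgv := hv.continuous_gradient
  have hq : ∀ᶠ z in 𝓝 z₀, 0 < α₀ * gradient v z 1 - β₀ * gradient v z 0 := by
    have hc : Continuous fun z => α₀ * gradient v z 1 - β₀ * gradient v z 0 := by fun_prop
    refine hc.continuousAt.eventually (lt_mem_nhds ?_)
    simp only [hv₀, hv₁]
    nlinarith
  obtain ⟨δ₀, hδ₀, hδq⟩ := Metric.eventually_nhds_iff_ball.1 hq
  obtain ⟨δ, hδ, hδ₀', hδR⟩ : ∃ δ, 0 < δ ∧ δ ≤ δ₀ ∧ δ ≤ R :=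
    ⟨min δ₀ R, lt_min hδ₀ hR, min_le_left _ _, min_le_right _ _⟩
  have hmono : ∀ z ∈ ball z₀ δ, z ≠ z₀ → 0 < fderiv ℝ u z n := by
    intro z hz hzne
    have hq := hδq z (ball_subset_ball hδ₀' hz)
    obtain ⟨α, β, -, h₂, h₃, h₄, h₅⟩ := hconj z (ball_subset_ball hδR hz)
    have hρ := norm_pos_iff.2 (hne z (ball_subset_ball hδR hz) hzne)
    rw [hdn, h₂, h₃]
    rw [h₄, h₅] at hq
    have : 0 < F ‖gradient u z‖ * (α₀ * α + β₀ * β) := by linarith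
    have := mul_pos hρ (pos_of_mul_pos_right this (hpos _ hρ.le).le)
    linarith
  have hA : IsCompact (closedBall z₀ (3 * δ / 4) \ ball z₀ (δ / 4)) :=
    (isCompact_closedBall _ _).diff isOpen_ball
  obtain ⟨m, hm, hmA⟩ := hA.exists_forall_le' (f := fun z => fderiv ℝ u z n) (a := 0)
    ((hu.continuous_fderiv one_ne_zero).clm_apply continuous_const).continuousOn (by
      rintro z ⟨hz, hz'⟩
      refine hmono z (closedBall_subset_ball (by linarith) hz) ?_
      rintro rfl
      exact hz' (mem_ball_self (by linarith)))
  have hline : ∀ z s, HasDerivAt (fun s : ℝ => u (z + s • n)) (fderiv ℝ u (z + s • n) n) s := by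
    intro z s
    have h := ((hu.differentiable one_ne_zero) (z + s • n)).hasFDerivAt.comp_hasDerivAt s
      (((hasDerivAt_id s).smul_const n).const_add z)
    rw [one_smul] at h
    exact h
  have hslope : ∀ᶠ t in 𝓝[>] (0 : ℝ), t⁻¹ • (u (z₀ + t • n) - u z₀) < m / 2 := by
    have h := (hline z₀ 0).tendsto_slope_zero_right
    simp only [zero_add, zero_smul, add_zero, hdn, h₀] at h
    refine h.eventually (gt_mem_nhds ?_)
    simpa using half_pos hm
  obtain ⟨t, ht, ht₀, htδ⟩ :=
    (hslope.and (Ioo_mem_nhdsGT (show (0 : ℝ) < δ / 4 by linarith))).exists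
  have hshift : ∀ z s, 0 ≤ s → dist (z + s • n) z = s := fun z s hs => by
    rw [dist_eq_norm, add_sub_cancel_left, norm_smul, hn, mul_one, Real.norm_of_nonneg hs]
  let U : E2 → ℝ := fun z => u (z + t • n) - u z
  let V : E2 → ℝ := fun z => v (z + t • n) - v z
  have hU : ContDiff ℝ 1 U := by fun_prop
  have hV : ContDiff ℝ 1 V := by fun_prop
  have hVc : HasCompactSupport V :=
    (hvc.comp_homeomorph (Homeomorph.addRight (t • n))).sub hvc
  have hdiff : ∀ w : E2 → ℝ, ContDiff ℝ 1 w → ∀ z i,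
      fderiv ℝ (fun z => w (z + t • n) - w z) z (EuclideanSpace.single i 1) =
        gradient w (z + t • n) i - gradient w z i := fun w hw z i => by
    have hd := hw.differentiable one_ne_zero
    rw [fderiv_fun_sub (by fun_prop) (hd z), fderiv_comp_add_right, gradient_apply, gradient_apply]
    rfl
  have hball : ∀ z ∈ ball z₀ (δ / 2), z ∈ ball z₀ R ∧ z + t • n ∈ ball z₀ R := fun z hz => by
    have h₁ := hshift z t ht₀.le
    have h₂ := dist_triangle (z + t • n) z z₀
    rw [mem_ball] at hz
    constructor <;> rw [mem_ball] <;> linarith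
  have hJ : ∀ z ∈ ball z₀ (δ / 2),
      (‖gradient u (z + t • n)‖ - ‖gradient u z‖)
        * (F ‖gradient u (z + t • n)‖ - F ‖gradient u z‖) ≤
      fderiv ℝ U z (EuclideanSpace.single 0 1) * fderiv ℝ V z (EuclideanSpace.single 1 1)
      - fderiv ℝ U z (EuclideanSpace.single 1 1) * fderiv ℝ V z (EuclideanSpace.single 0 1) := by
    intro z hz
    simp only [U, V, hdiff u hu, hdiff v hv]
    exact (hconj z (hball z hz).1).mul_sub_le (fun s hs => (hpos s hs).le)
      (hconj _ (hball z hz).2)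
  have hz₀ : z₀ ∈ ball z₀ (δ / 2) := mem_ball_self (by linarith)
  refine (jacobian_nonpos_of_lt (EuclideanSpace.single 0 1) (EuclideanSpace.single 1 1) hU hV hVc
    (c := t * (m / 2)) hz₀ (fun z hz => ?_) (fun z hz => ?_) ?_).not_gt ?_
  · obtain ⟨s, hs, hs'⟩ := exists_hasDerivAt_eq_slope (fun s : ℝ => u (z + s • n)) _ ht₀
      (fun s _ => (hline z s).continuousAt.continuousWithinAt) (fun s _ => hline z s)
    have hms : m ≤ fderiv ℝ u (z + s • n) n := by
      have h₁ := hshift z s hs.1.le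
      have h₂ := dist_triangle (z + s • n) z z₀
      have h₃ := dist_triangle_left z z₀ (z + s • n)
      rw [mem_sphere] at hz
      refine hmA _ ⟨?_, ?_⟩
      · rw [mem_closedBall]; linarith [hs.2]
      · rw [mem_ball, not_lt]; linarith [hs.2]
    rw [hs', sub_zero, le_div_iff₀ ht₀, zero_smul, add_zero] at hms
    have := mul_pos hm ht₀
    simp only [U]
    linarith
  · refine le_trans ?_ (hJ z hz)
    rcases le_total ‖gradient u z‖ ‖gradient u (z + t • n)‖ with hle | hle
    · exact mul_nonneg (sub_nonneg.2 hle)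
        (sub_nonneg.2 (hF.monotoneOn (norm_nonneg _) (norm_nonneg _) hle))
    · exact mul_nonneg_of_nonpos_of_nonpos (sub_nonpos.2 hle)
        (sub_nonpos.2 (hF.monotoneOn (norm_nonneg _) (norm_nonneg _) hle))
  · rw [smul_eq_mul, inv_mul_lt_iff₀ ht₀] at ht
    exact ht
  · refine lt_of_lt_of_le ?_ (hJ z₀ hz₀)
    have hne' : z₀ + t • n ≠ z₀ := fun h => by
      have := hshift z₀ t ht₀.le
      rw [h, dist_self] at this
      exact ht₀.ne this
    have hρ := norm_pos_iff.2 (hne _ (hball z₀ hz₀).2 hne')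
    rw [h₀, norm_zero, sub_zero]
    exact mul_pos hρ (sub_pos.2 (hF self_mem_Ici hρ.le hρ))

/-- A `C¹` function on a neighbourhood of `z₀` agrees near `z₀` with a compactly supported
`C¹` function. -/
theorem ContDiffOn.exists_contDiff_hasCompactSupport {w : E2 → ℝ} {Ω : Set E2} (hΩ : IsOpen Ω)
    (hw : ContDiffOn ℝ 1 w Ω) {z₀ : E2} (hz₀ : z₀ ∈ Ω) :
    ∃ w' : E2 → ℝ, ContDiff ℝ 1 w' ∧ HasCompactSupport w' ∧ w' =ᶠ[𝓝 z₀] w := by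
  obtain ⟨ε, hε, hsub⟩ := Metric.isOpen_iff.1 hΩ z₀ hz₀
  let η : ContDiffBump z₀ := ⟨ε / 3, ε / 2, by linarith, by linarith⟩
  refine ⟨fun z => η z * w z, contDiff_iff_contDiffAt.2 fun z => ?_,
    η.hasCompactSupport.mul_right, ?_⟩
  · by_cases hz : z ∈ tsupport η
    · refine η.contDiffAt.mul (hw.contDiffAt (hΩ.mem_nhds (hsub ?_)))
      rw [η.tsupport_eq] at hz
      exact closedBall_subset_ball (show ε / 2 < ε by linarith) hz
    · refine contDiffAt_const (c := (0 : ℝ)) |>.congr_of_eventuallyEq ?_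
      filter_upwards [notMem_tsupport_iff_eventuallyEq.1 hz] with y hy
      simp [hy]
  · filter_upwards [η.eventuallyEq_one] with y hy
    simp [hy]

/-- If the `C¹` pair `(u,v)` satisfies the Cauchy–Riemann-type system
`∂ₓv = −f'(‖∇u‖)∂ᵧu/‖∇u‖`, `∂ᵧv = f'(‖∇u‖)∂ₓu/‖∇u‖` at every non-critical point of `u`
in `Ω`, then `u` cannot have isolated critical points. -/
theorem pair_hasNoIsolatedCriticalPoint
    (f : ℝ → ℝ) (hf : StdF f)
    (Ω : Set E2) (hΩo : IsOpen Ω)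
    (u v : E2 → ℝ) (huC1 : ContDiffOn ℝ 1 u Ω) (hvC1 : ContDiffOn ℝ 1 v Ω)
    (hsys : ∀ z ∈ Ω, gradient u z ≠ 0 →
      gradient v z 0 = -(dtop f ‖gradient u z‖ * gradient u z 1 / ‖gradient u z‖) ∧
      gradient v z 1 = dtop f ‖gradient u z‖ * gradient u z 0 / ‖gradient u z‖) :
    ¬ HasIsolatedCritPt Ω u := by
  rintro ⟨z₀, hz₀, r, hr, h₀, hne⟩
  obtain ⟨hconv, hC1, -, -, hf0⟩ := hf
  have hF : StrictMonoOn (dtop f) (Ici 0) :=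
    hconv.strictMonoOn_derivWithin (hC1.differentiableOn one_ne_zero)
  have hFc : ContinuousOn (dtop f) (Ici 0) :=
    hC1.continuousOn_derivWithin (uniqueDiffOn_Ici 0) le_rfl
  obtain ⟨u', hu', -, huu'⟩ := huC1.exists_contDiff_hasCompactSupport hΩo hz₀
  obtain ⟨v', hv', hvc', hvv'⟩ := hvC1.exists_contDiff_hasCompactSupport hΩo hz₀
  have hgrad : ∀ᶠ z in 𝓝 z₀, z ∈ Ω ∧ dist z z₀ < r ∧
      gradient u' z = gradient u z ∧ gradient v' z = gradient v z := by
    filter_upwards [hΩo.mem_nhds hz₀, ball_mem_nhds z₀ hr, huu'.eventuallyEq_nhds,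
      hvv'.eventuallyEq_nhds] with z h₁ h₂ h₃ h₄
    exact ⟨h₁, h₂, h₃.gradient_eq, h₄.gradient_eq⟩
  obtain ⟨R, hR, hball⟩ := Metric.eventually_nhds_iff_ball.1 hgrad
  have h₀' : gradient u' z₀ = 0 := (hball z₀ (mem_ball_self hR)).2.2.1.trans h₀
  have hne' : ∀ z ∈ ball z₀ R, z ≠ z₀ → gradient u' z ≠ 0 := fun z hz hzne => by
    obtain ⟨h₁, h₂, h₃, -⟩ := hball z hz
    rw [h₃]
    exact hne z h₁ hzne h₂
  have hconj : ∀ z ∈ ball z₀ R, z ≠ z₀ → IsConjugate (dtop f) (gradient u' z) (gradient v' z) := by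
    intro z hz hzne
    obtain ⟨h₁, h₂, h₃, h₄⟩ := hball z hz
    have hg := hne z h₁ hzne h₂
    rw [h₃, h₄]
    exact isConjugate_of_ne_zero hg (hsys z h₁ hg).1 (hsys z h₁ hg).2
  refine not_isConjugate_of_isolated hF hf0 hu' hv' hvc' hR h₀' hne' fun z hz => ?_
  by_cases hzne : z = z₀
  · subst hzne
    refine isConjugate_of_isolated hFc hf0.ne' hu' hv' h₀' ?_
    rw [eventually_nhdsWithin_iff]
    filter_upwards [ball_mem_nhds z hR] with y hy hyne using hconj y hy hyne
  · exact hconj z hz hzne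
end
end
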